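/- Let d ≥ 3 be an integer and let G⁺ be a plane multigraph in which each face is bounded by a cycle with length in {3, …, d}. Let T be a spanning tree of G⁺ rooted at a vertex r on the boundary of the outer face of G⁺. Assume there is a vertical path P in T with end-vertices p₁ and p₂ such that the cycle C obtained from P by adding the edge p₁p₂ is a subgraph of G⁺ − r. Let G be the plane graph consisting of all vertices and edges of G⁺ contained in C and the interior of C. Then G^{(d)} has an H-partition P such that P ∈ P and each part S_i ∈ P \ {P} has a partition {X_i, Y_i} where |X_i| ≤ d − 3 and Y_i is the union of at most three vertical paths in T, and H is planar with treewidth at most 3. -/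

import Mathlib

/-!
Common definitions: multigraphs, combinatorial (cellular) surface embeddings,
Euler genus, framed graphs, strong products, treewidth, partitions and layerings.
-/

/-- A multigraph on vertex type `V` with edge type `E`, given by its endpoints map. -/
structure Multigraph (V E : Type) where
  ends : E → Sym2 V

namespace Multigraph

variable {V E F : Type}

/-- The simple graph underlying a multigraph. -/
def simple (G : Multigraph V E) : SimpleGraph V where
  Adj u v := u ≠ v ∧ ∃ e, G.ends e = s(u, v)
  symm := by
    constructor
    rintro u v ⟨hne, e, he⟩
    exact ⟨hne.symm, e, he.trans Sym2.eq_swap⟩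
  loopless := by constructor; rintro u ⟨hne, -⟩; exact hne rfl

/-- The simple graph on `V` whose edges are the edges of `G` lying in `S`. -/
def simpleOn (G : Multigraph V E) (S : Set E) : SimpleGraph V where
  Adj u v := u ≠ v ∧ ∃ e ∈ S, G.ends e = s(u, v)
  symm := by
    constructor
    rintro u v ⟨hne, e, heS, he⟩
    exact ⟨hne.symm, e, heS, he.trans Sym2.eq_swap⟩
  loopless := by constructor; rintro u ⟨hne, -⟩; exact hne rfl

/-- A multigraph is simple: no loops and no parallel edges. -/
def IsSimple (G : Multigraph V E) : Prop :=
  (∀ e, ¬ (G.ends e).IsDiag) ∧ Function.Injective G.ends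

/-- A set `S` of edges of `G` forms a spanning tree of `G`. -/
def IsSpanningTree (G : Multigraph V E) (S : Set E) : Prop :=
  (G.simpleOn S).IsTree ∧ (∀ e ∈ S, ¬ (G.ends e).IsDiag) ∧
    ∀ e ∈ S, ∀ e' ∈ S, G.ends e = G.ends e' → e = e'

/-- A closed walk in a multigraph, recorded as periodic sequences of vertices and
edges: the walk visits `vtx 0, vtx 1, …, vtx (len - 1)` and returns to
`vtx len = vtx 0`, traversing the edge `edge i` between `vtx i` and `vtx (i+1)`. -/
structure CWalk (G : Multigraph V E) where
  len : ℕ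
  len_pos : 0 < len
  vtx : ℕ → V
  edge : ℕ → E
  vtx_per : ∀ i, vtx (i + len) = vtx i
  edge_per : ∀ i, edge (i + len) = edge i
  compat : ∀ i, G.ends (edge i) = s(vtx i, vtx (i + 1))

namespace CWalk

variable {G : Multigraph V E}

/-- The vertex `v` lies on the closed walk `W`. -/
def HasVtx (W : G.CWalk) (v : V) : Prop := ∃ i, i < W.len ∧ W.vtx i = v

/-- The edge `e` lies on the closed walk `W`. -/
def HasEdge (W : G.CWalk) (e : E) : Prop := ∃ i, i < W.len ∧ W.edge i = e

/-- The closed walk `W` is a cycle: it repeats no vertex and no edge. -/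
def IsCycle (W : G.CWalk) : Prop :=
  (∀ i j, i < W.len → j < W.len → W.vtx i = W.vtx j → i = j) ∧
  (∀ i j, i < W.len → j < W.len → W.edge i = W.edge j → i = j)

end CWalk

/-- `p = (f, i)` is an occurrence of the edge `e` in the family `bd` of closed walks:
the walk of face `f` traverses `e` at position `i`. -/
def IsOcc {G : Multigraph V E} (bd : F → G.CWalk) (e : E) (p : F × ℕ) : Prop :=
  p.2 < (bd p.1).len ∧ (bd p.1).edge p.2 = e

/-- `c = (f, i)` is a corner of the vertex `v`: the walk of face `f` visits `v`
at position `i`. -/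
def IsCorner {G : Multigraph V E} (bd : F → G.CWalk) (v : V) (c : F × ℕ) : Prop :=
  c.2 < (bd c.1).len ∧ (bd c.1).vtx c.2 = v

/-- The corner `c` is one of the two end corners of the edge occurrence `p`. -/
def EndOf {G : Multigraph V E} (bd : F → G.CWalk) (c p : F × ℕ) : Prop :=
  c.1 = p.1 ∧ (c.2 = p.2 ∨ c.2 = (p.2 + 1) % (bd p.1).len)

/-- Two corners of `v` are linked if they are end corners (at `v`) of the two
distinct occurrences of a common edge; this is the edge-to-edge gluing relation
around the vertex `v`. -/
def CornerLinked {G : Multigraph V E} (bd : F → G.CWalk) (v : V) (c c' : F × ℕ) : Prop :=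
  IsCorner bd v c ∧ IsCorner bd v c' ∧
    ∃ (e : E) (p p' : F × ℕ), p ≠ p' ∧ IsOcc bd e p ∧ IsOcc bd e p' ∧
      EndOf bd c p ∧ EndOf bd c' p'

/-- A combinatorial (cellular) embedding of a connected multigraph `G` in a closed
surface, with face set `F`: every face is given by its closed boundary walk, every
edge of `G` is traversed exactly twice in total by the boundary walks, and the link
of every vertex is connected (so the embedding is in a genuine surface, with no
pinch points). -/
structure Embedding (G : Multigraph V E) (F : Type) where
  boundary : F → G.CWalk
  conn : G.simple.Connected
  edge_twice : ∀ e : E, {p : F × ℕ | IsOcc boundary e p}.ncard = 2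
  link_conn : ∀ (v : V) (c c' : F × ℕ), IsCorner boundary v c → IsCorner boundary v c' →
    Relation.EqvGen (CornerLinked boundary v) c c'

/-- The Euler genus `2 - (|V| - |E| + |F|)` of an embedding, via Euler's formula. -/
noncomputable def Embedding.eulerGenus {G : Multigraph V E} {F : Type}
    (_ : Embedding G F) : ℤ :=
  2 - ((Nat.card V : ℤ) - Nat.card E + Nat.card F)

/-- The simple graph underlying the framed multigraph `G^{(d)}`: two distinct
vertices are adjacent iff they are joined by an edge of `G` or lie on a common
face of length at most `d` (in which case `G^{(d)}` has a chord between them). -/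
def framedGraph {G : Multigraph V E} {F : Type} (emb : Embedding G F) (d : ℕ) :
    SimpleGraph V where
  Adj u v := u ≠ v ∧ ((∃ e, G.ends e = s(u, v)) ∨
    ∃ f, (emb.boundary f).len ≤ d ∧ (emb.boundary f).HasVtx u ∧ (emb.boundary f).HasVtx v)
  symm := by
    constructor
    rintro u v ⟨hne, (⟨e, he⟩ | ⟨f, h1, h2, h3⟩)⟩
    · exact ⟨hne.symm, Or.inl ⟨e, he.trans Sym2.eq_swap⟩⟩
    · exact ⟨hne.symm, Or.inr ⟨f, h1, h3, h2⟩⟩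
  loopless := by constructor; rintro u ⟨hne, -⟩; exact hne rfl

end Multigraph

namespace SimpleGraph

/-- `G` is contained in `X`: `G` is isomorphic to a subgraph of `X`. -/
def IsContainedIn {α β : Type} (G : SimpleGraph α) (X : SimpleGraph β) : Prop :=
  ∃ f : G →g X, Function.Injective f

/-- The strong product of two simple graphs. -/
def strongProd {α β : Type} (G : SimpleGraph α) (H : SimpleGraph β) :
    SimpleGraph (α × β) where
  Adj x y := x ≠ y ∧ (x.1 = y.1 ∨ G.Adj x.1 y.1) ∧ (x.2 = y.2 ∨ H.Adj x.2 y.2)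
  symm := by
    constructor
    rintro x y ⟨hne, h1, h2⟩
    exact ⟨hne.symm, h1.imp Eq.symm (fun h => G.adj_symm h), h2.imp Eq.symm (fun h => H.adj_symm h)⟩
  loopless := by constructor; rintro x ⟨hne, -⟩; exact hne rfl

end SimpleGraph

/-- `G` has treewidth at most `k`: it has a tree-decomposition with all bags of
size at most `k + 1`. -/
def TreewidthLE {α : Type} (G : SimpleGraph α) (k : ℕ) : Prop :=
  ∃ (ι : Type) (T : SimpleGraph ι) (B : ι → Set α),
    T.IsTree ∧
    (∀ v, ∃ i, v ∈ B i) ∧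
    (∀ u v, G.Adj u v → ∃ i, u ∈ B i ∧ v ∈ B i) ∧
    (∀ v, (T.induce {i | v ∈ B i}).Connected) ∧
    ∀ i, (B i).encard ≤ (k : ℕ∞) + 1

/-- `G` has Euler genus at most `g`: `G` is (isomorphic to) a subgraph of a
multigraph having a combinatorial embedding of Euler genus at most `g`. -/
def HasEulerGenusLE {α : Type} (G : SimpleGraph α) (g : ℕ) : Prop :=
  ∃ (V' E' F' : Type), Finite V' ∧ Finite E' ∧ Finite F' ∧
    ∃ (M : Multigraph V' E') (emb : M.Embedding F'),
      emb.eulerGenus ≤ (g : ℤ) ∧ G.IsContainedIn M.simple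

/-- A planar graph: a graph of Euler genus `0`. -/
def IsPlanar {α : Type} (G : SimpleGraph α) : Prop := HasEulerGenusLE G 0

/-- An apex graph: deleting some vertex leaves a planar graph. -/
def IsApex {α : Type} (G : SimpleGraph α) : Prop :=
  ∃ v : α, IsPlanar (G.induce {w | w ≠ v})

/-- `A` indexes a partition of the vertices of `G` into nonempty parts `A x`, and the
quotient of `G` by this partition is (isomorphic to) `H`, via the indexing: this is an
`H`-partition of `G`. -/
def IsHPartition {α W : Type} (G : SimpleGraph α) (H : SimpleGraph W) (A : W → Set α) : Prop :=
  (∀ x, (A x).Nonempty) ∧ (∀ v, ∃! x, v ∈ A x) ∧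
    ∀ x y, x ≠ y → (H.Adj x y ↔ ∃ u ∈ A x, ∃ v ∈ A y, G.Adj u v)

/-- `(L 0, L 1, …)` is a layering of `G`: an ordered partition of the vertices such
that every edge joins vertices in the same or in consecutive layers. -/
def IsLayering {α : Type} (G : SimpleGraph α) (L : ℕ → Set α) : Prop :=
  (∀ v, ∃! j, v ∈ L j) ∧
    ∀ u v, G.Adj u v → ∀ i j, u ∈ L i → v ∈ L j → i ≤ j + 1 ∧ j ≤ i + 1

/-- `b` lies on every walk from `a` to `c` in `T` (for a tree: `b` is on the unique
`a`–`c` path). -/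
def BtwIn {α : Type} (T : SimpleGraph α) (a b c : α) : Prop :=
  ∀ p : T.Walk a c, b ∈ p.support

/-- `Q` is the vertex set of a vertical path in the tree `T` rooted at `r` with upper
end `w` and lower end `u`: `w` lies on the path from `r` to `u`, and `Q` is the set of
vertices of the `w`–`u` path. -/
def IsVerticalPathBtw {α : Type} (T : SimpleGraph α) (r : α) (Q : Set α) (w u : α) : Prop :=
  BtwIn T r w u ∧ Q = {x | BtwIn T w x u}

/-- `Q` is the vertex set of a vertical path in the tree `T` rooted at `r`. -/
def IsVerticalPath {α : Type} (T : SimpleGraph α) (r : α) (Q : Set α) : Prop :=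
  ∃ w u, IsVerticalPathBtw T r Q w u

/-- `Y` is the union of at most `k` vertical paths in the tree `T` rooted at `r`. -/
def IsUnionOfVPaths {α : Type} (T : SimpleGraph α) (r : α) (k : ℕ) (Y : Set α) : Prop :=
  ∃ m, m ≤ k ∧ ∃ Q : Fin m → Set α, (∀ i, IsVerticalPath T r (Q i)) ∧ Y = ⋃ i, Q i

namespace Multigraph

variable {V E F : Type}

/-- The faces of the embedding that cannot be reached from the outer face `fout`
without crossing an edge of `EC`: the faces lying in the interior of the cycle with
edge set `EC`. -/
def interiorFaces {G : Multigraph V E} (emb : Embedding G F) (EC : Set E) (fout : F) :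
    Set F :=
  {f | ¬ Relation.ReflTransGen
    (fun f₁ f₂ => ∃ e, e ∉ EC ∧ (emb.boundary f₁).HasEdge e ∧ (emb.boundary f₂).HasEdge e)
    fout f}

/-- The simple graph underlying `G'^{(d)}`, where `G'` is the plane subgraph of the
embedded multigraph consisting of the cycle `C` (with edge set `EC` and vertex set `P`)
and everything embedded in the interior of `C`: two distinct vertices are adjacent iff
they are joined by an edge of `G'` (an edge of `EC`, or an edge all of whose face
occurrences are at interior faces), or they lie on a common interior face of length at
most `d`, or `C` has length at most `d` and both lie on `C`. -/
def innerFramedGraph {G : Multigraph V E} (emb : Embedding G F) (d : ℕ)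
    (EC : Set E) (fout : F) (P : Set V) : SimpleGraph V where
  Adj u v := u ≠ v ∧
    ((∃ e, (e ∈ EC ∨ ∀ f, (emb.boundary f).HasEdge e → f ∈ interiorFaces emb EC fout) ∧
        G.ends e = s(u, v)) ∨
     (∃ f ∈ interiorFaces emb EC fout, (emb.boundary f).len ≤ d ∧
        (emb.boundary f).HasVtx u ∧ (emb.boundary f).HasVtx v) ∨
     (P.ncard ≤ d ∧ u ∈ P ∧ v ∈ P))
  symm := by
    constructor
    rintro u v ⟨hne, (⟨e, he1, he2⟩ | ⟨f, h1, h2, h3, h4⟩ | ⟨h1, h2, h3⟩)⟩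
    · exact ⟨hne.symm, Or.inl ⟨e, he1, he2.trans Sym2.eq_swap⟩⟩
    · exact ⟨hne.symm, Or.inr (Or.inl ⟨f, h1, h2, h4, h3⟩)⟩
    · exact ⟨hne.symm, Or.inr (Or.inr ⟨h1, h3, h2⟩)⟩
  loopless := by constructor; rintro u ⟨hne, -⟩; exact hne rfl

end Multigraph


structure Sph (N L D : Type) [Fintype N] [Fintype L] [Fintype D] where
  e1 : L → N
  e2 : L → N
  ne : ∀ l, e1 l ≠ e2 l
  c0 : D → N
  c1 : D → N
  c2 : D → N
  l0 : D → L
  l1 : D → L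
  l2 : D → L
  h0 : ∀ t, s(e1 (l0 t), e2 (l0 t)) = s(c0 t, c1 t)
  h1 : ∀ t, s(e1 (l1 t), e2 (l1 t)) = s(c1 t, c2 t)
  h2 : ∀ t, s(e1 (l2 t), e2 (l2 t)) = s(c2 t, c0 t)
  d01 : ∀ t, l0 t ≠ l1 t
  d12 : ∀ t, l1 t ≠ l2 t
  d20 : ∀ t, l2 t ≠ l0 t
  two : ∀ l, ∃ t1 t2, t1 ≠ t2 ∧ ∀ t, (l = l0 t ∨ l = l1 t ∨ l = l2 t) ↔ (t = t1 ∨ t = t2)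
  star : ∀ (x : N) (Dv : D → ZMod 2),
    (∀ l, (e1 l = x ∨ e2 l = x) → ∀ t t', (l = l0 t ∨ l = l1 t ∨ l = l2 t) →
      (l = l0 t' ∨ l = l1 t' ∨ l = l2 t') → Dv t = Dv t') →
    ∀ t t', (x = c0 t ∨ x = c1 t ∨ x = c2 t) → (x = c0 t' ∨ x = c1 t' ∨ x = c2 t') → Dv t = Dv t'
  conn : ∀ x y, Relation.ReflTransGen (fun a b => ∃ l, s(e1 l, e2 l) = s(a, b)) x y
  euler : Fintype.card N + Fintype.card D = Fintype.card L + 2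

namespace Sph

variable {N L D : Type} [Fintype N] [Fintype L] [Fintype D] (K : Sph N L D)

def Adj (a b : N) : Prop := ∃ l, s(K.e1 l, K.e2 l) = s(a, b)
def inc (l : L) (t : D) : Prop := l = K.l0 t ∨ l = K.l1 t ∨ l = K.l2 t
def cor (x : N) (t : D) : Prop := x = K.c0 t ∨ x = K.c1 t ∨ x = K.c2 t

def ConnS (s : Set N) : Prop :=
  ∀ x ∈ s, ∀ y ∈ s, Relation.ReflTransGen (fun a b => a ∈ s ∧ b ∈ s ∧ K.Adj a b) x y

variable {K}

theorem Adj.symm {a b : N} (h : K.Adj a b) : K.Adj b a := by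
  obtain ⟨l, hl⟩ := h
  exact ⟨l, hl.trans Sym2.eq_swap⟩

theorem Adj.ne {a b : N} (h : K.Adj a b) : a ≠ b := by
  obtain ⟨l, hl⟩ := h
  rintro rfl
  have := K.ne l
  simp only [Sym2.eq_iff] at hl
  rcases hl with ⟨h1, h2⟩ | ⟨h1, h2⟩ <;> exact this (h1.trans h2.symm)

theorem exists_inc (l : L) : ∃ t, K.inc l t := by
  obtain ⟨t1, t2, _, h⟩ := K.two l
  exact ⟨t1, (h t1).2 (Or.inl rfl)⟩

theorem cor_of_inc {l : L} {t : D} {a b : N} (h : K.inc l t) (hl : s(K.e1 l, K.e2 l) = s(a, b)) :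
    K.cor a t ∧ K.cor b t := by
  have H0 := K.h0 t
  have H1 := K.h1 t
  have H2 := K.h2 t
  unfold cor
  rcases h with rfl | rfl | rfl
  · rw [hl] at H0
    simp only [Sym2.eq_iff] at H0
    tauto
  · rw [hl] at H1
    simp only [Sym2.eq_iff] at H1
    tauto
  · rw [hl] at H2
    simp only [Sym2.eq_iff] at H2
    tauto

theorem adj_of_cor {t : D} {a b : N} (ha : K.cor a t) (hb : K.cor b t) (hab : a ≠ b) :
    K.Adj a b := by
  have H0 := K.h0 t
  have H1 := K.h1 t
  have H2 := K.h2 t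
  rcases ha with rfl | rfl | rfl <;> rcases hb with rfl | rfl | rfl <;>
    first
      | exact absurd rfl hab
      | exact ⟨_, H0⟩
      | exact ⟨_, H1⟩
      | exact ⟨_, H2⟩
      | exact ⟨_, H0.trans Sym2.eq_swap⟩
      | exact ⟨_, H1.trans Sym2.eq_swap⟩
      | exact ⟨_, H2.trans Sym2.eq_swap⟩

theorem exists_tri {a b : N} (h : K.Adj a b) : ∃ t, K.cor a t ∧ K.cor b t := by
  obtain ⟨l, hl⟩ := h
  obtain ⟨t, ht⟩ := K.exists_inc l
  exact ⟨t, cor_of_inc ht hl⟩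

/-- distinct corners have three links -/
theorem three_links {t : D} {x y z : N} (hx : K.cor x t) (hy : K.cor y t) (hz : K.cor z t)
    (hxy : x ≠ y) (hyz : y ≠ z) (hzx : z ≠ x) :
    ∃ a b c, s(K.e1 a, K.e2 a) = s(x, y) ∧ s(K.e1 b, K.e2 b) = s(y, z) ∧
      s(K.e1 c, K.e2 c) = s(z, x) ∧
      ∀ g : L → ZMod 2, g a + g b + g c = g (K.l0 t) + g (K.l1 t) + g (K.l2 t) := by
  have H0 := K.h0 t
  have H1 := K.h1 t
  have H2 := K.h2 t
  have H0' := H0.trans Sym2.eq_swap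
  have H1' := H1.trans Sym2.eq_swap
  have H2' := H2.trans Sym2.eq_swap
  rcases hx with rfl | rfl | rfl <;> rcases hy with rfl | rfl | rfl <;>
    rcases hz with rfl | rfl | rfl <;>
    first
      | exact absurd rfl hxy
      | exact absurd rfl hyz
      | exact absurd rfl hzx
      | exact ⟨_, _, _, H0, H1, H2, fun g => by ring⟩
      | exact ⟨_, _, _, H1, H2, H0, fun g => by ring⟩
      | exact ⟨_, _, _, H2, H0, H1, fun g => by ring⟩
      | exact ⟨_, _, _, H0', H2', H1', fun g => by ring⟩
      | exact ⟨_, _, _, H1', H0', H2', fun g => by ring⟩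
      | exact ⟨_, _, _, H2', H1', H0', fun g => by ring⟩

theorem constOn {Y : Set N} (hY : K.ConnS Y) (Dv : D → ZMod 2)
    (h : ∀ l, (K.e1 l ∈ Y ∨ K.e2 l ∈ Y) → ∀ t t', K.inc l t → K.inc l t' → Dv t = Dv t')
    {x y : N} (hx : x ∈ Y) (hy : y ∈ Y) {t t' : D} (ht : K.cor x t) (ht' : K.cor y t') :
    Dv t = Dv t' := by
  have key : ∀ y, Relation.ReflTransGen (fun a b => a ∈ Y ∧ b ∈ Y ∧ K.Adj a b) x y →
      y ∈ Y → ∀ t', K.cor y t' → Dv t = Dv t' := by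
    intro y hr
    induction hr with
    | refl =>
      intro hy t' ht'
      refine K.star x Dv ?_ t t' ht ht'
      intro l hl
      refine h l ?_
      rcases hl with rfl | rfl
      · exact Or.inl hx
      · exact Or.inr hx
    | tail _ hbc ih =>
      rename_i b c _
      intro hc t' ht'
      obtain ⟨hb, _, hadj⟩ := hbc
      obtain ⟨t2, h1, h2⟩ := exists_tri hadj
      rw [ih hb t2 h1]
      refine K.star c Dv ?_ t2 t' h2 ht'
      intro l hl
      refine h l ?_
      rcases hl with rfl | rfl
      · exact Or.inl hc
      · exact Or.inr hc
  exact key y (hY x hx y hy) hy t' ht'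

theorem connS_univ : K.ConnS Set.univ := by
  intro x _ y _
  have := K.conn x y
  induction this with
  | refl => exact .refl
  | tail _ h ih => exact (ih trivial).tail ⟨trivial, trivial, h⟩

variable (K)

def d0 : (N → ZMod 2) →ₗ[ZMod 2] (L → ZMod 2) where
  toFun h l := h (K.e1 l) + h (K.e2 l)
  map_add' := by intros; funext l; simp; ring
  map_smul' := by intros; funext l; simp; ring

def d1 : (L → ZMod 2) →ₗ[ZMod 2] (D → ZMod 2) where
  toFun g t := g (K.l0 t) + g (K.l1 t) + g (K.l2 t)
  map_add' := by intros; funext l; simp; ring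
  map_smul' := by intros; funext l; simp; ring

variable {K}

theorem d0_apply (h : N → ZMod 2) (l : L) {a b : N} (hl : s(K.e1 l, K.e2 l) = s(a, b)) :
    K.d0 h l = h a + h b := by
  simp only [Sym2.eq_iff] at hl
  rcases hl with ⟨h1, h2⟩ | ⟨h1, h2⟩
  · simp [d0, h1, h2]
  · simp [d0, h1, h2, add_comm]

theorem d1_apply (g : L → ZMod 2) (t : D) :
    K.d1 g t = g (K.l0 t) + g (K.l1 t) + g (K.l2 t) := rfl

theorem z2 (a : ZMod 2) : a + a = 0 := CharTwo.add_self_eq_zero a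

theorem d1_d0 (h : N → ZMod 2) : K.d1 (K.d0 h) = 0 := by
  funext t
  rw [d1_apply, d0_apply h _ (K.h0 t), d0_apply h _ (K.h1 t), d0_apply h _ (K.h2 t)]
  have : h (K.c0 t) + h (K.c1 t) + (h (K.c1 t) + h (K.c2 t)) + (h (K.c2 t) + h (K.c0 t)) =
    (h (K.c0 t) + h (K.c0 t)) + (h (K.c1 t) + h (K.c1 t)) + (h (K.c2 t) + h (K.c2 t)) := by ring
  rw [this]; simp [z2]

open Classical in
theorem pair_single (Dv : D → ZMod 2) (l : L) {t1 t2 : D} (hne : t1 ≠ t2)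
    (h : ∀ t, (l = K.l0 t ∨ l = K.l1 t ∨ l = K.l2 t) ↔ (t = t1 ∨ t = t2)) :
    ∑ t, Dv t * K.d1 (Pi.single l 1) t = Dv t1 + Dv t2 := by
  have e : ∀ t, K.d1 (Pi.single l 1) t = if t = t1 ∨ t = t2 then 1 else 0 := by
    intro t
    rw [d1_apply]
    have a := K.d01 t
    have b := K.d12 t
    have c := K.d20 t
    simp only [Pi.single_apply]
    by_cases ht : (t = t1 ∨ t = t2)
    · rw [if_pos ht]
      rcases (h t).2 ht with r | r | r
      · subst r; simp [a.symm, c]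
      · subst r; simp [a, b.symm]
      · subst r; simp [b, c.symm]
    · rw [if_neg ht]
      have := mt (h t).1 ht
      push Not at this
      simp [this.1.symm, this.2.1.symm, this.2.2.symm]
  simp only [e, mul_ite, mul_one, mul_zero]
  rw [← Finset.sum_filter]
  have : (Finset.univ.filter (fun t => t = t1 ∨ t = t2)) = {t1, t2} := by
    ext t; simp
  rw [this, Finset.sum_pair hne]

open Classical in
theorem agree_of_pair (Dv : D → ZMod 2) (l : L)
    (h : ∑ t, Dv t * K.d1 (Pi.single l 1) t = 0) :
    ∀ t t', K.inc l t → K.inc l t' → Dv t = Dv t' := by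
  obtain ⟨t1, t2, hne, h2⟩ := K.two l
  rw [pair_single Dv l hne h2] at h
  have h12 : Dv t1 = Dv t2 := by
    exact CharTwo.add_eq_zero.1 h
  intro t t' ht ht'
  rcases (h2 t).1 ht with rfl | rfl <;> rcases (h2 t').1 ht' with rfl | rfl <;> simp [h12]

theorem const_of_pair (Dv : D → ZMod 2)
    (h : ∀ g, ∑ t, Dv t * K.d1 g t = 0) (t t' : D) : Dv t = Dv t' := by
  classical
  exact constOn (K := K) connS_univ Dv (fun l _ => agree_of_pair Dv l (h _)) (x := K.c0 t)
    (y := K.c0 t') trivial trivial (Or.inl rfl) (Or.inl rfl)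

theorem sum_d1 (g : L → ZMod 2) : ∑ t, K.d1 g t = 0 := by
  classical
  have : g = ∑ l, g l • (Pi.single l 1 : L → ZMod 2) := by
    funext l'
    simp [Finset.sum_apply, Pi.single_apply]
  rw [this, map_sum]
  simp only [Finset.sum_apply]
  rw [Finset.sum_comm]
  refine Finset.sum_eq_zero fun l _ => ?_
  simp only [map_smul, Pi.smul_apply, ← Finset.smul_sum]
  obtain ⟨t1, t2, hne, h2⟩ := K.two l
  have := pair_single (K := K) (fun _ => 1) l hne h2
  simp only [one_mul] at this
  rw [this, z2, smul_zero]

theorem ker_d0_le (h : N → ZMod 2) (h0 : K.d0 h = 0) (x y : N) : h x = h y := by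
  have := K.conn x y
  induction this with
  | refl => rfl
  | tail _ hbc ih =>
    obtain ⟨l, hl⟩ := hbc
    have := congrFun h0 l
    rw [d0_apply h l hl] at this
    rw [ih]
    exact CharTwo.add_eq_zero.1 this

theorem dual_eq_sum (ψ : Module.Dual (ZMod 2) (D → ZMod 2)) [DecidableEq D] (g : D → ZMod 2) :
    ψ g = ∑ t, ψ (Pi.single t 1) * g t := by
  conv_lhs => rw [show g = ∑ t, g t • (Pi.single t 1 : D → ZMod 2) by
    funext l'
    simp [Finset.sum_apply, Pi.single_apply]]
  rw [map_sum]
  refine Finset.sum_congr rfl fun t _ => ?_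
  simp [mul_comm]

theorem finrank_le_one_of_const {M : Type} [Fintype M] (S : Submodule (ZMod 2) (M → ZMod 2))
    (h : ∀ f ∈ S, ∀ x y, f x = f y) : Module.finrank (ZMod 2) S ≤ 1 := by
  have : S ≤ Submodule.span (ZMod 2) {(fun _ => 1 : M → ZMod 2)} := by
    intro f hf
    rw [Submodule.mem_span_singleton]
    by_cases hM : Nonempty M
    · obtain ⟨m⟩ := hM
      exact ⟨f m, by funext x; simp [h f hf x m]⟩
    · exact ⟨0, by funext x; exact absurd ⟨x⟩ hM⟩
  exact (Submodule.finrank_mono this).trans (finrank_span_le_card _ |>.trans (by simp))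

theorem H1 : LinearMap.ker K.d1 = LinearMap.range K.d0 := by
  classical
  symm
  apply Submodule.eq_of_le_of_finrank_le
  · rintro _ ⟨h, rfl⟩
    exact d1_d0 h
  have a0 := LinearMap.finrank_range_add_finrank_ker K.d0
  have a1 := LinearMap.finrank_range_add_finrank_ker K.d1
  have a2 := LinearMap.finrank_range_add_finrank_ker K.d1.dualMap
  have a3 := LinearMap.finrank_range_dualMap_eq_finrank_range K.d1
  have k0 : Module.finrank (ZMod 2) (LinearMap.ker K.d0) ≤ 1 :=
    finrank_le_one_of_const _ (fun f hf x y => ker_d0_le f hf x y)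
  have k1 : Module.finrank (ZMod 2) (LinearMap.ker K.d1.dualMap) ≤ 1 := by
    have : LinearMap.ker K.d1.dualMap ≤
        Submodule.span (ZMod 2) {(∑ t, LinearMap.proj t : Module.Dual (ZMod 2) (D → ZMod 2))} := by
      intro ψ hψ
      rw [Submodule.mem_span_singleton]
      have hc := const_of_pair (K := K) (fun t => ψ (Pi.single t 1)) (by
        intro g
        rw [← dual_eq_sum]
        have := LinearMap.congr_fun hψ g
        simpa using this)
      by_cases hM : Nonempty D
      · obtain ⟨m⟩ := hM
        refine ⟨ψ (Pi.single m 1), ?_⟩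
        ext t
        simpa [Finset.sum_pi_single', LinearMap.sum_apply, Pi.single_apply] using hc m t
      · refine ⟨0, ?_⟩
        ext t
        exact absurd ⟨t⟩ hM
    exact (Submodule.finrank_mono this).trans (finrank_span_le_card _ |>.trans (by simp))
  rw [Subspace.dual_finrank_eq] at a2
  simp only [Module.finrank_fintype_fun_eq_card] at *
  have := K.euler
  omega

theorem fill (φ : Module.Dual (ZMod 2) (L → ZMod 2)) (h : ∀ f, φ (K.d0 f) = 0) (t0 : D) :
    ∃ Dv : D → ZMod 2, Dv t0 = 0 ∧ ∀ g, φ g = ∑ t, Dv t * K.d1 g t := by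
  classical
  have : φ ∈ LinearMap.range K.d1.dualMap := by
    rw [LinearMap.range_dualMap_eq_dualAnnihilator_ker, Submodule.mem_dualAnnihilator, H1]
    rintro _ ⟨f, rfl⟩
    exact h f
  obtain ⟨ψ, rfl⟩ := this
  refine ⟨fun t => ψ (Pi.single t 1) + ψ (Pi.single t0 1), z2 _, fun g => ?_⟩
  simp only [add_mul, Finset.sum_add_distrib, ← Finset.mul_sum, sum_d1]
  rw [← dual_eq_sum]
  simp

theorem pathFun {s : Set N} {x y : N}
    (h : Relation.ReflTransGen (fun a b => a ∈ s ∧ b ∈ s ∧ K.Adj a b) x y) :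
    ∃ φ : Module.Dual (ZMod 2) (L → ZMod 2), (∀ f, φ (K.d0 f) = f x + f y) ∧
      ∀ g, (∀ l, K.e1 l ∈ s → K.e2 l ∈ s → g l = 0) → φ g = 0 := by
  induction h with
  | refl => exact ⟨0, fun f => by simp [z2], fun g _ => rfl⟩
  | tail _ hbc ih =>
    obtain ⟨φ, h1, h2⟩ := ih
    obtain ⟨hb, hc, l, hl⟩ := hbc
    refine ⟨φ + LinearMap.proj l, fun f => ?_, fun g hg => ?_⟩
    · rename_i b c _
      rw [LinearMap.add_apply, h1, LinearMap.proj_apply, d0_apply f l hl]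
      have : f x + f b + (f b + f c) = f x + (f b + f b) + f c := by ring
      rw [this, z2]; simp
    · rw [LinearMap.add_apply, h2 g hg, LinearMap.proj_apply, hg l, add_zero]
      · simp only [Sym2.eq_iff] at hl
        rcases hl with ⟨h1, h2⟩ | ⟨h1, h2⟩ <;> rw [h1] <;> assumption
      · simp only [Sym2.eq_iff] at hl
        rcases hl with ⟨h1, h2⟩ | ⟨h1, h2⟩ <;> rw [h2] <;> assumption

theorem half {C X : Set N} (hC : K.ConnS C) (hX : K.ConnS X) {x b : N} (hx : x ∈ C) (hb : b ∈ X)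
    (hadj : ∃ p ∈ X, ∃ q ∈ C, K.Adj p q) :
    ∃ (φ : Module.Dual (ZMod 2) (L → ZMod 2)) (m : L) (p q : N), p ∈ X ∧ q ∈ C ∧
      s(K.e1 m, K.e2 m) = s(p, q) ∧
      (∀ f, φ (K.d0 f) = f x + f b) ∧
      ∀ g, (∀ l, K.e1 l ∈ C → K.e2 l ∈ C → g l = 0) →
        (∀ l, K.e1 l ∈ X → K.e2 l ∈ X → g l = 0) → φ g = g m := by
  obtain ⟨p, hp, q, hq, m, hm⟩ := hadj
  obtain ⟨φ1, a1, b1⟩ := pathFun (hC x hx q hq)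
  obtain ⟨φ2, a2, b2⟩ := pathFun (hX p hp b hb)
  refine ⟨φ1 + LinearMap.proj m + φ2, m, p, q, hp, hq, hm, fun f => ?_, fun g h1 h2 => ?_⟩
  · simp only [LinearMap.add_apply, a1, a2, LinearMap.proj_apply, d0_apply f m hm]
    have : f x + f q + (f p + f q) + (f p + f b) = f x + (f q + f q) + (f p + f p) + f b := by ring
    rw [this, z2, z2]; simp
  · simp [b1 g h1, b2 g h2]

end Sph


namespace Sph
variable {N L D : Type} [Fintype N] [Fintype L] [Fintype D] {K : Sph N L D}

theorem mem_ends {l : L} {a b : N} (hl : s(K.e1 l, K.e2 l) = s(a, b)) (s : Set N)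
    (ha : a ∈ s) (hb : b ∈ s) : K.e1 l ∈ s ∧ K.e2 l ∈ s := by
  simp only [Sym2.eq_iff] at hl
  rcases hl with ⟨h1, h2⟩ | ⟨h1, h2⟩ <;> rw [h1, h2] <;> tauto

/-- one of the three cycles of the theta graph -/
theorem thetaAux {Ca Cb X : Set N} {xa xb b : N} {ma mb lab : L} {pa qa pb qb : N} {τ : D}
    {φa φb : Module.Dual (ZMod 2) (L → ZMod 2)}
    (hxa : xa ∈ Ca) (hxb : xb ∈ Cb)
    (hpa : pa ∈ X) (hqa : qa ∈ Ca) (hma : s(K.e1 ma, K.e2 ma) = s(pa, qa))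
    (fa : ∀ f, φa (K.d0 f) = f xa + f b)
    (ga : ∀ g, (∀ l, K.e1 l ∈ Ca → K.e2 l ∈ Ca → g l = 0) →
        (∀ l, K.e1 l ∈ X → K.e2 l ∈ X → g l = 0) → φa g = g ma)
    (hpb : pb ∈ X) (hqb : qb ∈ Cb) (hmb : s(K.e1 mb, K.e2 mb) = s(pb, qb))
    (fb : ∀ f, φb (K.d0 f) = f xb + f b)
    (gb : ∀ g, (∀ l, K.e1 l ∈ Cb → K.e2 l ∈ Cb → g l = 0) →
        (∀ l, K.e1 l ∈ X → K.e2 l ∈ X → g l = 0) → φb g = g mb)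
    (hl : s(K.e1 lab, K.e2 lab) = s(xa, xb)) :
    ∃ Dv : D → ZMod 2, Dv τ = 0 ∧
      (∀ g, φa g + φb g + g lab = ∑ t, Dv t * K.d1 g t) ∧
      (∀ l, ¬ (K.e1 l ∈ Ca ∪ Cb ∪ X ∧ K.e2 l ∈ Ca ∪ Cb ∪ X) →
        ∀ t t', K.inc l t → K.inc l t' → Dv t = Dv t') := by
  classical
  obtain ⟨Dv, h0, h1⟩ := fill (K := K) (φa + φb + LinearMap.proj lab) (by
    intro f
    simp only [LinearMap.add_apply, LinearMap.proj_apply, fa, fb, d0_apply f lab hl]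
    have : f xa + f b + (f xb + f b) + (f xa + f xb) =
      (f xa + f xa) + (f b + f b) + (f xb + f xb) := by ring
    rw [this]; simp [z2]) τ
  refine ⟨Dv, h0, fun g => by rw [← h1]; simp, fun l hl' => ?_⟩
  apply agree_of_pair
  rw [← h1]
  have za : ∀ m, (K.e1 m ∈ Ca ∪ Cb ∪ X ∧ K.e2 m ∈ Ca ∪ Cb ∪ X) →
      (Pi.single l 1 : L → ZMod 2) m = 0 := by
    intro m hm
    rw [Pi.single_apply, if_neg]
    rintro rfl
    exact hl' hm
  simp only [LinearMap.add_apply, LinearMap.proj_apply]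
  rw [ga, gb, za ma, za mb, za lab]
  · simp
  · exact mem_ends hl _ (by simp [hxa]) (by simp [hxb])
  · exact mem_ends hmb _ (by simp [hpb]) (by simp [hqb])
  · exact mem_ends hma _ (by simp [hpa]) (by simp [hqa])
  · intro m h1 h2; exact za m (by simp [h1, h2])
  · intro m h1 h2; exact za m (by simp [h1, h2])
  · intro m h1 h2; exact za m (by simp [h1, h2])
  · intro m h1 h2; exact za m (by simp [h1, h2])

theorem theta {Ca Cb Cc X : Set N} (ca : K.ConnS Ca) (cb : K.ConnS Cb) (cc : K.ConnS Cc)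
    (cX : K.ConnS X) (dab : Disjoint Ca Cb) (dbc : Disjoint Cb Cc) (dca : Disjoint Cc Ca)
    (dXa : Disjoint X Ca) (dXb : Disjoint X Cb) (dXc : Disjoint X Cc)
    (τ : D) (ta : ∃ x ∈ Ca, K.cor x τ) (tb : ∃ x ∈ Cb, K.cor x τ) (tc : ∃ x ∈ Cc, K.cor x τ)
    (aa : ∃ p ∈ X, ∃ q ∈ Ca, K.Adj p q) (ab : ∃ p ∈ X, ∃ q ∈ Cb, K.Adj p q)
    (ac : ∃ p ∈ X, ∃ q ∈ Cc, K.Adj p q) :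
    ∃ Dab Dbc Dca : D → ZMod 2,
      (∀ t, t ≠ τ → Dab t + Dbc t + Dca t = 1) ∧
      (∀ l, ¬ (K.e1 l ∈ Ca ∪ Cb ∪ X ∧ K.e2 l ∈ Ca ∪ Cb ∪ X) →
        ∀ t t', K.inc l t → K.inc l t' → Dab t = Dab t') ∧
      (∀ l, ¬ (K.e1 l ∈ Cb ∪ Cc ∪ X ∧ K.e2 l ∈ Cb ∪ Cc ∪ X) →
        ∀ t t', K.inc l t → K.inc l t' → Dbc t = Dbc t') ∧
      (∀ l, ¬ (K.e1 l ∈ Cc ∪ Ca ∪ X ∧ K.e2 l ∈ Cc ∪ Ca ∪ X) →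
        ∀ t t', K.inc l t → K.inc l t' → Dca t = Dca t') ∧
      (∀ x ∈ Cc, ∀ t, K.cor x t → Dab t = 0) ∧
      (∀ x ∈ Ca, ∀ t, K.cor x t → Dbc t = 0) ∧
      (∀ x ∈ Cb, ∀ t, K.cor x t → Dca t = 0) ∧
      (∃ m p q lab xa xb m' p' q', p ∈ X ∧ q ∈ Ca ∧ s(K.e1 m, K.e2 m) = s(p, q) ∧
        p' ∈ X ∧ q' ∈ Cb ∧ s(K.e1 m', K.e2 m') = s(p', q') ∧
        xa ∈ Ca ∧ xb ∈ Cb ∧ s(K.e1 lab, K.e2 lab) = s(xa, xb) ∧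
        ∀ g : L → ZMod 2,
         (∀ l, K.e1 l ∈ Ca → K.e2 l ∈ Ca → g l = 0) →
         (∀ l, K.e1 l ∈ Cb → K.e2 l ∈ Cb → g l = 0) →
         (∀ l, K.e1 l ∈ X → K.e2 l ∈ X → g l = 0) →
         ∑ t, Dab t * K.d1 g t = g m + g m' + g lab) := by
  classical
  obtain ⟨xa, hxa, txa⟩ := ta
  obtain ⟨xb, hxb, txb⟩ := tb
  obtain ⟨xc, hxc, txc⟩ := tc
  have nab : xa ≠ xb := fun h => Set.disjoint_left.1 dab hxa (h ▸ hxb)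
  have nbc : xb ≠ xc := fun h => Set.disjoint_left.1 dbc hxb (h ▸ hxc)
  have nca : xc ≠ xa := fun h => Set.disjoint_left.1 dca hxc (h ▸ hxa)
  obtain ⟨lab, lbc, lca, hab, hbc, hca, hsum⟩ := three_links txa txb txc nab nbc nca
  have hb : ∃ b, b ∈ X := ⟨_, aa.choose_spec.1⟩
  obtain ⟨b, hb⟩ := hb
  obtain ⟨φa, ma, pa, qa, hpa, hqa, hma, fa, ga⟩ := half ca cX hxa hb aa
  obtain ⟨φb, mb, pb, qb, hpb, hqb, hmb, fb, gb⟩ := half cb cX hxb hb ab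
  obtain ⟨φc, mc, pc, qc, hpc, hqc, hmc, fc, gc⟩ := half cc cX hxc hb ac
  obtain ⟨D1, t1, s1, u1⟩ :=
    thetaAux (τ := τ) hxa hxb hpa hqa hma fa ga hpb hqb hmb fb gb hab
  obtain ⟨D2, t2, s2, u2⟩ :=
    thetaAux (τ := τ) hxb hxc hpb hqb hmb fb gb hpc hqc hmc fc gc hbc
  obtain ⟨D3, t3, s3, u3⟩ :=
    thetaAux (τ := τ) hxc hxa hpc hqc hmc fc gc hpa hqa hma fa ga hca
  refine ⟨D1, D2, D3, ?_, u1, u2, u3, ?_, ?_, ?_, ?_⟩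
  · intro t ht
    have := const_of_pair (K := K) (fun t => D1 t + D2 t + D3 t + Pi.single (M := fun _ => ZMod 2) τ 1 t) (by
      intro g
      simp only [add_mul, Finset.sum_add_distrib, ← s1, ← s2, ← s3]
      have : ∑ x, Pi.single (M := fun _ => ZMod 2) τ 1 x * K.d1 g x = K.d1 g τ := by
        simp [Pi.single_apply]
      rw [this, d1_apply, ← hsum g]
      have : φa g + φb g + g lab + (φb g + φc g + g lbc) + (φc g + φa g + g lca) +
        (g lab + g lbc + g lca) = (φa g + φa g) + (φb g + φb g) + (φc g + φc g) +
        (g lab + g lab) + (g lbc + g lbc) + (g lca + g lca) := by ring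
      rw [this]; simp [z2]) t τ
    simpa [t1, t2, t3, ht] using this
  · intro x hx t ht
    rw [← t1]
    refine constOn cc D1 (fun l hl => u1 l ?_) hx hxc ht txc
    have : ∀ z ∈ Cc, z ∉ Ca ∪ Cb ∪ X := by
      rintro z hz ((h | h) | h)
      · exact Set.disjoint_left.1 dca hz h
      · exact Set.disjoint_left.1 dbc h hz
      · exact Set.disjoint_left.1 dXc h hz
    rintro ⟨h1, h2⟩
    rcases hl with h | h
    · exact this _ h h1
    · exact this _ h h2
  · intro x hx t ht
    rw [← t2]
    refine constOn ca D2 (fun l hl => u2 l ?_) hx hxa ht txa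
    have : ∀ z ∈ Ca, z ∉ Cb ∪ Cc ∪ X := by
      rintro z hz ((h | h) | h)
      · exact Set.disjoint_left.1 dab hz h
      · exact Set.disjoint_left.1 dca h hz
      · exact Set.disjoint_left.1 dXa h hz
    rintro ⟨h1, h2⟩
    rcases hl with h | h
    · exact this _ h h1
    · exact this _ h h2
  · intro x hx t ht
    rw [← t3]
    refine constOn cb D3 (fun l hl => u3 l ?_) hx hxb ht txb
    have : ∀ z ∈ Cb, z ∉ Cc ∪ Ca ∪ X := by
      rintro z hz ((h | h) | h)
      · exact Set.disjoint_left.1 dbc hz h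
      · exact Set.disjoint_left.1 dab h hz
      · exact Set.disjoint_left.1 dXb h hz
    rintro ⟨h1, h2⟩
    rcases hl with h | h
    · exact this _ h h1
    · exact this _ h h2
  · refine ⟨ma, pa, qa, lab, xa, xb, mb, pb, qb, hpa, hqa, hma, hpb, hqb, hmb, hxa, hxb, hab, ?_⟩
    intro g h1 h2 h3
    rw [← s1, ga g h1 h3, gb g h2 h3]

theorem K33 {Ca Cb Cc X Y : Set N} (ca : K.ConnS Ca) (cb : K.ConnS Cb) (cc : K.ConnS Cc)
    (cX : K.ConnS X) (cY : K.ConnS Y)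
    (dab : Disjoint Ca Cb) (dbc : Disjoint Cb Cc) (dca : Disjoint Cc Ca)
    (dXa : Disjoint X Ca) (dXb : Disjoint X Cb) (dXc : Disjoint X Cc)
    (dYa : Disjoint Y Ca) (dYb : Disjoint Y Cb) (dYc : Disjoint Y Cc) (dYX : Disjoint Y X)
    (τ : D) (ta : ∃ x ∈ Ca, K.cor x τ) (tb : ∃ x ∈ Cb, K.cor x τ) (tc : ∃ x ∈ Cc, K.cor x τ)
    (aa : ∃ p ∈ X, ∃ q ∈ Ca, K.Adj p q) (ab : ∃ p ∈ X, ∃ q ∈ Cb, K.Adj p q)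
    (ac : ∃ p ∈ X, ∃ q ∈ Cc, K.Adj p q)
    (ya : ∃ p ∈ Y, ∃ q ∈ Ca, K.Adj p q) (yb : ∃ p ∈ Y, ∃ q ∈ Cb, K.Adj p q)
    (yc : ∃ p ∈ Y, ∃ q ∈ Cc, K.Adj p q) : False := by
  obtain ⟨D1, D2, D3, hs, u1, u2, u3, v1, v2, v3, -⟩ :=
    theta ca cb cc cX dab dbc dca dXa dXb dXc τ ta tb tc aa ab ac
  have key : ∀ (A B C : Set N) (Dv : D → ZMod 2), Disjoint Y A → Disjoint Y B →
      (∀ l, ¬ (K.e1 l ∈ A ∪ B ∪ X ∧ K.e2 l ∈ A ∪ B ∪ X) →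
        ∀ t t', K.inc l t → K.inc l t' → Dv t = Dv t') →
      (∀ x ∈ C, ∀ t, K.cor x t → Dv t = 0) → (∃ p ∈ Y, ∃ q ∈ C, K.Adj p q) →
      ∀ x ∈ Y, ∀ t, K.cor x t → Dv t = 0 := by
    intro A B C Dv hA hB hu hv ⟨p, hp, q, hq, hpq⟩ x hx t ht
    obtain ⟨t', h1, h2⟩ := exists_tri hpq
    rw [← hv q hq t' h2]
    refine constOn cY Dv (fun l hl => hu l ?_) hx hp ht h1
    have : ∀ z ∈ Y, z ∉ A ∪ B ∪ X := by
      rintro z hz ((h | h) | h)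
      · exact Set.disjoint_left.1 hA hz h
      · exact Set.disjoint_left.1 hB hz h
      · exact Set.disjoint_left.1 dYX hz h
    rintro ⟨h1, h2⟩
    rcases hl with h | h
    · exact this _ h h1
    · exact this _ h h2
  have k1 := key _ _ _ D1 dYa dYb u1 v1 yc
  have k2 := key _ _ _ D2 dYb dYc u2 v2 ya
  have k3 := key _ _ _ D3 dYc dYa u3 v3 yb
  obtain ⟨p, hp, q, hq, hpq⟩ := ya
  obtain ⟨t', h1, h2⟩ := exists_tri hpq
  have : t' ≠ τ := by
    rintro rfl
    obtain ⟨xa, hxa, txa⟩ := ta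
    obtain ⟨xb, hxb, txb⟩ := tb
    obtain ⟨xc, hxc, txc⟩ := tc
    have e1 : p ≠ xa := fun h => Set.disjoint_left.1 dYa hp (h ▸ hxa)
    have e2 : p ≠ xb := fun h => Set.disjoint_left.1 dYb hp (h ▸ hxb)
    have e3 : p ≠ xc := fun h => Set.disjoint_left.1 dYc hp (h ▸ hxc)
    have nab : xa ≠ xb := fun h => Set.disjoint_left.1 dab hxa (h ▸ hxb)
    have nbc : xb ≠ xc := fun h => Set.disjoint_left.1 dbc hxb (h ▸ hxc)
    have nca : xc ≠ xa := fun h => Set.disjoint_left.1 dca hxc (h ▸ hxa)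
    unfold cor at *
    grind
  have := hs t' this
  rw [k1 p hp t' h1, k2 p hp t' h1, k3 p hp t' h1] at this
  simp at this

end Sph


namespace Sph

def G1 (p q : Fin 7) : ZMod 2 := if (p ≤ 2 ∧ q = 3) ∨ (q ≤ 2 ∧ p = 3) then 1 else 0
def colF (p : Fin 7) : Fin 3 := if p = 0 ∨ p = 3 then 0 else if p = 1 ∨ p = 4 then 1 else 2
def G2 (p q : Fin 7) : ZMod 2 :=
  if (p ≤ 2 ∨ q ≤ 2) ∧ ((colF p = 0 ∧ colF q = 1) ∨ (colF p = 1 ∧ colF q = 0)) then 1 else 0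
def TT (k : Fin 7) (p q r : Fin 7) : ZMod 2 :=
  if (p ≤ 2 ∨ q ≤ 2 ∨ r ≤ 2) ∧ (p = 3 ∨ q = 3 ∨ r = 3) ∧ (p = k ∨ q = k ∨ r = k) then 1 else 0
def compat (p q : Fin 7) : Prop := ¬ (p ≤ 2 ∧ q = 6) ∧ ¬ (q ≤ 2 ∧ p = 6)
instance (p q : Fin 7) : Decidable (compat p q) := by unfold compat; infer_instance

set_option maxRecDepth 100000 in
theorem G1_id : ∀ p q r : Fin 7, compat p q → compat q r → compat r p →
    G1 p q + G1 q r + G1 r p = TT 4 p q r + TT 5 p q r := by decide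

set_option maxRecDepth 100000 in
theorem G2_id : ∀ p q r : Fin 7, compat p q → compat q r → compat r p →
    ¬ ((p ≤ 2 ∨ q ≤ 2 ∨ r ≤ 2) ∧ (colF p = 0 ∨ colF q = 0 ∨ colF r = 0) ∧
      (colF p = 1 ∨ colF q = 1 ∨ colF r = 1) ∧ (colF p = 2 ∨ colF q = 2 ∨ colF r = 2)) →
    G2 p q + G2 q r + G2 r p = TT 4 p q r := by decide

set_option maxRecDepth 100000 in
theorem n6_id : ∀ p q r : Fin 7, compat p q → compat q r → compat r p →
    (p ≤ 2 ∨ q ≤ 2 ∨ r ≤ 2) → p ≠ 6 ∧ q ≠ 6 ∧ r ≠ 6 := by decide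

set_option maxRecDepth 100000 in
theorem TT45 : ∀ u v w : Fin 7, (u = 5 ∨ v = 5 ∨ w = 5) → TT 4 u v w = 0 := by decide

theorem G1_symm : ∀ p q : Fin 7, G1 p q = G1 q p := by decide
theorem G2_symm : ∀ p q : Fin 7, G2 p q = G2 q p := by decide

variable {N L D : Type} [Fintype N] [Fintype L] [Fintype D] {K : Sph N L D}

theorem sym_apply (G : Fin 7 → Fin 7 → ZMod 2) (hG : ∀ p q, G p q = G q p) (st : N → Fin 7)
    {l : L} {a b : N} (hl : s(K.e1 l, K.e2 l) = s(a, b)) :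
    G (st (K.e1 l)) (st (K.e2 l)) = G (st a) (st b) := by
  simp only [Sym2.eq_iff] at hl
  rcases hl with ⟨h1, h2⟩ | ⟨h1, h2⟩
  · rw [h1, h2]
  · rw [h1, h2, hG]

theorem sym_d1 (G : Fin 7 → Fin 7 → ZMod 2) (hG : ∀ p q, G p q = G q p) (st : N → Fin 7) (t : D) :
    K.d1 (fun l => G (st (K.e1 l)) (st (K.e2 l))) t =
      G (st (K.c0 t)) (st (K.c1 t)) + G (st (K.c1 t)) (st (K.c2 t)) +
      G (st (K.c2 t)) (st (K.c0 t)) := by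
  rw [d1_apply, sym_apply G hG st (K.h0 t), sym_apply G hG st (K.h1 t),
    sym_apply G hG st (K.h2 t)]

theorem exists_cor_iff (p : N → Prop) (t : D) :
    (∃ x, K.cor x t ∧ p x) ↔ (p (K.c0 t) ∨ p (K.c1 t) ∨ p (K.c2 t)) := by
  unfold cor
  constructor
  · rintro ⟨x, rfl | rfl | rfl, h⟩ <;> tauto
  · rintro (h | h | h)
    · exact ⟨_, Or.inl rfl, h⟩
    · exact ⟨_, Or.inr (Or.inl rfl), h⟩
    · exact ⟨_, Or.inr (Or.inr rfl), h⟩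

set_option maxHeartbeats 1000000 in
theorem sperner {Ca Cb Cc X : Set N} (ca : K.ConnS Ca) (cb : K.ConnS Cb) (cc : K.ConnS Cc)
    (cX : K.ConnS X) (dab : Disjoint Ca Cb) (dbc : Disjoint Cb Cc) (dca : Disjoint Cc Ca)
    (dXa : Disjoint X Ca) (dXb : Disjoint X Cb) (dXc : Disjoint X Cc)
    (τ : D) (ta : ∃ x ∈ Ca, K.cor x τ) (tb : ∃ x ∈ Cb, K.cor x τ) (tc : ∃ x ∈ Cc, K.cor x τ)
    (aa : ∃ p ∈ X, ∃ q ∈ Ca, K.Adj p q) (ab : ∃ p ∈ X, ∃ q ∈ Cb, K.Adj p q)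
    (ac : ∃ p ∈ X, ∃ q ∈ Cc, K.Adj p q)
    (hN : ∀ p ∈ X, ∀ q, K.Adj p q → q ∈ X ∨ q ∈ Ca ∨ q ∈ Cb ∨ q ∈ Cc)
    (κ : N → Fin 3) (ka : ∀ x ∈ Ca, κ x = 0) (kb : ∀ x ∈ Cb, κ x = 1) (kc : ∀ x ∈ Cc, κ x = 2) :
    ∃ t, (∃ x, K.cor x t ∧ x ∈ X) ∧ (∃ x, K.cor x t ∧ κ x = 0) ∧ (∃ x, K.cor x t ∧ κ x = 1) ∧
      (∃ x, K.cor x t ∧ κ x = 2) := by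
  classical
  obtain ⟨D1, D2, D3, hs, -, -, -, v1, v2, v3, m, p, q, lab, xa, xb, m', p', q', hp, hq, hm,
    hp', hq', hm', hxa, hxb, hlab, hg⟩ :=
    theta ca cb cc cX dab dbc dca dXa dXb dXc τ ta tb tc aa ab ac
  by_contra hcon
  push Not at hcon
  let em : Fin 3 → Fin 7 := fun i => ⟨i.1, by omega⟩
  let st : N → Fin 7 := fun x => if x ∈ X then em (κ x) else if x ∈ Ca then 3 else
    if x ∈ Cb then 4 else if x ∈ Cc then 5 else 6
  have em2 : ∀ i, em i ≤ 2 := by decide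
  have emc : ∀ i, colF (em i) = i := by decide
  have sX : ∀ x, x ∈ X → st x ≤ 2 ∧ colF (st x) = κ x := by
    intro x hx; simp only [st, if_pos hx]; exact ⟨em2 _, emc _⟩
  have sa : ∀ x, x ∈ Ca → st x = 3 := by
    intro x hx
    simp only [st, if_neg (Set.disjoint_right.1 dXa hx), if_pos hx]
  have sb : ∀ x, x ∈ Cb → st x = 4 := by
    intro x hx
    simp only [st, if_neg (Set.disjoint_right.1 dXb hx), if_neg (Set.disjoint_right.1 dab hx),
      if_pos hx]
  have sc : ∀ x, x ∈ Cc → st x = 5 := by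
    intro x hx
    simp only [st, if_neg (Set.disjoint_right.1 dXc hx), if_neg (Set.disjoint_right.1 dbc hx),
      if_neg (Set.disjoint_left.1 dca hx), if_pos hx]
  have inv : ∀ x, (x ∈ X ∧ st x ≤ 2) ∨ (x ∈ Ca ∧ st x = 3) ∨ (x ∈ Cb ∧ st x = 4) ∨
      (x ∈ Cc ∧ st x = 5) ∨ ((x ∉ X ∧ x ∉ Ca ∧ x ∉ Cb ∧ x ∉ Cc) ∧ st x = 6) := by
    intro x
    by_cases h1 : x ∈ X
    · exact Or.inl ⟨h1, (sX x h1).1⟩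
    by_cases h2 : x ∈ Ca
    · exact Or.inr (Or.inl ⟨h2, sa x h2⟩)
    by_cases h3 : x ∈ Cb
    · exact Or.inr (Or.inr (Or.inl ⟨h3, sb x h3⟩))
    by_cases h4 : x ∈ Cc
    · exact Or.inr (Or.inr (Or.inr (Or.inl ⟨h4, sc x h4⟩)))
    · refine Or.inr (Or.inr (Or.inr (Or.inr ⟨⟨h1, h2, h3, h4⟩, ?_⟩)))
      simp only [st, if_neg h1, if_neg h2, if_neg h3, if_neg h4]
  have iX : ∀ x, st x ≤ 2 → x ∈ X := by
    intro x hx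
    rcases inv x with h | h | h | h | h
    · exact h.1
    all_goals rw [h.2] at hx; exact absurd hx (by decide)
  have i3 : ∀ x, st x = 3 → x ∈ Ca := by
    intro x hx
    rcases inv x with h | h | h | h | h
    · rw [hx] at h; exact absurd h.2 (by decide)
    · exact h.1
    all_goals rw [h.2] at hx; exact absurd hx (by decide)
  have i4 : ∀ x, st x = 4 → x ∈ Cb := by
    intro x hx
    rcases inv x with h | h | h | h | h
    · rw [hx] at h; exact absurd h.2 (by decide)
    · rw [h.2] at hx; exact absurd hx (by decide)
    · exact h.1
    all_goals rw [h.2] at hx; exact absurd hx (by decide)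
  have i5 : ∀ x, st x = 5 → x ∈ Cc := by
    intro x hx
    rcases inv x with h | h | h | h | h
    · rw [hx] at h; exact absurd h.2 (by decide)
    · rw [h.2] at hx; exact absurd hx (by decide)
    · rw [h.2] at hx; exact absurd hx (by decide)
    · exact h.1
    all_goals rw [h.2] at hx; exact absurd hx (by decide)
  have i6 : ∀ x, st x = 6 → ¬ (x ∈ X ∨ x ∈ Ca ∨ x ∈ Cb ∨ x ∈ Cc) := by
    intro x hx
    rcases inv x with h | h | h | h | h
    · rw [hx] at h; exact absurd h.2 (by decide)
    · rw [h.2] at hx; exact absurd hx (by decide)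
    · rw [h.2] at hx; exact absurd hx (by decide)
    · rw [h.2] at hx; exact absurd hx (by decide)
    · tauto
  have ic : ∀ x, st x ≠ 6 → colF (st x) = κ x := by
    intro x hx
    rcases inv x with h | h | h | h | h
    · exact (sX x h.1).2
    · rw [h.2, ka x h.1]; decide
    · rw [h.2, kb x h.1]; decide
    · rw [h.2, kc x h.1]; decide
    · exact absurd h.2 hx
  have cmp : ∀ a b, K.Adj a b → compat (st a) (st b) := by
    intro a b hab
    refine ⟨fun h => i6 b h.2 (hN a (iX a h.1) b hab), fun h => i6 a h.2 (hN b (iX b h.1) a hab.symm)⟩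
  have cmps : ∀ t, compat (st (K.c0 t)) (st (K.c1 t)) ∧ compat (st (K.c1 t)) (st (K.c2 t)) ∧
      compat (st (K.c2 t)) (st (K.c0 t)) := fun t =>
    ⟨cmp _ _ ⟨_, K.h0 t⟩, cmp _ _ ⟨_, K.h1 t⟩, cmp _ _ ⟨_, K.h2 t⟩⟩
  have c2 : ∀ t, K.d1 (fun l => G2 (st (K.e1 l)) (st (K.e2 l))) t =
      TT 4 (st (K.c0 t)) (st (K.c1 t)) (st (K.c2 t)) := by
    intro t
    rw [sym_d1 G2 G2_symm]
    refine G2_id _ _ _ (cmps t).1 (cmps t).2.1 (cmps t).2.2 ?_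
    rintro ⟨hX, q0, q1, q2⟩
    have hX' : K.c0 t ∈ X ∨ K.c1 t ∈ X ∨ K.c2 t ∈ X := hX.imp (iX _) (Or.imp (iX _) (iX _))
    have n6 : st (K.c0 t) ≠ 6 ∧ st (K.c1 t) ≠ 6 ∧ st (K.c2 t) ≠ 6 := by
      exact n6_id _ _ _ (cmps t).1 (cmps t).2.1 (cmps t).2.2 hX
    rw [ic _ n6.1, ic _ n6.2.1, ic _ n6.2.2] at q0 q1 q2
    obtain ⟨x, hx, hxX⟩ := (exists_cor_iff (K := K) (· ∈ X) t).2 hX'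
    obtain ⟨x0, h0, k0⟩ := (exists_cor_iff (K := K) (κ · = 0) t).2 q0
    obtain ⟨x1, h1, k1⟩ := (exists_cor_iff (K := K) (κ · = 1) t).2 q1
    obtain ⟨x2, h2, k2⟩ := (exists_cor_iff (K := K) (κ · = 2) t).2 q2
    exact hcon t ⟨x, hx, hxX⟩ ⟨x0, h0, k0⟩ ⟨x1, h1, k1⟩ x2 h2 k2
  have s2 := sum_d1 (K := K) (fun l => G2 (st (K.e1 l)) (st (K.e2 l)))
  simp only [c2] at s2
  have s1 := hg (fun l => G1 (st (K.e1 l)) (st (K.e2 l)))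
    (by intro l h1 h2; simp only [sa _ h1, sa _ h2]; decide)
    (by intro l h1 h2; simp only [sb _ h1, sb _ h2]; decide)
    (by
      intro l h1 h2
      have a := (sX _ h1).1
      have b := (sX _ h2).1

      generalize st (K.e1 l) = u at *
      generalize st (K.e2 l) = v at *
      revert u v; decide)

  rw [sym_apply G1 G1_symm st hm, sym_apply G1 G1_symm st hm', sym_apply G1 G1_symm st hlab,
    sa q hq, sb q' hq', sa xa hxa, sb xb hxb] at s1
  have r1 : ∀ u : Fin 7, u ≤ 2 → G1 u 3 = 1 := by decide
  have r2 : ∀ u : Fin 7, u ≤ 2 → G1 u 4 = 0 := by decide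
  rw [r1 _ (sX _ hp).1, r2 _ (sX _ hp').1, show G1 3 4 = 0 by decide] at s1
  have : ∀ t, D1 t * K.d1 (fun l => G1 (st (K.e1 l)) (st (K.e2 l))) t =
      TT 4 (st (K.c0 t)) (st (K.c1 t)) (st (K.c2 t)) := by
    intro t
    rw [sym_d1 G1 G1_symm, G1_id _ _ _ (cmps t).1 (cmps t).2.1 (cmps t).2.2]
    by_cases hC : (st (K.c0 t) = 5 ∨ st (K.c1 t) = 5 ∨ st (K.c2 t) = 5)
    · obtain ⟨x, hx, hx'⟩ := (exists_cor_iff (K := K) (st · = 5) t).2 hC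
      rw [v1 x (i5 _ hx') t hx, zero_mul]
      symm
      exact TT45 _ _ _ hC
    · have : TT 5 (st (K.c0 t)) (st (K.c1 t)) (st (K.c2 t)) = 0 := by
        unfold TT; rw [if_neg]; tauto
      rw [this, add_zero]
      by_cases hT : TT 4 (st (K.c0 t)) (st (K.c1 t)) (st (K.c2 t)) = 0
      · rw [hT, mul_zero]
      · have hT' := hT
        unfold TT at hT'
        rw [ite_eq_right_iff] at hT'
        push Not at hT'
        obtain ⟨⟨h1, h2, h3⟩, -⟩ := hT'
        obtain ⟨x1, hx1, hx1'⟩ := (exists_cor_iff (K := K) (st · ≤ 2) t).2 h1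
        obtain ⟨x2, hx2, hx2'⟩ := (exists_cor_iff (K := K) (st · = 3) t).2 h2
        obtain ⟨x3, hx3, hx3'⟩ := (exists_cor_iff (K := K) (st · = 4) t).2 h3
        have hne : t ≠ τ := by
          rintro rfl
          obtain ⟨xc, hxc, hct⟩ := tc
          exact hC ((exists_cor_iff (K := K) (st · = 5) t).1 ⟨xc, hct, sc _ hxc⟩)
        have := hs t hne
        rw [v2 x2 (i3 _ hx2') t hx2, v3 x3 (i4 _ hx3') t hx3, add_zero, add_zero] at this
        rw [this, one_mul]
  simp only [this] at s1
  rw [s2] at s1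
  revert s1; decide

set_option maxHeartbeats 1000000 in
theorem unicoh {Ca Cb X : Set N} (ca : K.ConnS Ca) (cb : K.ConnS Cb) (cX : K.ConnS X)
    (dab : Disjoint Ca Cb) (dXa : Disjoint X Ca) (dXb : Disjoint X Cb)
    (τ : D) (ta : ∃ x ∈ Ca, K.cor x τ) (tb : ∃ x ∈ Cb, K.cor x τ)
    (aa : ∃ p ∈ X, ∃ q ∈ Ca, K.Adj p q) (ab : ∃ p ∈ X, ∃ q ∈ Cb, K.Adj p q)
    (hN : ∀ p ∈ X, ∀ q, K.Adj p q → q ∈ X ∨ q ∈ Ca ∨ q ∈ Cb) :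
    ∃ t, (∃ x, K.cor x t ∧ x ∈ X) ∧ (∃ x, K.cor x t ∧ x ∈ Ca) ∧ (∃ x, K.cor x t ∧ x ∈ Cb) := by
  classical
  by_contra hcon
  push Not at hcon
  let g : L → ZMod 2 := fun l =>
    if (K.e1 l ∈ X ∧ K.e2 l ∈ Ca) ∨ (K.e1 l ∈ Ca ∧ K.e2 l ∈ X) then 1 else 0
  have ge : ∀ l a b, s(K.e1 l, K.e2 l) = s(a, b) →
      g l = if (a ∈ X ∧ b ∈ Ca) ∨ (a ∈ Ca ∧ b ∈ X) then 1 else 0 := by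
    intro l a b hl
    simp only [Sym2.eq_iff] at hl
    rcases hl with ⟨h1, h2⟩ | ⟨h1, h2⟩
    · simp only [g, h1, h2]
    · simp only [g, h1, h2]
      congr 1
      apply propext; tauto
  have hg : K.d1 g = 0 := by
    funext t
    rw [d1_apply, ge _ _ _ (K.h0 t), ge _ _ _ (K.h1 t), ge _ _ _ (K.h2 t), Pi.zero_apply]
    have a01 : K.Adj (K.c0 t) (K.c1 t) := ⟨_, K.h0 t⟩
    have a12 : K.Adj (K.c1 t) (K.c2 t) := ⟨_, K.h1 t⟩
    have a20 : K.Adj (K.c2 t) (K.c0 t) := ⟨_, K.h2 t⟩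
    have n01 := fun h => hN _ h _ a01
    have n12 := fun h => hN _ h _ a12
    have n20 := fun h => hN _ h _ a20
    have n10 := fun h => hN _ h _ a01.symm
    have n21 := fun h => hN _ h _ a12.symm
    have n02 := fun h => hN _ h _ a20.symm
    have dj : ∀ x, x ∈ X → x ∉ Ca := fun x h => Set.disjoint_left.1 dXa h
    have d0 := dj (K.c0 t)
    have d1 := dj (K.c1 t)
    have d2 := dj (K.c2 t)
    have hc := hcon t
    have hc' : ¬ ((K.c0 t ∈ X ∨ K.c1 t ∈ X ∨ K.c2 t ∈ X) ∧ (K.c0 t ∈ Ca ∨ K.c1 t ∈ Ca ∨ K.c2 t ∈ Ca)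
        ∧ (K.c0 t ∈ Cb ∨ K.c1 t ∈ Cb ∨ K.c2 t ∈ Cb)) := by
      rintro ⟨h1, h2, h3⟩
      obtain ⟨x1, hx1⟩ := (exists_cor_iff (K := K) (· ∈ X) t).2 h1
      obtain ⟨x2, hx2⟩ := (exists_cor_iff (K := K) (· ∈ Ca) t).2 h2
      obtain ⟨x3, hx3⟩ := (exists_cor_iff (K := K) (· ∈ Cb) t).2 h3
      exact hc ⟨x1, hx1⟩ ⟨x2, hx2⟩ x3 hx3.1 hx3.2
    clear hc hcon dj ge hN ta tb aa ab
    by_cases x0 : K.c0 t ∈ X <;> by_cases x1 : K.c1 t ∈ X <;> by_cases x2 : K.c2 t ∈ X <;>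
    by_cases y0 : K.c0 t ∈ Ca <;> by_cases y1 : K.c1 t ∈ Ca <;> by_cases y2 : K.c2 t ∈ Ca <;>
    simp only [x0, x1, x2, y0, y1, y2, true_and, and_true, false_and, and_false, or_true, true_or,
      or_false, false_or, if_true, if_false, z2, add_zero, zero_add, not_true, imp_false, forall_const,
      true_imp_iff, false_imp_iff, not_false_iff] at * <;>
    tauto
  have : g ∈ LinearMap.range K.d0 := by rw [← H1]; exact hg
  obtain ⟨h, hh⟩ := this
  rw [← hh] at ge
  have eqh : ∀ a b, K.Adj a b → ¬ ((a ∈ X ∧ b ∈ Ca) ∨ (a ∈ Ca ∧ b ∈ X)) → h a = h b := by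
    rintro a b ⟨l, hl⟩ hn
    have := ge l a b hl
    rw [if_neg hn, d0_apply h l hl] at this
    exact CharTwo.add_eq_zero.1 this
  have cst : ∀ C : Set N, K.ConnS C → (∀ a ∈ C, ∀ b ∈ C, ¬ ((a ∈ X ∧ b ∈ Ca) ∨ (a ∈ Ca ∧ b ∈ X))) →
      ∀ a ∈ C, ∀ b ∈ C, h a = h b := by
    intro C hC hn a ha b hb
    have := hC a ha b hb
    clear hb
    induction this with
    | refl => rfl
    | tail _ hbc ih => rw [ih]; exact eqh _ _ hbc.2.2 (hn _ hbc.1 _ hbc.2.1)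
  have dj : ∀ x, x ∈ X → x ∉ Ca := fun x h => Set.disjoint_left.1 dXa h
  have djb : ∀ x, x ∈ X → x ∉ Cb := fun x h => Set.disjoint_left.1 dXb h
  have djab : ∀ x, x ∈ Ca → x ∉ Cb := fun x h => Set.disjoint_left.1 dab h
  have hX := cst X cX (by intro a ha b hb; have := dj a ha; have := dj b hb; tauto)
  have hA := cst Ca ca (by
    intro a ha b hb; have := mt (dj a); have := mt (dj b); tauto)
  have hB := cst Cb cb (by
    intro a ha b hb; have := mt (djb a); have := mt (djb b); tauto)
  obtain ⟨xa, hxa, txa⟩ := ta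
  obtain ⟨xb, hxb, txb⟩ := tb
  obtain ⟨p, hp, q, hq, l, hl⟩ := aa
  obtain ⟨p', hp', q', hq', hpq'⟩ := ab
  have nab : xa ≠ xb := fun h => Set.disjoint_left.1 dab hxa (h ▸ hxb)
  have f1 := eqh xa xb (adj_of_cor txa txb nab)
    (by have := djb xb; have := dj xb; have := djab xb; have := dj xa; tauto)
  have f2 := eqh p' q' hpq' (by have := djab q'; have := djb q'; tauto)
  have f3 := ge l p q hl
  rw [if_pos (Or.inl ⟨hp, hq⟩), d0_apply h l hl, hX p hp p' hp', f2, hB q' hq' xb hxb, ← f1,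
    hA q hq xa hxa, z2] at f3
  exact absurd f3 (by decide)

end Sph


namespace Multigraph
variable {V E F : Type} {G : Multigraph V E}

theorem CWalk.vtx_mod (W : G.CWalk) (i : ℕ) : W.vtx (i % W.len) = W.vtx i := by
  conv_rhs => rw [← Nat.mod_add_div i W.len]
  generalize i / W.len = k
  induction k with
  | zero => simp
  | succ k ih => rw [Nat.mul_succ, ← add_assoc, W.vtx_per, ih]

theorem CWalk.hasVtx_vtx (W : G.CWalk) (i : ℕ) : W.HasVtx (W.vtx i) :=
  ⟨i % W.len, Nat.mod_lt _ W.len_pos, W.vtx_mod i⟩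

/-- successor position -/
def CWalk.nxt (W : G.CWalk) (i : Fin W.len) : Fin W.len := ⟨(i.1 + 1) % W.len, Nat.mod_lt _ W.len_pos⟩

theorem CWalk.vtx_nxt (W : G.CWalk) (i : Fin W.len) : W.vtx (W.nxt i) = W.vtx (i + 1) :=
  W.vtx_mod _

theorem CWalk.nxt_surj (W : G.CWalk) : Function.Surjective W.nxt := by
  intro i
  have h := W.len_pos
  by_cases h0 : i.1 = 0
  · refine ⟨⟨W.len - 1, by omega⟩, ?_⟩
    ext
    simp only [nxt]
    rw [h0, Nat.sub_add_cancel h, Nat.mod_self]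
  · refine ⟨⟨i.1 - 1, by omega⟩, ?_⟩
    ext
    simp only [nxt]
    rw [Nat.sub_add_cancel (by omega), Nat.mod_eq_of_lt i.2]

theorem CWalk.nxt_inj (W : G.CWalk) : Function.Injective W.nxt :=
  Finite.injective_iff_surjective.2 W.nxt_surj

theorem CWalk.nxt_ne (W : G.CWalk) (h : 2 ≤ W.len) (i : Fin W.len) : W.nxt i ≠ i := by
  intro e
  have := congrArg Fin.val e
  simp only [nxt] at this
  have hi := i.2
  by_cases h1 : i.1 + 1 = W.len
  · rw [h1, Nat.mod_self] at this; omega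
  · rw [Nat.mod_eq_of_lt (by omega)] at this; omega

noncomputable def ea (G : Multigraph V E) (e : E) : V := (Quot.out (G.ends e)).1
noncomputable def eb (G : Multigraph V E) (e : E) : V := (Quot.out (G.ends e)).2
theorem ends_eq (G : Multigraph V E) (e : E) : G.ends e = s(G.ea e, G.eb e) :=
  (Quot.out_eq (G.ends e)).symm

abbrev Occ (emb : G.Embedding F) : Type := Σ f : F, Fin (emb.boundary f).len

theorem two_occ (emb : G.Embedding F) (e : E) : ∃ t1 t2 : Occ emb, t1 ≠ t2 ∧
    ∀ t : Occ emb, (e = (emb.boundary t.1).edge t.2) ↔ (t = t1 ∨ t = t2) := by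
  obtain ⟨p, q, hne, h⟩ := Set.ncard_eq_two.1 (emb.edge_twice e)
  have hp : IsOcc emb.boundary e p := by
    have : p ∈ {p | IsOcc emb.boundary e p} := by rw [h]; simp
    exact this
  have hq : IsOcc emb.boundary e q := by
    have : q ∈ {p | IsOcc emb.boundary e p} := by rw [h]; simp
    exact this
  have hh : ∀ x, IsOcc emb.boundary e x → x = p ∨ x = q := by
    intro x hx
    have : x ∈ {p | IsOcc emb.boundary e p} := hx
    rw [h] at this; simpa using this
  obtain ⟨f, i⟩ := p
  obtain ⟨f', i'⟩ := q
  refine ⟨⟨f, ⟨i, hp.1⟩⟩, ⟨f', ⟨i', hq.1⟩⟩, ?_, ?_⟩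
  · intro e
    apply hne
    have h1 := congrArg (fun t : Occ emb => t.1) e
    have h2 := congrArg (fun t : Occ emb => t.2.1) e
    simp only at h1 h2
    rw [h1, h2]
  · rintro ⟨g, j⟩
    constructor
    · intro he
      rcases hh (g, j.1) ⟨j.2, he.symm⟩ with h' | h'
      · left
        simp only [Prod.mk.injEq] at h'
        obtain ⟨rfl, h'⟩ := h'
        congr 1; exact Fin.ext h'
      · right
        simp only [Prod.mk.injEq] at h'
        obtain ⟨rfl, h'⟩ := h'
        congr 1; exact Fin.ext h'
    · rintro (h | h) <;> rw [h]
      · exact hp.2.symm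
      · exact hq.2.symm

theorem card_occ (emb : G.Embedding F) [Fintype E] [Fintype F] :
    Fintype.card (Occ emb) = 2 * Fintype.card E := by
  classical
  have := Finset.card_eq_sum_card_fiberwise (f := fun t : Occ emb => (emb.boundary t.1).edge t.2)
    (s := Finset.univ) (t := Finset.univ) (fun _ _ => Finset.mem_coe.2 (Finset.mem_univ _))
  rw [Finset.card_univ] at this
  rw [this, Finset.sum_const_nat (m := 2), Finset.card_univ, mul_comm]
  intro e _
  obtain ⟨t1, t2, hne, h⟩ := two_occ emb e
  rw [Finset.card_eq_two]
  refine ⟨t1, t2, hne, ?_⟩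
  ext t
  simp only [Finset.mem_filter, Finset.mem_univ, true_and, Finset.mem_insert, Finset.mem_singleton]
  rw [← h]; exact eq_comm

theorem sum_len (emb : G.Embedding F) [Fintype E] [Fintype F] :
    ∑ f, (emb.boundary f).len = 2 * Fintype.card E := by
  rw [← card_occ emb]
  rw [Fintype.card_sigma]
  simp

theorem exists_face (emb : G.Embedding F) (e : E) : ∃ t : Occ emb, (emb.boundary t.1).edge t.2 = e := by
  obtain ⟨t1, t2, _, h⟩ := two_occ emb e
  exact ⟨t1, ((h t1).2 (Or.inl rfl)).symm⟩

theorem vtx_ne (emb : G.Embedding F)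
    (hcyc : ∀ f, (emb.boundary f).IsCycle ∧ 3 ≤ (emb.boundary f).len) (t : Occ emb) :
    (emb.boundary t.1).vtx t.2 ≠ (emb.boundary t.1).vtx (t.2 + 1) := by
  intro h
  rw [← CWalk.vtx_nxt] at h
  have := (hcyc t.1).1.1 _ _ t.2.2 ((emb.boundary t.1).nxt t.2).2 h
  exact (emb.boundary t.1).nxt_ne (by have := (hcyc t.1).2; omega) t.2 (Fin.ext this.symm)

noncomputable def toSph [Fintype V] [Fintype E] [Fintype F] (emb : G.Embedding F)
    (hcyc : ∀ f, (emb.boundary f).IsCycle ∧ 3 ≤ (emb.boundary f).len)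
    (hg : emb.eulerGenus = 0) : Sph (V ⊕ F) (E ⊕ Occ emb) (Occ emb) where
  e1 := Sum.elim (fun e => Sum.inl (G.ea e)) (fun t => Sum.inl ((emb.boundary t.1).vtx t.2))
  e2 := Sum.elim (fun e => Sum.inl (G.eb e)) (fun t => Sum.inr t.1)
  ne := by
    rintro (e | t)
    · simp only [Sum.elim_inl]
      intro h
      have h := Sum.inl_injective h
      obtain ⟨t, rfl⟩ := exists_face emb e
      have h1 : G.ends ((emb.boundary t.1).edge t.2) = s(G.ea ((emb.boundary t.1).edge t.2), G.eb ((emb.boundary t.1).edge t.2)) :=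
        G.ends_eq _
      have h2 := (emb.boundary t.1).compat t.2
      rw [h1, h, Sym2.eq_iff] at h2
      apply vtx_ne emb hcyc t
      rcases h2 with h2 | h2
      · exact h2.1.symm.trans h2.2
      · exact h2.2.symm.trans h2.1
    · simp
  c0 t := Sum.inl ((emb.boundary t.1).vtx t.2)
  c1 t := Sum.inl ((emb.boundary t.1).vtx (t.2 + 1))
  c2 t := Sum.inr t.1
  l0 t := Sum.inl ((emb.boundary t.1).edge t.2)
  l1 t := Sum.inr ⟨t.1, (emb.boundary t.1).nxt t.2⟩
  l2 t := Sum.inr t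
  h0 := by
    intro t
    have h1 : G.ends ((emb.boundary t.1).edge t.2) = s(G.ea ((emb.boundary t.1).edge t.2), G.eb ((emb.boundary t.1).edge t.2)) :=
        G.ends_eq _
    have h2 := (emb.boundary t.1).compat t.2
    rw [h1] at h2
    simp only [Sum.elim_inl]
    simpa [Sym2.eq_iff] using h2
  h1 := by
    intro t
    simp only [Sum.elim_inr]
    rw [CWalk.vtx_nxt]
  h2 := by
    intro t
    simp only [Sum.elim_inr]
    exact Sym2.eq_swap
  d01 := by intro t; simp
  d12 := by
    intro t h
    have h := Sum.inr_injective h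
    have : (⟨t.1, (emb.boundary t.1).nxt t.2⟩ : Occ emb) = ⟨t.1, t.2⟩ := h
    have := eq_of_heq (Sigma.mk.inj this).2
    exact (emb.boundary t.1).nxt_ne (by have := (hcyc t.1).2; omega) t.2 this
  d20 := by intro t; simp
  two := by
    rintro (e | t)
    · obtain ⟨t1, t2, hne, h⟩ := two_occ emb e
      refine ⟨t1, t2, hne, fun t => ?_⟩
      rw [← h]
      simp
    · obtain ⟨f, i⟩ := t
      obtain ⟨j, rfl⟩ := (emb.boundary f).nxt_surj i
      refine ⟨⟨f, (emb.boundary f).nxt j⟩, ⟨f, j⟩, ?_, ?_⟩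
      · intro h
        have := eq_of_heq (Sigma.mk.inj h).2
        exact (emb.boundary f).nxt_ne (by have := (hcyc f).2; omega) j this
      · rintro ⟨g, k⟩
        constructor
        · rintro (h | h | h)
          · cases h
          · right
            have h := Sum.inr_injective h
            obtain ⟨rfl, h2⟩ := Sigma.mk.inj h
            have := (emb.boundary f).nxt_inj (eq_of_heq h2)
            rw [this]
          · left
            exact (Sum.inr_injective h).symm
        · rintro (h | h)
          · right; right
            rw [h]
          · right; left
            obtain ⟨rfl, h2⟩ := Sigma.mk.inj h
            rw [eq_of_heq h2]
  star := by
    rintro (v | f) Dv hDv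
    · have step : ∀ t : Occ emb, (emb.boundary t.1).vtx (t.2 + 1) = v →
          Dv t = Dv ⟨t.1, (emb.boundary t.1).nxt t.2⟩ := by
        intro t ht
        refine hDv (Sum.inr ⟨t.1, (emb.boundary t.1).nxt t.2⟩) (Or.inl ?_) t _
          (Or.inr (Or.inl rfl)) (Or.inr (Or.inr rfl))
        simp only [Sum.elim_inr]
        rw [CWalk.vtx_nxt, ht]
      let Dw : F × ℕ → ZMod 2 := fun c => if h : c.2 < (emb.boundary c.1).len then
        Dv ⟨c.1, ⟨c.2, h⟩⟩ else 0
      have hw : ∀ t : Occ emb, Dw (t.1, t.2.1) = Dv t := by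
        intro t
        have : t.2.1 < (emb.boundary t.1).len := t.2.2
        simp only [Dw]
        rw [dif_pos this]
      have hEnd : ∀ c p : F × ℕ, IsCorner emb.boundary v c → p.2 < (emb.boundary p.1).len →
          EndOf emb.boundary c p → Dw c = Dw p ∧
            (v = (emb.boundary p.1).vtx p.2 ∨ v = (emb.boundary p.1).vtx (p.2 + 1)) := by
        rintro ⟨f, i⟩ ⟨f', j⟩ hc hp ⟨h1, h2⟩
        simp only at h1 h2 hp
        subst h1
        rcases h2 with h2 | h2
        · subst h2
          exact ⟨rfl, Or.inl hc.2.symm⟩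
        · have hv : (emb.boundary f).vtx (j + 1) = v := by
            rw [← CWalk.vtx_mod, ← h2]; exact hc.2
          refine ⟨?_, Or.inr hv.symm⟩
          have := step ⟨f, ⟨j, hp⟩⟩ hv
          rw [← hw, ← hw] at this
          simp only [CWalk.nxt] at this
          rw [h2, this]
      have hl : ∀ c c', CornerLinked emb.boundary v c c' → Dw c = Dw c' := by
        rintro c c' ⟨hc, hc', e, p, p', hne, hp, hp', he, he'⟩
        obtain ⟨a1, a2⟩ := hEnd c p hc hp.1 he
        obtain ⟨b1, b2⟩ := hEnd c' p' hc' hp'.1 he'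
        rw [a1, b1]
        have := hDv (Sum.inl e) (by
          simp only [Sum.elim_inl]
          have h1 : G.ends e = s((G.ea e), (G.eb e)) :=
            G.ends_eq e
          have h2 := (emb.boundary p.1).compat p.2
          rw [hp.2, h1, Sym2.eq_iff] at h2
          simp only [Sum.inl.injEq]
          rcases h2 with ⟨x1, x2⟩ | ⟨x1, x2⟩ <;> rw [x1, x2] <;> tauto)
          ⟨p.1, ⟨p.2, hp.1⟩⟩ ⟨p'.1, ⟨p'.2, hp'.1⟩⟩ (Or.inl (by simp only [hp.2]))
          (Or.inl (by simp only [hp'.2]))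
        rw [← hw, ← hw] at this
        exact this
      have hE : ∀ c c', Relation.EqvGen (CornerLinked emb.boundary v) c c' → Dw c = Dw c' := by
        intro c c' h
        induction h with
        | rel _ _ h => exact hl _ _ h
        | refl => rfl
        | symm _ _ _ ih => exact ih.symm
        | trans _ _ _ _ _ h1 h2 => exact h1.trans h2
      have hred : ∀ t : Occ emb, (Sum.inl v = (Sum.inl ((emb.boundary t.1).vtx t.2) : V ⊕ F) ∨
          Sum.inl v = (Sum.inl ((emb.boundary t.1).vtx (t.2 + 1)) : V ⊕ F) ∨ Sum.inl v = (Sum.inr t.1 : V ⊕ F)) →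
          ∃ t' : Occ emb, Dv t = Dv t' ∧ IsCorner emb.boundary v (t'.1, t'.2.1) := by
        rintro t (h | h | h)
        · exact ⟨t, rfl, t.2.2, (Sum.inl_injective h).symm⟩
        · have := Sum.inl_injective h
          refine ⟨_, step t this.symm, ((emb.boundary t.1).nxt t.2).2, ?_⟩
          simp only
          rw [CWalk.vtx_nxt, this]
        · cases h
      intro t t' ht ht'
      obtain ⟨s, hs, cs⟩ := hred t ht
      obtain ⟨s', hs', cs'⟩ := hred t' ht'
      rw [hs, hs', ← hw, ← hw]
      exact hE _ _ (emb.link_conn v _ _ cs cs')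
    · have h0 : ∀ (i : ℕ) (hi : i < (emb.boundary f).len),
          Dv ⟨f, ⟨i, hi⟩⟩ = Dv ⟨f, ⟨0, (emb.boundary f).len_pos⟩⟩ := by
        intro i
        induction i with
        | zero => intro _; rfl
        | succ i ih =>
          intro hi
          rw [← ih (by omega)]
          refine hDv (Sum.inr ⟨f, ⟨i + 1, hi⟩⟩) (Or.inr rfl) _ _ (Or.inr (Or.inr rfl))
            (Or.inr (Or.inl ?_))
          congr 2
          ext
          simp only [CWalk.nxt]
          rw [Nat.mod_eq_of_lt hi]
      have h1 : ∀ t : Occ emb, t.1 = f → Dv t = Dv ⟨f, ⟨0, (emb.boundary f).len_pos⟩⟩ := by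
        rintro ⟨g, j⟩ rfl
        exact h0 j.1 j.2
      have h2 : ∀ t : Occ emb, (Sum.inr f = (Sum.inl ((emb.boundary t.1).vtx t.2) : V ⊕ F) ∨
          Sum.inr f = (Sum.inl ((emb.boundary t.1).vtx (t.2 + 1)) : V ⊕ F) ∨ Sum.inr f = (Sum.inr t.1 : V ⊕ F)) →
          t.1 = f := by
        rintro t (h | h | h)
        · cases h
        · cases h
        · exact (Sum.inr_injective h).symm
      intro t t' ht ht'
      rw [h1 t (h2 t ht), h1 t' (h2 t' ht')]
  conn := by
    have hV : ∀ x y : V, Relation.ReflTransGen (fun a b => ∃ l : E ⊕ Occ emb,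
        s((Sum.elim (fun e => Sum.inl (G.ea e)) (fun t : Occ emb => Sum.inl ((emb.boundary t.1).vtx t.2)) l : V ⊕ F),
          Sum.elim (fun e => Sum.inl (G.eb e)) (fun t : Occ emb => Sum.inr t.1) l) = s(a, b)) (Sum.inl x) (Sum.inl y) := by
      intro x y
      obtain ⟨w⟩ := emb.conn.preconnected x y
      induction w with
      | nil => exact .refl
      | cons h _ ih =>
        refine Relation.ReflTransGen.head ?_ ih
        obtain ⟨_, e, he⟩ := h
        refine ⟨Sum.inl e, ?_⟩
        have h1 : G.ends e = s((G.ea e), (G.eb e)) :=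
            G.ends_eq e
        rw [h1] at he
        simp only [Sum.elim_inl]
        simpa [Sym2.eq_iff] using he
    rintro (x | f) (y | g)
    · exact hV x y
    · refine (hV x ((emb.boundary g).vtx 0)).tail ⟨Sum.inr ⟨g, ⟨0, (emb.boundary g).len_pos⟩⟩, rfl⟩
    · refine Relation.ReflTransGen.head ⟨Sum.inr ⟨f, ⟨0, (emb.boundary f).len_pos⟩⟩, Sym2.eq_swap⟩
        (hV ((emb.boundary f).vtx 0) y)
    · refine Relation.ReflTransGen.head ⟨Sum.inr ⟨f, ⟨0, (emb.boundary f).len_pos⟩⟩, Sym2.eq_swap⟩ ?_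
      refine (hV ((emb.boundary f).vtx 0) ((emb.boundary g).vtx 0)).tail ⟨Sum.inr ⟨g, ⟨0, (emb.boundary g).len_pos⟩⟩, rfl⟩
  euler := by
    unfold Embedding.eulerGenus at hg
    simp only [Nat.card_eq_fintype_card] at hg
    simp only [Fintype.card_sum]
    omega

section
variable [Fintype V] [Fintype E] [Fintype F] (emb : G.Embedding F)
    (hcyc : ∀ f, (emb.boundary f).IsCycle ∧ 3 ≤ (emb.boundary f).len)
    (hg : emb.eulerGenus = 0)

theorem adj_vv (u v : V) : (toSph emb hcyc hg).Adj (Sum.inl u) (Sum.inl v) ↔ ∃ e, G.ends e = s(u, v) := by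
  constructor
  · rintro ⟨e | t, h⟩
    · refine ⟨e, ?_⟩
      have h1 : G.ends e = s((G.ea e), (G.eb e)) :=
            G.ends_eq e
      rw [h1]
      simp only [toSph, Sum.elim_inl] at h
      simpa [Sym2.eq_iff] using h
    · simp [toSph] at h
  · rintro ⟨e, he⟩
    refine ⟨Sum.inl e, ?_⟩
    have h1 : G.ends e = s((G.ea e), (G.eb e)) :=
            G.ends_eq e
    rw [h1] at he
    simp only [toSph, Sum.elim_inl]
    simpa [Sym2.eq_iff] using he

theorem adj_vf (v : V) (f : F) : (toSph emb hcyc hg).Adj (Sum.inl v) (Sum.inr f) ↔ (emb.boundary f).HasVtx v := by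
  constructor
  · rintro ⟨e | t, h⟩
    · simp [toSph] at h
    · simp only [toSph, Sum.elim_inr, Sym2.eq_iff, Sum.inl.injEq, Sum.inr.injEq] at h
      rcases h with ⟨h1, rfl⟩ | ⟨h, _⟩
      · exact ⟨t.2, t.2.2, h1⟩
      · cases h
  · rintro ⟨i, hi, rfl⟩
    exact ⟨Sum.inr ⟨f, ⟨i, hi⟩⟩, rfl⟩

theorem adj_ff (f g : F) : ¬ (toSph emb hcyc hg).Adj (Sum.inr f) (Sum.inr g) := by
  rintro ⟨e | t, h⟩ <;> simp [toSph] at h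

theorem cor_iff (x : V ⊕ F) (t : Occ emb) : (toSph emb hcyc hg).cor x t ↔
    (x = Sum.inl ((emb.boundary t.1).vtx t.2) ∨ x = Sum.inl ((emb.boundary t.1).vtx (t.2 + 1)) ∨
      x = Sum.inr t.1) := Iff.rfl
end

end Multigraph


section
variable {α : Type} {T : SimpleGraph α}

def CIn (R : α → α → Prop) (s : Set α) (x y : α) : Prop :=
  Relation.ReflTransGen (fun a b => a ∈ s ∧ b ∈ s ∧ R a b) x y

theorem CIn.mono {R R' : α → α → Prop} {s s' : Set α} (hs : s ⊆ s') (hR : ∀ a b, R a b → R' a b)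
    {x y : α} (h : CIn R s x y) : CIn R' s' x y := by
  unfold CIn at *
  induction h with
  | refl => exact .refl
  | tail _ h ih => exact ih.tail ⟨hs h.1, hs h.2.1, hR _ _ h.2.2⟩

theorem CIn.symm {R : α → α → Prop} (hR : ∀ a b, R a b → R b a) {s : Set α}
    {x y : α} (h : CIn R s x y) : CIn R s y x := by
  unfold CIn at *
  induction h with
  | refl => exact .refl
  | tail _ h ih => exact .head ⟨h.2.1, h.1, hR _ _ h.2.2⟩ ih

theorem btwIn_iff (hT : T.IsTree) {a b c : α} (p : T.Walk a c) (hp : p.IsPath) :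
    BtwIn T a b c ↔ b ∈ p.support := by
  classical
  constructor
  · intro h; exact h p
  · intro h q
    have : q.bypass = p := by
      have := (SimpleGraph.isTree_iff_existsUnique_path.1 hT).2 a c
      exact this.unique (q.bypass_isPath) hp
    rw [← this] at h
    exact q.support_bypass_subset h

theorem walk_conn {a b : α} (q : T.Walk a b) : ∀ x ∈ q.support, CIn T.Adj {y | y ∈ q.support} a x := by
  induction q with
  | nil => intro x hx; simp at hx; subst hx; exact .refl
  | cons h q ih =>
    intro x hx
    rw [SimpleGraph.Walk.support_cons, List.mem_cons] at hx
    rcases hx with rfl | hx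
    · exact .refl
    · refine Relation.ReflTransGen.head ?_ ((ih x hx).mono ?_ (fun _ _ h => h))
      · exact ⟨by simp, by simp, h⟩
      · intro y hy; simp only [Set.mem_ofPred_eq] at *; simp [hy]

theorem walk_conn2 {a b : α} (q : T.Walk a b) : ∀ x ∈ q.support, ∀ y ∈ q.support,
    CIn T.Adj {y | y ∈ q.support} x y := by
  intro x hx y hy
  exact ((walk_conn q x hx).symm (fun _ _ h => h.symm)).trans (walk_conn q y hy)

theorem btw_conn (hT : T.IsTree) (a b : α) :
    a ∈ {x | BtwIn T a x b} ∧ b ∈ {x | BtwIn T a x b} ∧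
    ∀ x ∈ {x | BtwIn T a x b}, ∀ y ∈ {x | BtwIn T a x b}, CIn T.Adj {x | BtwIn T a x b} x y := by
  obtain ⟨p, hp⟩ := (SimpleGraph.isTree_iff_existsUnique_path.1 hT).2 a b |>.exists
  have : {x | BtwIn T a x b} = {x | x ∈ p.support} := by
    ext x; exact btwIn_iff hT p hp
  rw [this]
  exact ⟨by simp, by simp, walk_conn2 p⟩

theorem split_walk {v r : α} (q : T.Walk v r) (U : Set α) (hv : v ∈ U) (hr : r ∉ U) :
    ∃ (w y : α) (q1 : T.Walk v w) (h : T.Adj w y) (q2 : T.Walk y r),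
      q = q1.append (.cons h q2) ∧ (∀ x ∈ q1.support, x ∈ U) ∧ y ∉ U := by
  induction q with
  | nil => exact absurd hv hr
  | @cons u v' w' h q ih =>
    by_cases h' : v' ∈ U
    · obtain ⟨w, y, q1, hh, q2, rfl, h2, h3⟩ := ih h' hr
      refine ⟨w, y, .cons h q1, hh, q2, rfl, ?_, h3⟩
      intro x hx
      rw [SimpleGraph.Walk.support_cons, List.mem_cons] at hx
      rcases hx with rfl | hx
      · exact hv
      · exact h2 x hx
    · exact ⟨_, _, .nil, h, q, rfl, by simp [hv], h'⟩

theorem exists_vert (hT : T.IsTree) {r v : α} (U : Set α) (hv : v ∈ U) (hr : r ∉ U) :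
    ∃ (Q : Set α) (w y : α), v ∈ Q ∧ w ∈ Q ∧ Q ⊆ U ∧ y ∉ U ∧ T.Adj w y ∧ IsVerticalPath T r Q ∧
      ∀ a ∈ Q, ∀ b ∈ Q, CIn T.Adj Q a b := by
  obtain ⟨p, hp⟩ := (SimpleGraph.isTree_iff_existsUnique_path.1 hT).2 v r |>.exists
  obtain ⟨w, y, q1, h, q2, rfl, h1, h2⟩ := split_walk p U hv hr
  have hq1 : q1.IsPath := hp.of_append_left
  refine ⟨{x | x ∈ q1.support}, w, y, by simp, by simp, h1, h2, h, ⟨w, v, ?_, ?_⟩, walk_conn2 q1⟩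
  · rw [btwIn_iff hT _ hp.reverse]
    simp
  · ext x
    simp only [Set.mem_ofPred_eq]
    rw [btwIn_iff hT _ hq1.reverse]
    simp
end


def apoBase : Finset (Finset ℕ) := {{0,1,2},{0,1,3},{0,2,3},{1,2,3}}

inductive Apo : ℕ → Finset (Finset ℕ) → Finset (Finset ℕ) → Prop
  | base : Apo 4 apoBase {{0,1,2,3}}
  | step {n : ℕ} {Fc bags : Finset (Finset ℕ)} {s : Finset ℕ} (h : Apo n Fc bags) (hs : s ∈ Fc) :
      Apo (n+1) (Fc.erase s ∪ s.image (fun x => insert n (s.erase x))) (insert (insert n s) bags)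

namespace Apo

theorem basic {n : ℕ} {Fc bags : Finset (Finset ℕ)} (h : Apo n Fc bags) :
    4 ≤ n ∧ (∀ s ∈ Fc, s.card = 3 ∧ ∀ x ∈ s, x < n) ∧ (∀ b ∈ bags, b.card ≤ 4 ∧ ∀ x ∈ b, x < n) := by
  induction h with
  | base => 
    refine ⟨le_refl _, by unfold apoBase; decide, by decide⟩
  | @step n Fc bags s h hs ih =>
    obtain ⟨i1, i2, i3⟩ := ih
    have hn : n ∉ s := fun hh => by have := (i2 s hs).2 n hh; omega
    refine ⟨by omega, ?_, ?_⟩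
    · intro f hf
      simp only [Finset.mem_union, Finset.mem_erase, Finset.mem_image] at hf
      rcases hf with ⟨_, hf⟩ | ⟨x, hx, rfl⟩
      · exact ⟨(i2 f hf).1, fun x hx => by have := (i2 f hf).2 x hx; omega⟩
      · constructor
        · rw [Finset.card_insert_of_notMem (by simp [hn]), Finset.card_erase_of_mem hx, (i2 s hs).1]
        · intro y hy
          simp only [Finset.mem_insert, Finset.mem_erase] at hy
          rcases hy with rfl | hy
          · omega
          · have := (i2 s hs).2 y hy.2; omega
    · intro b hb
      simp only [Finset.mem_insert] at hb
      rcases hb with rfl | hb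
      · refine ⟨by rw [Finset.card_insert_of_notMem hn, (i2 s hs).1], fun x hx => ?_⟩
        simp only [Finset.mem_insert] at hx
        rcases hx with rfl | hx
        · omega
        · have := (i2 s hs).2 x hx; omega
      · exact ⟨(i3 b hb).1, fun x hx => by have := (i3 b hb).2 x hx; omega⟩

/-- explicit description of a step -/
theorem step_form {n : ℕ} {Fc bags : Finset (Finset ℕ)} {s : Finset ℕ} (h : Apo n Fc bags) (hs : s ∈ Fc) :
    ∃ a b c, a ≠ b ∧ b ≠ c ∧ a ≠ c ∧ s = {a,b,c} ∧ a < n ∧ b < n ∧ c < n ∧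
     ∀ f, f ∈ Fc.erase s ∪ s.image (fun x => insert n (s.erase x)) ↔
       (f ∈ Fc ∧ f ≠ s) ∨ f = {n,b,c} ∨ f = {n,a,c} ∨ f = {n,a,b} := by
  obtain ⟨_, i2, _⟩ := h.basic
  obtain ⟨c3, lt⟩ := i2 s hs
  obtain ⟨a, b, c, hab, hac, hbc, rfl⟩ := Finset.card_eq_three.1 c3
  refine ⟨a, b, c, hab, hbc, hac, rfl, lt a (by simp), lt b (by simp), lt c (by simp), fun f => ?_⟩
  have e1 : ({a,b,c} : Finset ℕ).erase a = {b,c} := by ext; simp; grind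
  have e2 : ({a,b,c} : Finset ℕ).erase b = {a,c} := by ext; simp; grind
  have e3 : ({a,b,c} : Finset ℕ).erase c = {a,b} := by ext; simp; grind
  simp only [Finset.mem_union, Finset.mem_erase, Finset.image_insert, Finset.image_singleton, e1, e2, e3,
    Finset.mem_insert, Finset.mem_singleton]
  tauto

theorem card_faces {n : ℕ} {Fc bags : Finset (Finset ℕ)} (h : Apo n Fc bags) : Fc.card + 4 = 2 * n := by
  induction h with
  | base => decide
  | @step n Fc bags s h hs ih =>
    obtain ⟨i1, i2, i3⟩ := h.basic
    have hn : ∀ f ∈ Fc, n ∉ f := fun f hf hh => by have := (i2 f hf).2 n hh; omega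
    rw [Finset.card_union_of_disjoint, Finset.card_erase_of_mem hs, Finset.card_image_of_injOn, (i2 s hs).1]
    · have : 0 < Fc.card := Finset.card_pos.2 ⟨s, hs⟩
      omega
    · intro x hx y hy hxy
      by_contra hne
      have : x ∈ insert n (s.erase y) := by simp [hne]; right; exact hx
      simp only [] at hxy
      rw [← hxy] at this
      simp only [Finset.mem_insert, Finset.mem_erase, ne_eq, not_true_eq_false, false_and, or_false] at this
      subst this
      exact hn s hs hx
    · rw [Finset.disjoint_left]
      intro f hf hf'
      simp only [Finset.mem_erase, Finset.mem_image] at hf hf'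
      obtain ⟨x, _, rfl⟩ := hf'
      exact hn _ hf.2 (by simp)

set_option synthInstance.maxSize 4000 in
set_option synthInstance.maxHeartbeats 200000 in
theorem pair {n : ℕ} {Fc bags : Finset (Finset ℕ)} (h : Apo n Fc bags) :
    ∀ x y, x ≠ y → ∀ f ∈ Fc, x ∈ f → y ∈ f → ∃ g ∈ Fc, g ≠ f ∧ x ∈ g ∧ y ∈ g ∧
      ∀ h ∈ Fc, x ∈ h → y ∈ h → h = f ∨ h = g := by
  induction h with
  | base =>
    intro x y hxy f hf hx hy
    have hx4 : x < 4 := ((Apo.base).basic.2.1 f hf).2 x hx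
    have hy4 : y < 4 := ((Apo.base).basic.2.1 f hf).2 y hy
    have key : ∀ x < 4, ∀ y < 4, x ≠ y → ∀ f ∈ apoBase, x ∈ f → y ∈ f → ∃ g ∈ apoBase, g ≠ f ∧ x ∈ g ∧ y ∈ g ∧
      ∀ h ∈ apoBase, x ∈ h → y ∈ h → h = f ∨ h = g := by unfold apoBase; decide
    exact key x hx4 y hy4 hxy f hf hx hy
  | @step n Fc bags s h hs ih =>
    obtain ⟨a, b, c, hab, hbc, hac, rfl, ha, hb, hc, hmem⟩ := step_form h hs
    obtain ⟨i1, i2, i3⟩ := h.basic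
    have hn : ∀ f ∈ Fc, n ∉ f := fun f hf hh => by have := (i2 f hf).2 n hh; omega
    have na : ({n,b,c} : Finset ℕ) ≠ {n,a,c} := fun e => by
      have : a ∈ ({n,b,c} : Finset ℕ) := by rw [e]; simp
      simp at this; omega
    have nb : ({n,b,c} : Finset ℕ) ≠ {n,a,b} := fun e => by
      have : a ∈ ({n,b,c} : Finset ℕ) := by rw [e]; simp
      simp at this; omega
    have nc : ({n,a,c} : Finset ℕ) ≠ {n,a,b} := fun e => by
      have : b ∈ ({n,a,c} : Finset ℕ) := by rw [e]; simp
      simp at this; omega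
    -- pairs of s
    have sp : ∀ x y, x ≠ y → x ∈ ({a,b,c} : Finset ℕ) → y ∈ ({a,b,c} : Finset ℕ) →
       ∃ g : Finset ℕ, (g = {n,b,c} ∨ g = {n,a,c} ∨ g = {n,a,b}) ∧ x ∈ g ∧ y ∈ g ∧
         ∀ g' : Finset ℕ, (g' = {n,b,c} ∨ g' = {n,a,c} ∨ g' = {n,a,b}) → x ∈ g' → y ∈ g' → g' = g := by
      intro x y hxy hx hy
      simp only [Finset.mem_insert, Finset.mem_singleton] at hx hy
      rcases hx with rfl | rfl | rfl <;> rcases hy with rfl | rfl | rfl <;> first | exact absurd rfl hxy | skip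
      all_goals first
        | (refine ⟨_, Or.inl rfl, by simp, by simp, ?_⟩; rintro g' (rfl | rfl | rfl) h1 h2 <;> simp at h1 h2 ⊢ <;> omega)
        | (refine ⟨_, Or.inr (Or.inl rfl), by simp, by simp, ?_⟩; rintro g' (rfl | rfl | rfl) h1 h2 <;> simp at h1 h2 ⊢ <;> omega)
        | (refine ⟨_, Or.inr (Or.inr rfl), by simp, by simp, ?_⟩; rintro g' (rfl | rfl | rfl) h1 h2 <;> simp at h1 h2 ⊢ <;> omega)
    have newsub : ∀ (g : Finset ℕ) (x : ℕ), (g = {n,b,c} ∨ g = {n,a,c} ∨ g = {n,a,b}) → x ∈ g → x = n ∨ x ∈ ({a,b,c} : Finset ℕ) := by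
      rintro g x (rfl | rfl | rfl) hx <;> simp at hx ⊢ <;> tauto
    have nin : ∀ g : Finset ℕ, (g = {n,b,c} ∨ g = {n,a,c} ∨ g = {n,a,b}) → n ∈ g := by
      rintro g (rfl | rfl | rfl) <;> simp
    -- pairs (n, x)
    have np : ∀ y : ℕ, ∀ f : Finset ℕ, (f = {n,b,c} ∨ f = {n,a,c} ∨ f = {n,a,b}) → y ≠ n → y ∈ f → 
       ∃ g : Finset ℕ, (g = {n,b,c} ∨ g = {n,a,c} ∨ g = {n,a,b}) ∧ g ≠ f ∧ y ∈ g ∧ 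
         ∀ g' : Finset ℕ, (g' = {n,b,c} ∨ g' = {n,a,c} ∨ g' = {n,a,b}) → y ∈ g' → g' = f ∨ g' = g := by
      intro y f hf hyn hy
      rcases hf with rfl | rfl | rfl <;> simp [hyn] at hy <;> rcases hy with rfl | rfl
      · exact ⟨_, Or.inr (Or.inr rfl), nb.symm, by simp, by rintro g' (rfl | rfl | rfl) h1 <;> simp at h1 ⊢ <;> omega⟩
      · exact ⟨_, Or.inr (Or.inl rfl), na.symm, by simp, by rintro g' (rfl | rfl | rfl) h1 <;> simp at h1 ⊢ <;> omega⟩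
      · exact ⟨_, Or.inr (Or.inr rfl), nc.symm, by simp, by rintro g' (rfl | rfl | rfl) h1 <;> simp at h1 ⊢ <;> omega⟩
      · exact ⟨_, Or.inl rfl, na, by simp, by rintro g' (rfl | rfl | rfl) h1 <;> simp at h1 ⊢ <;> omega⟩
      · exact ⟨_, Or.inr (Or.inl rfl), nc, by simp, by rintro g' (rfl | rfl | rfl) h1 <;> simp at h1 ⊢ <;> omega⟩
      · exact ⟨_, Or.inl rfl, nb, by simp, by rintro g' (rfl | rfl | rfl) h1 <;> simp at h1 ⊢ <;> omega⟩
    intro x y hxy f hf hx hy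
    rw [hmem] at hf
    simp only [hmem]
    rcases hf with ⟨hf, hfs⟩ | hf
    · have hxn : x ≠ n := fun e => hn f hf (e ▸ hx)
      have hyn : y ≠ n := fun e => hn f hf (e ▸ hy)
      obtain ⟨g, hg, hgf, hxg, hyg, hu⟩ := ih x y hxy f hf hx hy
      by_cases hgs : g = {a,b,c}
      · subst hgs
        obtain ⟨g, h1, h2, h3, h4⟩ := sp x y hxy hxg hyg
        refine ⟨g, Or.inr h1, fun e => hn f hf (e ▸ nin g h1), h2, h3, ?_⟩
        rintro k (⟨hk, hks⟩ | hk) hxk hyk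
        · left; exact (hu k hk hxk hyk).resolve_right hks
        · right; exact h4 k hk hxk hyk
      · refine ⟨g, Or.inl ⟨hg, hgs⟩, hgf, hxg, hyg, ?_⟩
        rintro k (⟨hk, hks⟩ | hk) hxk hyk
        · exact hu k hk hxk hyk
        · exfalso
          have := hu _ hs ((newsub k x hk hxk).resolve_left hxn) ((newsub k y hk hyk).resolve_left hyn)
          rcases this with e | e
          · exact hfs e.symm
          · exact hgs e.symm
    · by_cases hxn : x = n
      · subst hxn
        obtain ⟨g, h1, h2, h3, h4⟩ := np y f hf hxy.symm hy
        refine ⟨g, Or.inr h1, h2, nin g h1, h3, ?_⟩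
        rintro k (⟨hk, hks⟩ | hk) hxk hyk
        · exact absurd hxk (hn k hk)
        · exact h4 k hk hyk
      by_cases hyn : y = n
      · subst hyn
        obtain ⟨g, h1, h2, h3, h4⟩ := np x f hf hxy hx
        refine ⟨g, Or.inr h1, h2, h3, nin g h1, ?_⟩
        rintro k (⟨hk, hks⟩ | hk) hxk hyk
        · exact absurd hyk (hn k hk)
        · exact h4 k hk hxk
      have hxs := (newsub f x hf hx).resolve_left hxn
      have hys := (newsub f y hf hy).resolve_left hyn
      obtain ⟨g, hg, hgf, hxg, hyg, hu⟩ := ih x y hxy _ hs hxs hys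
      obtain ⟨g', h1, h2, h3, h4⟩ := sp x y hxy hxs hys
      have := h4 f hf hx hy
      subst this
      refine ⟨g, Or.inl ⟨hg, hgf⟩, fun e => hn g hg (e ▸ nin _ hf), hxg, hyg, ?_⟩
      rintro k (⟨hk, hks⟩ | hk) hxk hyk
      · right; exact (hu k hk hxk hyk).resolve_left hks
      · left; exact h4 k hk hxk hyk

/-- old pairs persist -/
theorem pair_step {n : ℕ} {Fc bags : Finset (Finset ℕ)} {s : Finset ℕ} (h : Apo n Fc bags) (hs : s ∈ Fc)
    {x y : ℕ} {f : Finset ℕ} (hf : f ∈ Fc) (hx : x ∈ f) (hy : y ∈ f) :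
    ∃ f' ∈ Fc.erase s ∪ s.image (fun x => insert n (s.erase x)), x ∈ f' ∧ y ∈ f' := by
  obtain ⟨a, b, c, hab, hbc, hac, rfl, ha, hb, hc, hmem⟩ := step_form h hs
  simp only [hmem]
  by_cases e : f = {a,b,c}
  · subst e
    simp only [Finset.mem_insert, Finset.mem_singleton] at hx hy
    rcases hx with rfl | rfl | rfl <;> rcases hy with rfl | rfl | rfl
    all_goals first
        | (refine ⟨_, Or.inr (Or.inl rfl), ?_, ?_⟩ <;> (simp; done))
        | (refine ⟨_, Or.inr (Or.inr (Or.inl rfl)), ?_, ?_⟩ <;> (simp; done))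
        | (refine ⟨_, Or.inr (Or.inr (Or.inr rfl)), ?_, ?_⟩ <;> (simp; done))
  · exact ⟨f, Or.inl ⟨hf, e⟩, hx, hy⟩

theorem new_pair {n : ℕ} {Fc bags : Finset (Finset ℕ)} {s : Finset ℕ} (h : Apo n Fc bags) (hs : s ∈ Fc)
    {x : ℕ} (hx : x ∈ insert n s) :
    ∃ f' ∈ Fc.erase s ∪ s.image (fun x => insert n (s.erase x)), x ∈ f' ∧ n ∈ f' := by
  obtain ⟨a, b, c, hab, hbc, hac, rfl, ha, hb, hc, hmem⟩ := step_form h hs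
  simp only [hmem]
  simp only [Finset.mem_insert, Finset.mem_singleton] at hx 
  rcases hx with rfl | rfl | rfl | rfl
  all_goals first
        | (refine ⟨_, Or.inr (Or.inl rfl), ?_, ?_⟩ <;> (simp; done))
        | (refine ⟨_, Or.inr (Or.inr (Or.inl rfl)), ?_, ?_⟩ <;> (simp; done))

theorem bag_face {n : ℕ} {Fc bags : Finset (Finset ℕ)} (h : Apo n Fc bags) :
    ∀ b ∈ bags, ∀ x ∈ b, ∀ y ∈ b, ∃ f ∈ Fc, x ∈ f ∧ y ∈ f := by
  induction h with
  | base => unfold apoBase; decide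
  | @step n Fc bags s h hs ih =>
    intro b hb x hx y hy
    rw [Finset.mem_insert] at hb
    rcases hb with rfl | hb
    · by_cases hxn : x = n
      · subst hxn
        obtain ⟨f, h1, h2, h3⟩ := new_pair h hs hy
        exact ⟨f, h1, h3, h2⟩
      by_cases hyn : y = n
      · subst hyn
        exact new_pair h hs hx
      exact pair_step h hs hs (by simpa [hxn] using hx) (by simpa [hyn] using hy)
    · obtain ⟨f, hf, h1, h2⟩ := ih b hb x hx y hy
      exact pair_step h hs hf h1 h2

theorem face_bag {n : ℕ} {Fc bags : Finset (Finset ℕ)} (h : Apo n Fc bags) :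
    ∀ f ∈ Fc, ∃ b ∈ bags, f ⊆ b := by
  induction h with
  | base => unfold apoBase; decide
  | @step n Fc bags s h hs ih =>
    intro f hf
    simp only [Finset.mem_union, Finset.mem_erase, Finset.mem_image] at hf
    rcases hf with ⟨_, hf⟩ | ⟨x, hx, rfl⟩
    · obtain ⟨b, hb, h1⟩ := ih f hf
      exact ⟨b, Finset.mem_insert_of_mem hb, h1⟩
    · exact ⟨_, Finset.mem_insert_self _ _, Finset.insert_subset_insert _ (Finset.erase_subset _ _)⟩

theorem conn {n : ℕ} {Fc bags : Finset (Finset ℕ)} (h : Apo n Fc bags) :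
    ∀ v < n, Relation.ReflTransGen (fun x y => ∃ f ∈ Fc, x ∈ f ∧ y ∈ f) 0 v := by
  induction h with
  | base =>
    intro v hv
    apply Relation.ReflTransGen.single
    revert v; unfold apoBase; decide
  | @step n Fc bags s h hs ih =>
    have mono : ∀ v < n, Relation.ReflTransGen (fun x y => ∃ f ∈ Fc.erase s ∪ s.image (fun x => insert n (s.erase x)), x ∈ f ∧ y ∈ f) 0 v := by
      intro v hv
      refine Relation.ReflTransGen.mono ?_ _ _ (ih v hv)
      rintro x y ⟨f, hf, hx, hy⟩
      exact pair_step h hs hf hx hy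
    intro v hv
    rcases Nat.lt_succ_iff_lt_or_eq.1 hv with hv | rfl
    · exact mono v hv
    · obtain ⟨c3, lt⟩ := h.basic.2.1 s hs
      obtain ⟨x, hx⟩ := Finset.card_pos.1 (by omega : 0 < s.card)
      exact (mono x (lt x hx)).tail (new_pair h hs (Finset.mem_insert_of_mem hx))

theorem face_of {n : ℕ} {Fc bags : Finset (Finset ℕ)} (h : Apo n Fc bags) :
    ∀ v < n, ∃ f ∈ Fc, v ∈ f := by
  induction h with
  | base => unfold apoBase; decide
  | @step n Fc bags s h hs ih =>
    intro v hv
    rcases Nat.lt_succ_iff_lt_or_eq.1 hv with hv | rfl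
    · obtain ⟨f, hf, hx⟩ := ih v hv
      obtain ⟨f', h1, h2, _⟩ := pair_step h hs hf hx hx
      exact ⟨f', h1, h2⟩
    · obtain ⟨f', h1, h2, _⟩ := new_pair h hs (Finset.mem_insert_self v s)
      exact ⟨f', h1, h2⟩

def LinkR (Fc : Finset (Finset ℕ)) (v : ℕ) (f g : Finset ℕ) : Prop :=
  f ∈ Fc ∧ g ∈ Fc ∧ v ∈ f ∧ v ∈ g ∧ ∃ w ≠ v, w ∈ f ∧ w ∈ g

set_option synthInstance.maxSize 4000 in
set_option synthInstance.maxHeartbeats 200000 in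
theorem link {n : ℕ} {Fc bags : Finset (Finset ℕ)} (h : Apo n Fc bags) :
    ∀ v, ∀ f ∈ Fc, ∀ g ∈ Fc, v ∈ f → v ∈ g → Relation.EqvGen (LinkR Fc v) f g := by
  induction h with
  | base =>
    intro v f hf g hg hvf hvg
    apply Relation.EqvGen.rel
    have hv : v < 4 := ((Apo.base).basic.2.1 f hf).2 v hvf
    have key : ∀ v < 4, ∀ f ∈ apoBase, ∀ g ∈ apoBase, v ∈ f → v ∈ g → ∃ w, w < 4 ∧ w ≠ v ∧ w ∈ f ∧ w ∈ g := by
      unfold apoBase; decide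
    obtain ⟨w, _, h2, h3, h4⟩ := key v hv f hf g hg hvf hvg
    exact ⟨hf, hg, hvf, hvg, w, h2, h3, h4⟩
  | @step n Fc bags s h hs ih =>
    obtain ⟨a, b, c, hab, hbc, hac, rfl, ha, hb, hc, hmem⟩ := step_form h hs
    obtain ⟨i1, i2, i3⟩ := h.basic
    have hn : ∀ f ∈ Fc, n ∉ f := fun f hf hh => by have := (i2 f hf).2 n hh; omega
    set Fc' := Fc.erase {a,b,c} ∪ ({a,b,c} : Finset ℕ).image (fun x => insert n (({a,b,c} : Finset ℕ).erase x)) with hF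
    intro v f hf g hg hvf hvg
    have nin : ∀ g : Finset ℕ, (g = {n,b,c} ∨ g = {n,a,c} ∨ g = {n,a,b}) → n ∈ g := by
      rintro g (rfl | rfl | rfl) <;> simp
    have newsub : ∀ (g : Finset ℕ) (x : ℕ), (g = {n,b,c} ∨ g = {n,a,c} ∨ g = {n,a,b}) → x ∈ g → x = n ∨ x ∈ ({a,b,c} : Finset ℕ) := by
      rintro g x (rfl | rfl | rfl) hx <;> simp at hx ⊢ <;> tauto
    by_cases hvn : v = n
    · subst hvn
      rw [hmem] at hf hg
      have hf' := hf.resolve_left (fun e => hn f e.1 hvf)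
      have hg' := hg.resolve_left (fun e => hn g e.1 hvg)
      apply Relation.EqvGen.rel
      refine ⟨(hmem f).2 hf, (hmem g).2 hg, hvf, hvg, ?_⟩
      rcases hf' with rfl | rfl | rfl <;> rcases hg' with rfl | rfl | rfl
      all_goals first
        | (refine ⟨a, by omega, ?_, ?_⟩ <;> (simp; done))
        | (refine ⟨b, by omega, ?_, ?_⟩ <;> (simp; done))
        | (refine ⟨c, by omega, ?_, ?_⟩ <;> (simp; done))
    -- two new faces through v are linked
    have nn : ∀ f g : Finset ℕ, (f = {n,b,c} ∨ f = {n,a,c} ∨ f = {n,a,b}) → (g = {n,b,c} ∨ g = {n,a,c} ∨ g = {n,a,b}) →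
        v ∈ f → v ∈ g → Relation.EqvGen (LinkR Fc' v) f g := by
      intro f g hf hg h1 h2
      exact Relation.EqvGen.rel _ _ ⟨(hmem f).2 (Or.inr hf), (hmem g).2 (Or.inr hg), h1, h2, n, Ne.symm hvn, nin f hf, nin g hg⟩
    -- map of an old face to new faces
    let R : Finset ℕ → Finset ℕ → Prop := fun f f' => v ∈ f' ∧ ((f ≠ {a,b,c} ∧ f' = f ∧ f ∈ Fc) ∨ (f = {a,b,c} ∧ (f' = {n,b,c} ∨ f' = {n,a,c} ∨ f' = {n,a,b})))
    have Rsame : ∀ f f' g', R f f' → R f g' → Relation.EqvGen (LinkR Fc' v) f' g' := by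
      rintro f f' g' ⟨h0, h1 | h1⟩ ⟨h2, h3 | h3⟩
      · rw [h1.2.1, h3.2.1]; exact Relation.EqvGen.refl _
      · exact absurd h3.1 h1.1
      · exact absurd h1.1 h3.1
      · exact nn _ _ h1.2 h3.2 h0 h2
    have Rex : ∀ f ∈ Fc, v ∈ f → ∃ f', R f f' := by
      intro f hf hv
      by_cases e : f = {a,b,c}
      · subst e
        simp only [Finset.mem_insert, Finset.mem_singleton] at hv
        rcases hv with rfl | rfl | rfl
        · exact ⟨{n,v,c}, by simp, Or.inr ⟨rfl, Or.inr (Or.inl rfl)⟩⟩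
        · exact ⟨{n,v,c}, by simp, Or.inr ⟨rfl, Or.inl rfl⟩⟩
        · exact ⟨{n,b,v}, by simp, Or.inr ⟨rfl, Or.inl rfl⟩⟩
      · exact ⟨f, hv, Or.inl ⟨e, rfl, hf⟩⟩
    have Rpair : ∀ f ∈ Fc, v ∈ f → ∀ w ∈ f, ∃ f', R f f' ∧ w ∈ f' := by
      intro f hf hv w hw
      by_cases e : f = {a,b,c}
      · subst e
        simp only [Finset.mem_insert, Finset.mem_singleton] at hv hw
        rcases hv with rfl | rfl | rfl <;> rcases hw with rfl | rfl | rfl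
        all_goals first
          | (refine ⟨_, ⟨?_, Or.inr ⟨rfl, Or.inl rfl⟩⟩, ?_⟩ <;> (simp; done))
          | (refine ⟨_, ⟨?_, Or.inr ⟨rfl, Or.inr (Or.inl rfl)⟩⟩, ?_⟩ <;> (simp; done))
          | (refine ⟨_, ⟨?_, Or.inr ⟨rfl, Or.inr (Or.inr rfl)⟩⟩, ?_⟩ <;> (simp; done))
      · exact ⟨f, ⟨hv, Or.inl ⟨e, rfl, hf⟩⟩, hw⟩
    have Rmem : ∀ f f', R f f' → f' ∈ Fc' := by
      rintro f f' ⟨_, ⟨h1, h2, h3⟩ | ⟨_, h1⟩⟩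
      · rw [hmem, h2]; exact Or.inl ⟨h3, h1⟩
      · rw [hmem]; exact Or.inr h1
    have key : ∀ f g, Relation.EqvGen (LinkR Fc v) f g → f = g ∨ (f ∈ Fc ∧ g ∈ Fc ∧ v ∈ f ∧ v ∈ g ∧ ∀ f' g', R f f' → R g g' → Relation.EqvGen (LinkR Fc' v) f' g') := by
      intro f g hfg
      induction hfg with
      | rel f g hl =>
        obtain ⟨h1, h2, h3, h4, w, h5, h6, h7⟩ := hl
        refine Or.inr ⟨h1, h2, h3, h4, fun f' g' hf' hg' => ?_⟩
        obtain ⟨f'', hf'', hw⟩ := Rpair f h1 h3 w h6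
        obtain ⟨g'', hg'', hw'⟩ := Rpair g h2 h4 w h7
        refine (Rsame f f' f'' hf' hf'').trans _ _ _ (Relation.EqvGen.trans _ _ _ ?_ (Rsame g g'' g' hg'' hg'))
        exact Relation.EqvGen.rel _ _ ⟨Rmem _ _ hf'', Rmem _ _ hg'', hf''.1, hg''.1, w, h5, hw, hw'⟩
      | refl f => exact Or.inl rfl
      | symm f g _ ih =>
        rcases ih with rfl | ⟨h1, h2, h3, h4, h5⟩
        · exact Or.inl rfl
        · exact Or.inr ⟨h2, h1, h4, h3, fun f' g' hf' hg' => (h5 g' f' hg' hf').symm _ _⟩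
      | trans f g k _ _ ih1 ih2 =>
        rcases ih1 with rfl | ⟨h1, h2, h3, h4, h5⟩
        · exact ih2
        rcases ih2 with rfl | ⟨k1, k2, k3, k4, k5⟩
        · exact Or.inr ⟨h1, h2, h3, h4, h5⟩
        refine Or.inr ⟨h1, k2, h3, k4, fun f' g' hf' hg' => ?_⟩
        obtain ⟨m, hm⟩ := Rex g h2 h4
        exact (h5 f' m hf' hm).trans _ _ _ (k5 m g' hm hg')
    have Rback : ∀ f' ∈ Fc', v ∈ f' → ∃ f ∈ Fc, v ∈ f ∧ R f f' := by
      intro f' hf' hv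
      rw [hmem] at hf'
      rcases hf' with ⟨h1, h2⟩ | h1
      · exact ⟨f', h1, hv, hv, Or.inl ⟨h2, rfl, h1⟩⟩
      · exact ⟨{a,b,c}, hs, (newsub f' v h1 hv).resolve_left hvn, hv, Or.inr ⟨rfl, h1⟩⟩
    obtain ⟨f0, hf0, hvf0, hR⟩ := Rback f hf hvf
    obtain ⟨g0, hg0, hvg0, hR'⟩ := Rback g hg hvg
    rcases key f0 g0 (ih v f0 hf0 g0 hg0 hvf0 hvg0) with e | e
    · subst e; exact Rsame _ _ _ hR hR'
    · exact e.2.2.2.2 f g hR hR'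

end Apo


namespace Apo

theorem enum {n : ℕ} {f : Finset ℕ} (h3 : f.card = 3) (hlt : ∀ x ∈ f, x < n) :
    ∃ a : ℕ → Fin n, (∀ i, a (i+3) = a i) ∧ (∀ i j, i < 3 → j < 3 → a i = a j → i = j) ∧
      (∀ x : Fin n, x.1 ∈ f ↔ ∃ i < 3, a i = x) := by
  obtain ⟨x, y, z, hxy, hxz, hyz, rfl⟩ := Finset.card_eq_three.1 h3
  have hx := hlt x (by simp)
  have hy := hlt y (by simp)
  have hz := hlt z (by simp)
  refine ⟨fun i => if i % 3 = 0 then ⟨x, hx⟩ else if i % 3 = 1 then ⟨y, hy⟩ else ⟨z, hz⟩, ?_, ?_, ?_⟩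
  · intro i; simp
  · intro i j hi hj
    interval_cases i <;> interval_cases j <;> simp [hxy, hxz, hyz, hxy.symm, hxz.symm, hyz.symm]
  · intro w
    simp only [Finset.mem_insert, Finset.mem_singleton]
    constructor
    · rintro (h | h | h)
      · exact ⟨0, by omega, by simp [Fin.ext_iff, h]⟩
      · exact ⟨1, by omega, by simp [Fin.ext_iff, h]⟩
      · exact ⟨2, by omega, by simp [Fin.ext_iff, h]⟩
    · rintro ⟨i, hi, h⟩
      interval_cases i <;> simp [Fin.ext_iff] at h <;> omega

theorem enum_pos {n : ℕ} {a : ℕ → Fin n} (h1 : ∀ i, a (i+3) = a i)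
    (h2 : ∀ i j, i < 3 → j < 3 → a i = a j → i = j) {u v : Fin n} (huv : u ≠ v)
    (hu : ∃ i < 3, a i = u) (hv : ∃ i < 3, a i = v) :
    ∃ i < 3, s(a i, a (i+1)) = s(u,v) ∧ ∀ j < 3, s(a j, a (j+1)) = s(u,v) → j = i := by
  obtain ⟨i, hi, rfl⟩ := hu
  obtain ⟨j, hj, rfl⟩ := hv
  have e3 : a 3 = a 0 := h1 0
  have n01 : a 0 ≠ a 1 := fun e => by have := h2 0 1 (by omega) (by omega) e; omega
  have n02 : a 0 ≠ a 2 := fun e => by have := h2 0 2 (by omega) (by omega) e; omega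
  have n12 : a 1 ≠ a 2 := fun e => by have := h2 1 2 (by omega) (by omega) e; omega
  have key : ∀ k < 3, s(a k, a (k+1)) = s(a i, a j) → ∀ j' < 3, s(a j', a (j'+1)) = s(a i, a j) → j' = k := by
    intro k hk e j' hj' e'
    rw [← e] at e'
    clear e
    have n01' := n01.symm
    have n02' := n02.symm
    have n12' := n12.symm
    interval_cases k <;> interval_cases j' <;> simp [Sym2.eq_iff, e3, n01, n02, n12, n01', n02', n12'] at e' ⊢
  have ex : ∃ k < 3, s(a k, a (k+1)) = s(a i, a j) := by
    interval_cases i <;> interval_cases j <;> first | exact absurd rfl huv | skip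
    · exact ⟨0, by omega, rfl⟩
    · exact ⟨2, by omega, by simp [e3]⟩
    · exact ⟨0, by omega, by simp⟩
    · exact ⟨1, by omega, by simp⟩
    · exact ⟨2, by omega, by simp [e3]⟩
    · exact ⟨1, by omega, by simp⟩
  obtain ⟨k, hk, e⟩ := ex
  exact ⟨k, hk, e, key k hk e⟩

open Multigraph in
theorem planar {n : ℕ} {Fc bags : Finset (Finset ℕ)} (h : Apo n Fc bags) {W : Type} (H : SimpleGraph W)
    (φ : W → ℕ) (hφ : Function.Injective φ) (hlt : ∀ w, φ w < n)
    (hadj : ∀ x y, H.Adj x y → ∃ b ∈ bags, φ x ∈ b ∧ φ y ∈ b) : IsPlanar H := by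
  classical
  obtain ⟨i1, i2, i3⟩ := h.basic
  have hen : ∀ f : Fc, _ := fun f => enum (i2 f.1 f.2).1 (i2 f.1 f.2).2
  choose a a1 a2 a3 using hen
  let E' := {q : Sym2 (Fin n) // ¬ q.IsDiag ∧ ∃ f ∈ Fc, ∀ x ∈ q, (x:ℕ) ∈ f}
  let M : Multigraph (Fin n) E' := ⟨fun e => e.1⟩
  have am : ∀ f i, a f (i % 3) = a f i := by
    intro f i
    have : ∀ k j, a f (j + 3 * k) = a f j := by
      intro k; induction k with
      | zero => intro j; rfl
      | succ k ih => intro j; rw [← ih j, ← a1 f (j + 3 * k)]; rfl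
    conv_rhs => rw [← Nat.mod_add_div i 3]
    rw [this]
  have ain : ∀ f i, ((a f i : Fin n) : ℕ) ∈ f.1 := fun f i => (a3 f _).2 ⟨i % 3, Nat.mod_lt _ (by omega), am f i⟩
  have ane : ∀ f i, a f i ≠ a f (i+1) := by
    intro f i e
    rw [← am f i, ← am f (i+1)] at e
    have := a2 f _ _ (Nat.mod_lt _ (by omega)) (Nat.mod_lt _ (by omega)) e
    omega
  let bd : Fc → M.CWalk := fun f =>
    { len := 3
      len_pos := by omega
      vtx := a f
      edge := fun i => ⟨s(a f i, a f (i+1)), by simpa using ane f i, f.1, f.2, by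
        intro x hx
        rcases Sym2.mem_iff.1 hx with rfl | rfl <;> exact ain _ _⟩
      vtx_per := a1 f
      edge_per := fun i => by
        apply Subtype.ext
        simp only
        rw [a1 f i, show i + 3 + 1 = (i + 1) + 3 by ring, a1 f (i+1)]
      compat := fun i => rfl }
  have occ : ∀ (u v : Fin n) (huv : u ≠ v) (f : Fc), u.1 ∈ f.1 → v.1 ∈ f.1 → 
      ∃ i < 3, s(a f i, a f (i+1)) = s(u,v) ∧ ∀ j < 3, s(a f j, a f (j+1)) = s(u,v) → j = i := by
    intro u v huv f hu hv
    exact enum_pos (a1 f) (a2 f) huv ((a3 f u).1 hu) ((a3 f v).1 hv)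
  let emb : M.Embedding Fc :=
    { boundary := bd
      conn := by
        have h0 : 0 < n := by omega
        have : ∀ v (hv : v < n), M.simple.Reachable ⟨0, h0⟩ ⟨v, hv⟩ := by
          intro v hv
          have hc := h.conn v hv
          have : ∀ v, Relation.ReflTransGen (fun x y => ∃ f ∈ Fc, x ∈ f ∧ y ∈ f) 0 v → 
              ∀ (hv : v < n), M.simple.Reachable ⟨0, h0⟩ ⟨v, hv⟩ := by
            intro v hc
            induction hc with
            | refl => intro hv; exact SimpleGraph.Reachable.refl _
            | @tail x y _ hxy ih =>
              intro hy
              obtain ⟨f, hf, hx, hy'⟩ := hxy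
              have hx' := (i2 f hf).2 x hx
              by_cases e : x = y
              · subst e; exact ih hx'
              · refine (ih hx').trans (SimpleGraph.Adj.reachable ⟨by simpa [Fin.ext_iff] using e, ?_⟩)
                refine ⟨⟨s(⟨x, hx'⟩, ⟨y, hy⟩), by simpa [Fin.ext_iff] using e, f, hf, ?_⟩, rfl⟩
                intro z hz
                rcases Sym2.mem_iff.1 hz with rfl | rfl <;> assumption
          exact this v hc hv
        have hne : Nonempty (Fin n) := ⟨⟨0, h0⟩⟩
        exact ⟨fun u v => (this u.1 u.2).symm.trans (this v.1 v.2)⟩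
      edge_twice := by
        rintro ⟨q, hq, f, hf, hqf⟩
        induction q using Sym2.ind with
        | _ u v =>
        have huv : u ≠ v := by simpa using hq
        have hu : u.1 ∈ f := hqf u (by simp)
        have hv : v.1 ∈ f := hqf v (by simp)
        obtain ⟨g, hg, hgf, hug, hvg, huniq⟩ := h.pair u.1 v.1 (by simpa [Fin.ext_iff] using huv) f hf hu hv
        obtain ⟨i, hi, ei, ui⟩ := occ u v huv ⟨f, hf⟩ hu hv
        obtain ⟨j, hj, ej, uj⟩ := occ u v huv ⟨g, hg⟩ hug hvg
        have : {p : Fc × ℕ | IsOcc bd ⟨s(u,v), hq, f, hf, hqf⟩ p} = {(⟨f,hf⟩, i), (⟨g,hg⟩, j)} := by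
          ext ⟨k, l⟩
          simp only [Set.mem_ofPred_eq, IsOcc, Set.mem_insert_iff, Set.mem_singleton_iff, Prod.mk.injEq]
          constructor
          · rintro ⟨hl, he⟩
            have he : s(a k l, a k (l+1)) = s(u,v) := congrArg Subtype.val he
            have hl : l < 3 := hl
            have mk : ∀ x, x ∈ s(u,v) → (x : ℕ) ∈ k.1 := by
              intro x hx
              rw [← he] at hx
              rcases Sym2.mem_iff.1 hx with rfl | rfl <;> exact ain _ _
            rcases huniq k.1 k.2 (mk u (by simp)) (mk v (by simp)) with e | e
            · left
              have e' : k = ⟨f, hf⟩ := Subtype.ext e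
              subst e'
              exact ⟨rfl, ui l hl he⟩
            · right
              have e' : k = ⟨g, hg⟩ := Subtype.ext e
              subst e'
              exact ⟨rfl, uj l hl he⟩
          · rintro (⟨rfl, rfl⟩ | ⟨rfl, rfl⟩)
            · exact ⟨hi, Subtype.ext ei⟩
            · exact ⟨hj, Subtype.ext ej⟩
        rw [this, Set.ncard_pair]
        intro e
        exact hgf (congrArg (fun p => p.1.1) e).symm
      link_conn := by
        have same : ∀ v c c', IsCorner bd v c → IsCorner bd v c' → c.1 = c'.1 → c = c' := by
          rintro v ⟨f, i⟩ ⟨g, j⟩ ⟨h1, h2⟩ ⟨h3, h4⟩ e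
          simp only at e
          subst e
          have := a2 f i j h1 h3 (h2.trans h4.symm)
          rw [this]
        have inf : ∀ v c, IsCorner bd v c → (v : ℕ) ∈ c.1.1 := by
          rintro v ⟨f, i⟩ ⟨h1, h2⟩
          have h2 : a f i = v := h2
          rw [← h2]; exact ain _ _
        have key : ∀ (v : Fin n) (f g : Finset ℕ), Relation.EqvGen (LinkR Fc v) f g →
           f = g ∨ (∃ c, IsCorner bd v c ∧ c.1.1 = f) ∧ (∃ c, IsCorner bd v c ∧ c.1.1 = g) ∧ 
            ∀ c c', IsCorner bd v c → IsCorner bd v c' → c.1.1 = f → c'.1.1 = g → 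
              Relation.EqvGen (CornerLinked bd v) c c' := by
          have ex : ∀ (v : Fin n) (f : Finset ℕ), f ∈ Fc → v.1 ∈ f → ∃ c, IsCorner bd v c ∧ c.1.1 = f := by
            intro v f hf hv
            obtain ⟨i, hi, e⟩ := (a3 ⟨f, hf⟩ v).1 hv
            exact ⟨(⟨f, hf⟩, i), ⟨hi, e⟩, rfl⟩
          intro v f g hfg
          induction hfg with
          | rel f g hl =>
            obtain ⟨h1, h2, h3, h4, w, h5, h6, h7⟩ := hl
            by_cases efg : f = g
            · exact Or.inl efg
            refine Or.inr ⟨ex v f h1 h3, ex v g h2 h4, ?_⟩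
            rintro ⟨f', i⟩ ⟨g', j⟩ hc hc' e e'
            simp only at e e'
            have ef : f' = ⟨f, h1⟩ := Subtype.ext e
            have eg : g' = ⟨g, h2⟩ := Subtype.ext e'
            subst ef eg
            have hwn := (i2 f h1).2 w h6
            have hvw : v ≠ (⟨w, hwn⟩ : Fin n) := by rw [Ne, Fin.ext_iff]; exact fun e => h5 e.symm
            obtain ⟨k, hk, ek, uk⟩ := occ v ⟨w, hwn⟩ hvw ⟨f, h1⟩ h3 h6
            obtain ⟨l, hl, el, ul⟩ := occ v ⟨w, hwn⟩ hvw ⟨g, h2⟩ h4 h7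
            apply Relation.EqvGen.rel
            have en : ∀ (f : Fc) i k, k < 3 → IsCorner bd v (f, i) → s(a f k, a f (k+1)) = s(v, ⟨w, hwn⟩) → EndOf bd (f, i) (f, k) := by
              intro f i k hk hc e
              refine ⟨rfl, ?_⟩
              have hvm : v ∈ s(a f k, a f (k+1)) := by rw [e]; simp
              have hc1 : i < 3 := hc.1
              have hc2 : a f i = v := hc.2
              rcases Sym2.mem_iff.1 hvm with e | e
              · left; exact a2 f i k hc1 hk (hc2.trans e)
              · right
                refine a2 f i _ hc1 (Nat.mod_lt (k+1) (show 0 < 3 by omega)) ?_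
                have : a f ((k+1) % 3) = a f (k+1) := am f (k+1)
                rw [hc2, e]; exact this.symm
            refine ⟨hc, hc', ⟨s(v, ⟨w, hwn⟩), by simpa using hvw, f, h1, ?_⟩, (⟨f,h1⟩, k), (⟨g,h2⟩, l), ?_, ⟨hk, Subtype.ext ek⟩, ⟨hl, Subtype.ext el⟩, en _ _ _ hk hc ek, en _ _ _ hl hc' el⟩
            · intro x hx
              rcases Sym2.mem_iff.1 hx with rfl | rfl <;> assumption
            · intro e
              exact efg (congrArg (fun p => p.1.1) e)
          | refl f => exact Or.inl rfl
          | symm f g _ ih =>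
            rcases ih with e | ⟨h1, h2, h3⟩
            · exact Or.inl e.symm
            · exact Or.inr ⟨h2, h1, fun c c' k1 k2 k3 k4 => (h3 c' c k2 k1 k4 k3).symm _ _⟩
          | trans f g k _ _ ih1 ih2 =>
            rcases ih1 with rfl | ⟨h1, h2, h3⟩
            · exact ih2
            rcases ih2 with rfl | ⟨k1, k2, k3⟩
            · exact Or.inr ⟨h1, h2, h3⟩
            refine Or.inr ⟨h1, k2, fun c c' q1 q2 q3 q4 => ?_⟩
            obtain ⟨m, hm, em⟩ := h2
            exact (h3 c m q1 hm q3 em).trans _ _ _ (k3 m c' hm q2 em q4)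
        intro v c c' hc hc'
        rcases key v _ _ (h.link v.1 c.1.1 c.1.2 c'.1.1 c'.1.2 (inf v c hc) (inf v c' hc')) with e | e
        · rw [same v c c' hc hc' (Subtype.ext e)]
          exact Relation.EqvGen.refl _
        · exact e.2.2 c c' hc hc' rfl rfl }
  have hs := sum_len emb
  have hs' : 3 * Fc.card = 2 * Fintype.card E' := by
    rw [← hs]
    have : ∀ f, (emb.boundary f).len = 3 := fun f => rfl
    simp [this, mul_comm]
  have hf := h.card_faces
  refine ⟨Fin n, E', Fc, inferInstance, inferInstance, inferInstance, M, emb, ?_, ⟨⟨fun w => ⟨φ w, hlt w⟩, ?_⟩, ?_⟩⟩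
  · unfold Embedding.eulerGenus
    rw [Nat.card_eq_fintype_card, Nat.card_eq_fintype_card, Nat.card_eq_fintype_card, Fintype.card_fin, Fintype.card_coe]
    omega
  · intro x y hxy
    obtain ⟨b, hb, hx, hy⟩ := hadj x y hxy
    obtain ⟨f, hf, hxf, hyf⟩ := h.bag_face b hb _ hx _ hy
    have hne : (⟨φ x, hlt x⟩ : Fin n) ≠ ⟨φ y, hlt y⟩ := by
      rw [Ne, Fin.mk.injEq]; exact fun e => hxy.ne (hφ e)
    refine ⟨hne, ⟨s(⟨φ x, hlt x⟩, ⟨φ y, hlt y⟩), by simpa using hne, f, hf, ?_⟩, rfl⟩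
    intro z hz
    rcases Sym2.mem_iff.1 hz with rfl | rfl <;> assumption
  · intro x y e
    have e : (⟨φ x, hlt x⟩ : Fin n) = ⟨φ y, hlt y⟩ := e
    rw [Fin.mk.injEq] at e
    exact hφ e

end Apo


def leafExt {ι : Type} (T : SimpleGraph ι) (i0 : ι) : SimpleGraph (Option ι) where
  Adj x y := (∃ a b, x = some a ∧ y = some b ∧ T.Adj a b) ∨ (x = none ∧ y = some i0) ∨ (x = some i0 ∧ y = none)
  symm := by
    constructor
    rintro x y (⟨a, b, h1, h2, h3⟩ | ⟨h1, h2⟩ | ⟨h1, h2⟩)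
    · exact Or.inl ⟨b, a, h2, h1, h3.symm⟩
    · exact Or.inr (Or.inr ⟨h2, h1⟩)
    · exact Or.inr (Or.inl ⟨h2, h1⟩)
  loopless := by
    constructor
    rintro x (⟨a, b, h1, h2, h3⟩ | ⟨h1, h2⟩ | ⟨h1, h2⟩)
    · rw [h1] at h2; cases h2; exact T.loopless.irrefl _ h3
    · rw [h1] at h2; cases h2
    · rw [h1] at h2; cases h2

theorem reach_iff {α : Type} (G : SimpleGraph α) (x y : α) : G.Reachable x y ↔ Relation.ReflTransGen G.Adj x y := by
  exact SimpleGraph.reachable_iff_reflTransGen x y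

theorem leafExt_tree {ι : Type} {T : SimpleGraph ι} (hT : T.IsTree) (i0 : ι) : (leafExt T i0).IsTree := by
  obtain ⟨hc, ha⟩ := hT
  have hs : ∀ a b, (leafExt T i0).Reachable (some a) (some b) := by
    intro a b
    have := (reach_iff T a b).1 (hc.preconnected a b)
    rw [reach_iff]
    exact Relation.ReflTransGen.lift some (fun x y h => Or.inl ⟨x, y, rfl, rfl, h⟩) _ _ this
  have hn : (leafExt T i0).Reachable none (some i0) := SimpleGraph.Adj.reachable (Or.inr (Or.inl ⟨rfl, rfl⟩))
  refine ⟨?_, ?_⟩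
  · have : Nonempty (Option ι) := ⟨none⟩
    refine ⟨fun x y => ?_⟩
    cases x with
    | none => cases y with
      | none => exact SimpleGraph.Reachable.refl _
      | some b => exact hn.trans (hs _ _)
    | some a => cases y with
      | none => exact (hs _ _).trans hn.symm
      | some b => exact hs _ _
  · rw [SimpleGraph.isAcyclic_iff_forall_adj_isBridge] at ha ⊢
    have leaf : ¬ ((leafExt T i0) \ SimpleGraph.fromEdgeSet {s(none, some i0)}).Reachable none (some i0) := by
      intro h
      rw [reach_iff] at h
      obtain h | ⟨c, hc, _⟩ := Relation.ReflTransGen.cases_head h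
      · cases h
      · rw [SimpleGraph.sdiff_adj] at hc
        obtain ⟨(⟨a, b, h1, h2, h3⟩ | ⟨h1, h2⟩ | ⟨h1, h2⟩), hne⟩ := hc
        · cases h1
        · subst h2; apply hne; simp
        · cases h1
    rintro x y (⟨a, b, rfl, rfl, hab⟩ | ⟨rfl, rfl⟩ | ⟨rfl, rfl⟩)
    · have hb := ha hab
      rw [SimpleGraph.isBridge_iff] at hb ⊢
      intro h
      apply hb
      rw [reach_iff] at h ⊢
      have key : ∀ x y, Relation.ReflTransGen ((leafExt T i0) \ SimpleGraph.fromEdgeSet {s(some a, some b)}).Adj x y →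
         Relation.ReflTransGen (T \ SimpleGraph.fromEdgeSet {s(a, b)}).Adj (x.getD i0) (y.getD i0) := by
        intro x y h
        induction h with
        | refl => exact Relation.ReflTransGen.refl
        | @tail y z _ hyz ih =>
          rw [SimpleGraph.sdiff_adj] at hyz
          obtain ⟨(⟨c, d, rfl, rfl, h3⟩ | ⟨rfl, rfl⟩ | ⟨rfl, rfl⟩), hne⟩ := hyz
          · refine ih.tail ?_
            rw [SimpleGraph.sdiff_adj]
            refine ⟨h3, fun hh => hne ?_⟩
            simp only [SimpleGraph.fromEdgeSet_adj, Set.mem_singleton_iff] at hh ⊢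
            simp only [Option.getD_some] at hh
            refine ⟨?_, by simpa using hh.2⟩
            have := congrArg (Sym2.map some) hh.1
            simpa using this
          · simpa using ih
          · simpa using ih
      exact key _ _ h
    · rw [SimpleGraph.isBridge_iff]; exact leaf
    · rw [SimpleGraph.isBridge_iff]
      intro h
      apply leaf
      have := h.symm
      rwa [Sym2.eq_swap] at this

namespace Apo

theorem treedec {n : ℕ} {Fc bags : Finset (Finset ℕ)} (h : Apo n Fc bags) :
    ∃ (ι : Type) (T : SimpleGraph ι) (B : ι → Finset ℕ), T.IsTree ∧ (∀ b ∈ bags, ∃ i, B i = b) ∧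
      (∀ i, B i ∈ bags) ∧ ∀ v < n, (∃ i, v ∈ B i) ∧
        ∀ i j, v ∈ B i → v ∈ B j → CIn T.Adj {i | v ∈ B i} i j := by
  induction h with
  | base =>
    refine ⟨Unit, ⊥, fun _ => {0,1,2,3}, SimpleGraph.IsTree.of_subsingleton, ?_, ?_, ?_⟩
    · intro b hb; simp at hb; exact ⟨(), hb.symm⟩
    · simp
    · intro v hv
      refine ⟨⟨(), by revert v; decide⟩, fun i j _ _ => Relation.ReflTransGen.refl⟩
  | @step n Fc bags s h hs ih =>
    obtain ⟨ι, T, B, hT, h1, h2, h3⟩ := ih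
    obtain ⟨b, hb, hsb⟩ := h.face_bag s hs
    obtain ⟨i0, rfl⟩ := h1 b hb
    have hlt := (h.basic.2.1 s hs).2
    have hlt' : ∀ i, n ∉ B i := fun i hi => by have := (h.basic.2.2 _ (h2 i)).2 n hi; omega
    let B' : Option ι → Finset ℕ := fun x => x.elim (insert n s) B
    refine ⟨Option ι, leafExt T i0, B', leafExt_tree hT i0, ?_, ?_, ?_⟩
    · intro b hb
      rcases Finset.mem_insert.1 hb with rfl | hb
      · exact ⟨none, rfl⟩
      · obtain ⟨i, hi⟩ := h1 b hb; exact ⟨some i, hi⟩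
    · rintro (_ | i)
      · exact Finset.mem_insert_self _ _
      · exact Finset.mem_insert_of_mem (h2 i)
    · intro v hv
      rcases Nat.lt_succ_iff_lt_or_eq.1 hv with hv | rfl
      · obtain ⟨⟨i, hi⟩, h4⟩ := h3 v hv
        refine ⟨⟨some i, hi⟩, ?_⟩
        have lift : ∀ i j, v ∈ B i → v ∈ B j → CIn (leafExt T i0).Adj {i | v ∈ B' i} (some i) (some j) := by
          intro i j hi hj
          exact Relation.ReflTransGen.lift some (fun x y h => ⟨h.1, h.2.1, Or.inl ⟨x, y, rfl, rfl, h.2.2⟩⟩) _ _ (h4 i j hi hj)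
        have nn : ∀ j, v ∈ B' none → v ∈ B j → CIn (leafExt T i0).Adj {i | v ∈ B' i} none (some j) := by
          intro j hv' hj
          have hvs : v ∈ s := by
            rcases Finset.mem_insert.1 (show v ∈ insert n s from hv') with e | e
            · omega
            · exact e
          have hvi : v ∈ B i0 := hsb hvs
          exact Relation.ReflTransGen.head ⟨hv', hvi, Or.inr (Or.inl ⟨rfl, rfl⟩)⟩ (lift i0 j hvi hj)
        rintro (_ | i) (_ | j) hi hj
        · exact Relation.ReflTransGen.refl
        · exact nn j hi hj
        · exact (nn i hj hi).symm (fun a b h => h.symm)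
        · exact lift i j hi hj
      · refine ⟨⟨none, Finset.mem_insert_self _ _⟩, ?_⟩
        rintro (_ | i) (_ | j) hi hj
        · exact Relation.ReflTransGen.refl
        · exact absurd hj (hlt' j)
        · exact absurd hi (hlt' i)
        · exact absurd hi (hlt' i)

theorem treewidth {n : ℕ} {Fc bags : Finset (Finset ℕ)} (h : Apo n Fc bags) {W : Type} (H : SimpleGraph W)
    (φ : W → ℕ) (hφ : Function.Injective φ) (hlt : ∀ w, φ w < n)
    (hadj : ∀ x y, H.Adj x y → ∃ b ∈ bags, φ x ∈ b ∧ φ y ∈ b) : TreewidthLE H 3 := by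
  obtain ⟨ι, T, B, hT, h1, h2, h3⟩ := h.treedec
  refine ⟨ι, T, fun i => {w | φ w ∈ B i}, hT, ?_, ?_, ?_, ?_⟩
  · intro w; exact (h3 _ (hlt w)).1
  · intro u v huv
    obtain ⟨b, hb, hu, hv⟩ := hadj u v huv
    obtain ⟨i, rfl⟩ := h1 b hb
    exact ⟨i, hu, hv⟩
  · intro w
    obtain ⟨⟨i, hi⟩, hc⟩ := h3 _ (hlt w)
    have : Nonempty {i | w ∈ {w | φ w ∈ B i}} := ⟨⟨i, hi⟩⟩
    refine ⟨fun x y => ?_⟩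
    have key : ∀ j, CIn T.Adj {i | φ w ∈ B i} x.1 j → ∀ hj : φ w ∈ B j, (T.induce {i | w ∈ {w | φ w ∈ B i}}).Reachable x ⟨j, hj⟩ := by
      intro j hj
      unfold CIn at hj
      induction hj with
      | refl => intro _; exact SimpleGraph.Reachable.refl _
      | @tail a b _ hab ih =>
        intro hb
        exact (ih hab.1).trans (SimpleGraph.Adj.reachable (by simpa using hab.2.2))
    exact key y.1 (hc _ _ x.2 y.2) y.2
  · intro i
    have hc := (h.basic.2.2 _ (h2 i)).1
    calc ({w | φ w ∈ B i} : Set W).encard = (φ '' {w | φ w ∈ B i}).encard := (hφ.encard_image _).symm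
      _ ≤ ((B i : Finset ℕ) : Set ℕ).encard := Set.encard_le_encard (by rintro _ ⟨w, hw, rfl⟩; exact hw)
      _ = ((B i).card : ℕ∞) := Set.encard_coe_eq_coe_finsetCard _
      _ ≤ (4 : ℕ) := by exact_mod_cast hc
      _ = _ := by norm_num

end Apo


open Sum

section ctx
variable {V F L D : Type} [Fintype V] [Fintype F] [Fintype L] [Fintype D]

structure Ctx (K : Sph (V ⊕ F) L D) (T : SimpleGraph V) (r : V) (d : ℕ) (U0 P : Set V) : Prop where
  ff : ∀ f g, ¬ K.Adj (inr f) (inr g)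
  tri : ∀ t, ∃ x y f, ∀ z, K.cor z t ↔ z = inl x ∨ z = inl y ∨ z = inr f
  third : ∀ f x y, ∃ z, z ≠ x ∧ z ≠ y ∧ K.Adj (inr f) (inl z)
  inface : ∀ v, ∃ f, K.Adj (inl v) (inr f)
  le : ∀ f, {v | K.Adj (inr f) (inl v)}.encard ≤ (d : ℕ∞)
  d3 : 3 ≤ d
  hT : T.IsTree
  TK : ∀ u v, T.Adj u v → K.Adj (inl u) (inl v)
  rU : r ∉ U0
  PU : ∀ v ∈ P, v ∉ U0
  Pc : K.ConnS (inl '' P)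
  nb : ∀ u ∈ U0, ∀ f, K.Adj (inr f) (inl u) → ∀ v, K.Adj (inr f) (inl v) → v ∈ U0 ∨ v ∈ P

variable (K : Sph (V ⊕ F) L D)

def Fre (U : Set V) : Set (V ⊕ F) :=
  {x | (∃ v ∈ U, x = inl v) ∨ ∃ f, x = inr f ∧ ∃ v ∈ U, K.Adj (inr f) (inl v)}

def Reg (U : Set V) (u : V) : Set (V ⊕ F) := {x | CIn K.Adj (Fre K U) (inl u) x}

def Sees (U : Set V) (lab : V → ℕ) (B : Set (V ⊕ F)) (a : ℕ) : Prop :=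
  ∃ v, v ∉ U ∧ lab v = a ∧ ∃ p ∈ B, K.Adj p (inl v)

structure GoodB (U : Set V) (lab : V → ℕ) (B : Set (V ⊕ F)) (t : Finset ℕ) (Cl : ℕ → Set (V ⊕ F)) : Prop where
  card : t.card ≤ 3
  sees : ∀ a, Sees K U lab B a ↔ a ∈ t
  conn : ∀ a ∈ t, K.ConnS (Cl a)
  dB : ∀ a ∈ t, Disjoint B (Cl a)
  dd : ∀ a ∈ t, ∀ b ∈ t, a ≠ b → Disjoint (Cl a) (Cl b)
  nbr : ∀ v, v ∉ U → ∀ p ∈ B, K.Adj p (inl v) → inl v ∈ Cl (lab v)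
  tau : ∃ τ, ∀ a ∈ t, ∃ x ∈ Cl a, K.cor x τ

variable {K} {T : SimpleGraph V} {r : V} {d : ℕ} {U0 P U : Set V}

theorem mem_fre_inl {v : V} : (inl v : V ⊕ F) ∈ Fre K U ↔ v ∈ U := by
  simp [Fre]

theorem mem_fre_inr {f : F} : (inr f : V ⊕ F) ∈ Fre K U ↔ ∃ v ∈ U, K.Adj (inr f) (inl v) := by
  simp [Fre]

theorem fre_mono {U' : Set V} (h : U' ⊆ U) : Fre K U' ⊆ Fre K U := by
  rintro (v | f) hx
  · rw [mem_fre_inl] at hx ⊢; exact h hx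
  · rw [mem_fre_inr] at hx ⊢
    obtain ⟨v, hv, h2⟩ := hx; exact ⟨v, h hv, h2⟩

theorem self_reg (u : V) : (inl u : V ⊕ F) ∈ Reg K U u := Relation.ReflTransGen.refl

theorem reg_sub {u : V} (hu : u ∈ U) : Reg K U u ⊆ Fre K U := by
  intro x hx
  rcases Relation.ReflTransGen.cases_tail (hx : CIn _ _ _ _) with e | ⟨y, _, h⟩
  · rw [e]; exact mem_fre_inl.2 hu
  · exact h.2.1

theorem reg_step {u : V} (hu : u ∈ U) {p q : V ⊕ F} (hp : p ∈ Reg K U u) (h : K.Adj p q) (hq : q ∈ Fre K U) :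
    q ∈ Reg K U u :=
  Relation.ReflTransGen.tail (hp : CIn _ _ _ _) ⟨reg_sub hu hp, hq, h⟩

theorem reg_mono {U' : Set V} (h : U' ⊆ U) (u : V) : Reg K U' u ⊆ Reg K U u :=
  fun _ hx => CIn.mono (fre_mono h) (fun _ _ h => h) hx

theorem reg_path {u : V} {x : V ⊕ F} (hx : x ∈ Reg K U u) : CIn K.Adj (Reg K U u) (inl u) x := by
  have hx : Relation.ReflTransGen _ _ _ := hx
  induction hx with
  | refl => exact Relation.ReflTransGen.refl
  | @tail y z hy hyz ih => exact Relation.ReflTransGen.tail (ih hy) ⟨hy, Relation.ReflTransGen.tail hy hyz, hyz.2.2⟩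

theorem reg_conn (u : V) : K.ConnS (Reg K U u) := by
  intro x hx y hy
  exact Relation.ReflTransGen.trans ((reg_path hx).symm (fun a b h => h.symm)) (reg_path hy)

theorem reg_eq {u v : V} (h : (inl v : V ⊕ F) ∈ Reg K U u) : Reg K U v = Reg K U u := by
  ext x
  constructor
  · intro hx; exact Relation.ReflTransGen.trans (h : CIn _ _ _ _) hx
  · intro hx; exact Relation.ReflTransGen.trans (CIn.symm (fun a b h => h.symm) (h : CIn _ _ _ _)) hx

theorem reg_eq' {u v : V} {x : V ⊕ F} (h : x ∈ Reg K U u) (h' : x ∈ Reg K U v) : Reg K U v = Reg K U u := by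
  apply reg_eq
  exact Relation.ReflTransGen.trans (h : CIn _ _ _ _) (CIn.symm (fun a b h => h.symm) (h' : CIn _ _ _ _))

theorem reg_nbr (C : Ctx K T r d U0 P) {u : V} (hu : u ∈ U) {p q : V ⊕ F} (hp : p ∈ Reg K U u) (h : K.Adj p q) :
    q ∈ Reg K U u ∨ ∃ v, v ∉ U ∧ q = inl v := by
  by_cases hq : q ∈ Fre K U
  · exact Or.inl (reg_step hu hp h hq)
  · right
    cases q with
    | inl v => exact ⟨v, fun hv => hq (mem_fre_inl.2 hv), rfl⟩
    | inr f =>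
      exfalso
      cases p with
      | inl w => exact hq (mem_fre_inr.2 ⟨w, mem_fre_inl.1 (reg_sub hu hp), h.symm⟩)
      | inr g => exact C.ff _ _ h

theorem reg_face (C : Ctx K T r d U0 P) {u v : V} (hu : u ∈ U) {f : F} (hp : (inl v : V ⊕ F) ∈ Reg K U u) (h : K.Adj (inl v) (inr f)) :
    inr f ∈ Reg K U u := by
  rcases reg_nbr C hu hp h with e | ⟨w, _, e⟩
  · exact e
  · cases e

/-- a done neighbour is on a face of the region -/
theorem face_nbr (C : Ctx K T r d U0 P) {u v : V} (hu : u ∈ U) {p : V ⊕ F} (hp : p ∈ Reg K U u) (h : K.Adj p (inl v)) :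
    ∃ f, inr f ∈ Reg K U u ∧ K.Adj (inr f) (inl v) := by
  cases p with
  | inr f => exact ⟨f, hp, h⟩
  | inl w =>
    obtain ⟨t, h1, h2⟩ := K.exists_tri h
    obtain ⟨x, y, f, hc⟩ := C.tri t
    have hf : K.cor (inr f) t := (hc _).2 (by simp)
    exact ⟨f, reg_face C hu hp (K.adj_of_cor h1 hf (by simp)), K.adj_of_cor hf h2 (by simp)⟩

/-- roots -/
theorem exists_roots (C : Ctx K T r d U0 P) (hU : U ⊆ U0) :
    ∃ (Q : V → Set V) (ρ : V → V), ∀ v, ρ v ∉ U ∧ Q v ⊆ U ∧ (v ∉ U → Q v = ∅ ∧ ρ v = v) ∧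
      (v ∈ U → v ∈ Q v ∧ IsVerticalPath T r (Q v) ∧ (∃ w ∈ Q v, K.Adj (inl w) (inl (ρ v))) ∧
        K.ConnS (inl '' (Q v))) := by
  have : ∀ v, ∃ (Q : Set V) (y : V), y ∉ U ∧ Q ⊆ U ∧ (v ∉ U → Q = ∅ ∧ y = v) ∧
      (v ∈ U → v ∈ Q ∧ IsVerticalPath T r Q ∧ (∃ w ∈ Q, K.Adj (inl w) (inl y)) ∧
        K.ConnS (inl '' Q)) := by
    intro v
    by_cases hv : v ∈ U
    · obtain ⟨Q, w, y, h1, h2, h3, h4, h5, h6, h7⟩ := exists_vert C.hT U hv (fun h => C.rU (hU h))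
      refine ⟨Q, y, h4, h3, fun h => absurd hv h, fun _ => ⟨h1, h6, ⟨w, h2, C.TK _ _ h5⟩, ?_⟩⟩
      rintro _ ⟨a, ha, rfl⟩ _ ⟨b, hb, rfl⟩
      exact Relation.ReflTransGen.lift inl (fun x y h => ⟨⟨x, h.1, rfl⟩, ⟨y, h.2.1, rfl⟩, C.TK _ _ h.2.2⟩) _ _ (h7 a ha b hb)
    · exact ⟨∅, v, hv, by simp, fun _ => ⟨rfl, rfl⟩, fun h => absurd h hv⟩
  choose Q ρ h using this
  exact ⟨Q, ρ, h⟩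

/-- selection of a face -/
theorem select (C : Ctx K T r d U0 P) {u : V} (hu : u ∈ U) {lab : V → ℕ} {t : Finset ℕ}
    {Cl : ℕ → Set (V ⊕ F)} (G : GoodB K U lab (Reg K U u) t Cl) (ρ : V → V)
    (hρ : ∀ v, v ∉ U → ρ v = v)
    (hρt : ∀ f v, inr f ∈ Reg K U u → K.Adj (inr f) (inl v) → lab (ρ v) ∈ t) :
    ∃ f v1 v2 v3, inr f ∈ Reg K U u ∧ v1 ≠ v2 ∧ v2 ≠ v3 ∧ v1 ≠ v3 ∧ K.Adj (inr f) (inl v1) ∧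
      K.Adj (inr f) (inl v2) ∧ K.Adj (inr f) (inl v3) ∧
      (∀ a ∈ t, lab (ρ v1) = a ∨ lab (ρ v2) = a ∨ lab (ρ v3) = a) ∧
      (t.card ≤ 2 → ∃ τ, K.cor (inr f) τ ∧ ∀ a ∈ t, ∃ x ∈ Cl a, K.cor x τ) := by
  classical
  have adjB : ∀ a ∈ t, ∃ p ∈ Reg K U u, ∃ q ∈ Cl a, K.Adj p q := by
    intro a ha
    obtain ⟨v, hv, rfl, p, hp, h⟩ := (G.sees a).2 ha
    exact ⟨p, hp, inl v, G.nbr v hv p hp h, h⟩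
  have seen : ∀ v, v ∉ U → ∀ p ∈ Reg K U u, K.Adj p (inl v) → lab v ∈ t ∧ inl v ∈ Cl (lab v) :=
    fun v hv p hp h => ⟨(G.sees _).1 ⟨v, hv, rfl, p, hp, h⟩, G.nbr v hv p hp h⟩
  have hN : ∀ p ∈ Reg K U u, ∀ q, K.Adj p q → q ∈ Reg K U u ∨ ∃ a ∈ t, q ∈ Cl a := by
    intro p hp q h
    rcases reg_nbr C hu hp h with e | ⟨v, hv, rfl⟩
    · exact Or.inl e
    · exact Or.inr ⟨lab v, seen v hv p hp h⟩
  obtain ⟨τ, hτ⟩ := G.tau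
  have hc : t.card = 0 ∨ t.card = 1 ∨ t.card = 2 ∨ t.card = 3 := by have := G.card; omega
  rcases hc with hc | hc | hc | hc
  · rw [Finset.card_eq_zero] at hc
    subst hc
    obtain ⟨f, hf⟩ := C.inface u
    obtain ⟨v2, h2, _, h2'⟩ := C.third f u u
    obtain ⟨v3, h3, h3', h3''⟩ := C.third f u v2
    obtain ⟨τ', c1, c2⟩ := K.exists_tri hf
    exact ⟨f, u, v2, v3, reg_face C hu (self_reg u) hf, h2.symm, h3'.symm, h3.symm, hf.symm, h2', h3'', by simp,
      fun _ => ⟨τ', c2, by simp⟩⟩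
  · obtain ⟨a, rfl⟩ := Finset.card_eq_one.1 hc
    obtain ⟨v, hv, hva, p, hp, h⟩ := (G.sees a).2 (by simp)
    obtain ⟨f, hf, hfv⟩ := face_nbr C hu hp h
    obtain ⟨v2, h2, _, h2'⟩ := C.third f v v
    obtain ⟨v3, h3, h3', h3''⟩ := C.third f v v2
    obtain ⟨τ', c1, c2⟩ := K.exists_tri hfv
    refine ⟨f, v, v2, v3, hf, h2.symm, h3'.symm, h3.symm, hfv, h2', h3'', ?_, fun _ => ⟨τ', c1, ?_⟩⟩
    · intro b hb
      rw [Finset.mem_singleton] at hb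
      left; rw [hρ v hv, hva, hb]
    · intro b hb
      rw [Finset.mem_singleton] at hb
      subst hb
      exact ⟨inl v, hva ▸ (seen v hv _ hf hfv).2, c2⟩
  · obtain ⟨a, b, hab, rfl⟩ := Finset.card_eq_two.1 hc
    have ma : a ∈ ({a, b} : Finset ℕ) := by simp
    have mb : b ∈ ({a, b} : Finset ℕ) := by simp
    obtain ⟨τ', ⟨x0, cx0, hx0⟩, ⟨x1, cx1, hx1⟩, ⟨x2, cx2, hx2⟩⟩ := 
      K.unicoh (G.conn a ma) (G.conn b mb) (reg_conn u) (G.dd a ma b mb hab) (G.dB a ma) (G.dB b mb) τ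
       (hτ a ma) (hτ b mb) (adjB a ma) (adjB b mb) (by
        intro p hp q h
        rcases hN p hp q h with e | ⟨c, hc, e⟩
        · exact Or.inl e
        · simp only [Finset.mem_insert, Finset.mem_singleton] at hc
          rcases hc with rfl | rfl
          · exact Or.inr (Or.inl e)
          · exact Or.inr (Or.inr e))
    obtain ⟨y, z, f, hyz⟩ := C.tri τ'
    have cf : K.cor (inr f) τ' := (hyz _).2 (by simp)
    have fB : inr f ∈ Reg K U u := by
      cases x0 with
      | inl w => exact reg_face C hu hx0 (K.adj_of_cor cx0 cf (by simp))
      | inr g =>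
        rcases (hyz _).1 cx0 with e | e | e
        · cases e
        · cases e
        · rw [← e]; exact hx0
    have conv : ∀ c ∈ ({a, b} : Finset ℕ), ∀ x, K.cor x τ' → x ∈ Cl c → ∃ v, x = inl v ∧ lab (ρ v) = c ∧ K.Adj (inr f) (inl v) := by
      intro c hc x cx hx
      have hxB : x ∉ Reg K U u := fun e => Set.disjoint_left.1 (G.dB c hc) e hx
      have hne : inr f ≠ x := fun e => hxB (e ▸ fB)
      have hadj := K.adj_of_cor cf cx hne
      rcases reg_nbr C hu fB hadj with e | ⟨v, hv, rfl⟩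
      · exact absurd e hxB
      · refine ⟨v, rfl, ?_, hadj⟩
        rw [hρ v hv]
        by_contra hne'
        obtain ⟨h1, h2⟩ := seen v hv _ fB hadj
        exact Set.disjoint_left.1 (G.dd _ h1 c hc hne') h2 hx
    obtain ⟨v1, rfl, l1, ad1⟩ := conv a ma x1 cx1 hx1
    obtain ⟨v2, rfl, l2, ad2⟩ := conv b mb x2 cx2 hx2
    obtain ⟨v3, n1, n2, ad3⟩ := C.third f v1 v2
    refine ⟨f, v1, v2, v3, fB, ?_, n2.symm, n1.symm, ad1, ad2, ad3, ?_, fun _ => ⟨τ', cf, ?_⟩⟩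
    · rintro rfl; exact hab (l1.symm.trans l2)
    · intro c hc
      simp only [Finset.mem_insert, Finset.mem_singleton] at hc
      rcases hc with rfl | rfl
      · exact Or.inl l1
      · exact Or.inr (Or.inl l2)
    · intro c hc
      simp only [Finset.mem_insert, Finset.mem_singleton] at hc
      rcases hc with rfl | rfl
      · exact ⟨_, hx1, cx1⟩
      · exact ⟨_, hx2, cx2⟩
  · obtain ⟨a, b, c, hab, hac, hbc, rfl⟩ := Finset.card_eq_three.1 hc
    have ma : a ∈ ({a, b, c} : Finset ℕ) := by simp
    have mb : b ∈ ({a, b, c} : Finset ℕ) := by simp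
    have mc : c ∈ ({a, b, c} : Finset ℕ) := by simp
    have hw : ∀ f : F, ∃ v, K.Adj (inr f) (inl v) := fun f => by
      obtain ⟨z, _, _, h⟩ := C.third f u u; exact ⟨z, h⟩
    choose w hw using hw
    let rep : V ⊕ F → V := fun x => Sum.elim id w x
    let idx : ℕ → Fin 3 := fun l => if l = a then 0 else if l = b then 1 else 2
    let κ : V ⊕ F → Fin 3 := fun x => if x ∈ Cl a then 0 else if x ∈ Cl b then 1 else if x ∈ Cl c then 2
      else idx (lab (ρ (rep x)))
    have ka : ∀ x ∈ Cl a, κ x = 0 := fun x hx => by simp [κ, hx]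
    have kb : ∀ x ∈ Cl b, κ x = 1 := fun x hx => by
      have := Set.disjoint_right.1 (G.dd a ma b mb hab) hx
      simp [κ, hx, this]
    have kc : ∀ x ∈ Cl c, κ x = 2 := fun x hx => by
      have h1 := Set.disjoint_right.1 (G.dd a ma c mc hac) hx
      have h2 := Set.disjoint_right.1 (G.dd b mb c mc hbc) hx
      simp [κ, hx, h1, h2]
    obtain ⟨τ', ⟨x0, cx0, hx0⟩, ⟨x1, cx1, hx1⟩, ⟨x2, cx2, hx2⟩, ⟨x3, cx3, hx3⟩⟩ := 
      K.sperner (G.conn a ma) (G.conn b mb) (G.conn c mc) (reg_conn u) (G.dd a ma b mb hab) (G.dd b mb c mc hbc)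
       (G.dd c mc a ma hac.symm) (G.dB a ma) (G.dB b mb) (G.dB c mc) τ
       (hτ a ma) (hτ b mb) (hτ c mc) (adjB a ma) (adjB b mb) (adjB c mc) (by
        intro p hp q h
        rcases hN p hp q h with e | ⟨c, hc, e⟩
        · exact Or.inl e
        · simp only [Finset.mem_insert, Finset.mem_singleton] at hc
          rcases hc with rfl | rfl | rfl
          · exact Or.inr (Or.inl e)
          · exact Or.inr (Or.inr (Or.inl e))
          · exact Or.inr (Or.inr (Or.inr e))) κ ka kb kc
    obtain ⟨y, z, f, hyz⟩ := C.tri τ'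
    have cf : K.cor (inr f) τ' := (hyz _).2 (by simp)
    have fB : inr f ∈ Reg K U u := by
      cases x0 with
      | inl w => exact reg_face C hu hx0 (K.adj_of_cor cx0 cf (by simp))
      | inr g =>
        rcases (hyz _).1 cx0 with e | e | e
        · cases e
        · cases e
        · rw [← e]; exact hx0
    have notCl : ∀ x ∈ Reg K U u, κ x = idx (lab (ρ (rep x))) := by
      intro x hx
      have h1 := Set.disjoint_left.1 (G.dB a ma) hx
      have h2 := Set.disjoint_left.1 (G.dB b mb) hx
      have h3 := Set.disjoint_left.1 (G.dB c mc) hx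
      simp [κ, h1, h2, h3]
    have conv : ∀ x, K.cor x τ' → ∃ v, κ x = idx (lab (ρ v)) ∧ K.Adj (inr f) (inl v) := by
      intro x cx
      by_cases hxB : x ∈ Reg K U u
      · refine ⟨rep x, notCl x hxB, ?_⟩
        cases x with
        | inl v => exact K.adj_of_cor cf cx (by simp)
        | inr g =>
          have : g = f := by
            rcases (hyz _).1 cx with e | e | e
            · cases e
            · cases e
            · exact Sum.inr_injective e
          subst this
          exact hw g
      · have hne : inr f ≠ x := fun e => hxB (e ▸ fB)
        have hadj := K.adj_of_cor cf cx hne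
        rcases reg_nbr C hu fB hadj with e | ⟨v, hv, rfl⟩
        · exact absurd e hxB
        · refine ⟨v, ?_, hadj⟩
          obtain ⟨h1, h2⟩ := seen v hv _ fB hadj
          rw [hρ v hv]
          simp only [Finset.mem_insert, Finset.mem_singleton] at h1
          rcases h1 with h1 | h1 | h1
          · rw [ka _ (h1 ▸ h2)]; simp [idx, h1]
          · rw [kb _ (h1 ▸ h2)]; simp [idx, h1, hab.symm]
          · rw [kc _ (h1 ▸ h2)]; simp [idx, h1, hac.symm, hbc.symm]
    obtain ⟨v1, l1, ad1⟩ := conv x1 cx1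
    obtain ⟨v2, l2, ad2⟩ := conv x2 cx2
    obtain ⟨v3, l3, ad3⟩ := conv x3 cx3
    rw [hx1] at l1
    rw [hx2] at l2
    rw [hx3] at l3
    have i1 : lab (ρ v1) = a := by
      by_contra h; simp only [idx, h, if_false] at l1
      split_ifs at l1 <;> simp at l1
    have i2 : lab (ρ v2) = b := by
      by_contra h; simp only [idx, h, if_false] at l2
      split_ifs at l2 <;> simp at l2
    have i3 : lab (ρ v3) = c := by
      have := hρt f v3 fB ad3
      simp only [Finset.mem_insert, Finset.mem_singleton] at this
      rcases this with e | e | e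
      · simp [idx, e] at l3
      · simp [idx, e, hab.symm] at l3
      · exact e
    refine ⟨f, v1, v2, v3, fB, ?_, ?_, ?_, ad1, ad2, ad3, ?_, fun h => by omega⟩
    · rintro rfl; exact hab (i1.symm.trans i2)
    · rintro rfl; exact hbc (i2.symm.trans i3)
    · rintro rfl; exact hac (i1.symm.trans i3)
    · intro x hx
      simp only [Finset.mem_insert, Finset.mem_singleton] at hx
      rcases hx with rfl | rfl | rfl
      · exact Or.inl i1
      · exact Or.inr (Or.inl i2)
      · exact Or.inr (Or.inr i3)
end ctx


open Sum

section ctx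
variable {V F L D : Type} [Fintype V] [Fintype F] [Fintype L] [Fintype D]

def PartOK (T : SimpleGraph V) (r : V) (d : ℕ) (S : Set V) : Prop :=
  S.Nonempty ∧ ∃ X Y, S = X ∪ Y ∧ X ∩ Y = ∅ ∧ X.encard ≤ ((d - 3 : ℕ) : ℕ∞) ∧ IsUnionOfVPaths T r 3 Y

omit [Fintype V] in
theorem vp_union {T : SimpleGraph V} {r : V} {k : ℕ} {Y Q : Set V} (hY : IsUnionOfVPaths T r k Y)
    (hQ : Q = ∅ ∨ IsVerticalPath T r Q) : IsUnionOfVPaths T r (k+1) (Y ∪ Q) := by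
  obtain ⟨m, hm, f, hf, rfl⟩ := hY
  rcases hQ with rfl | hQ
  · exact ⟨m, by omega, f, hf, by simp⟩
  · refine ⟨m+1, by omega, Fin.snoc (α := fun _ => Set V) f Q, ?_, ?_⟩
    · intro i
      refine Fin.lastCases ?_ (fun i => ?_) i
      · simpa using hQ
      · simpa using hf i
    · ext x
      simp only [Set.mem_union, Set.mem_iUnion, Fin.exists_fin_succ', Fin.snoc_castSucc, Fin.snoc_last]

variable {K : Sph (V ⊕ F) L D} {T : SimpleGraph V} {r : V} {d : ℕ} {U0 P U : Set V}

theorem connS_center {A : Set (V ⊕ F)} (c : V ⊕ F) (h : ∀ x ∈ A, CIn K.Adj A c x) : K.ConnS A :=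
  fun x hx y hy => Relation.ReflTransGen.trans ((h x hx).symm (fun _ _ h => h.symm)) (h y hy)

theorem chunk (C : Ctx K T r d U0 P) (hU : U ⊆ U0) {u : V} (hu : u ∈ U) {lab : V → ℕ} {t : Finset ℕ}
    {Cl : ℕ → Set (V ⊕ F)} (G : GoodB K U lab (Reg K U u) t Cl) :
    ∃ (S : Set V) (f : F), S ⊆ U ∧ PartOK T r d S ∧ inl '' S ⊆ Reg K U u ∧ inr f ∈ Reg K U u ∧
      (∀ v ∈ U, K.Adj (inr f) (inl v) → v ∈ S) ∧ K.ConnS (insert (inr f) (inl '' S)) ∧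
      (∀ a ∈ t, ∃ p ∈ (insert (inr f) (inl '' S) : Set (V ⊕ F)), ∃ q ∈ Cl a, K.Adj p q) ∧
      (t.card ≤ 2 → ∃ τ, K.cor (inr f) τ ∧ ∀ a ∈ t, ∃ x ∈ Cl a, K.cor x τ) := by
  obtain ⟨Q, ρ, hQ⟩ := exists_roots C hU
  have QB : ∀ v ∈ U, inl v ∈ Reg K U u → inl '' (Q v) ⊆ Reg K U u := by
    rintro v hv hB _ ⟨x, hx, rfl⟩
    obtain ⟨h1, h2, h3, h4⟩ := (hQ v).2.2.2 hv
    have := h4 (inl v) ⟨v, h1, rfl⟩ (inl x) ⟨x, hx, rfl⟩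
    have hsub : inl '' Q v ⊆ Fre K U := by
      rintro _ ⟨z, hz, rfl⟩; exact mem_fre_inl.2 ((hQ v).2.1 hz)
    exact Relation.ReflTransGen.trans (hB : CIn _ _ _ _) (CIn.mono hsub (fun _ _ h => h) this)
  have fv : ∀ f, inr f ∈ Reg K U u → ∀ v ∈ U, K.Adj (inr f) (inl v) → inl v ∈ Reg K U u :=
    fun f hf v hv h => reg_step hu hf h (mem_fre_inl.2 hv)
  have rootadj : ∀ f, inr f ∈ Reg K U u → ∀ v, K.Adj (inr f) (inl v) → ∃ p ∈ (insert (inr f) (inl '' Q v) : Set (V ⊕ F)), p ∈ Reg K U u ∧ K.Adj p (inl (ρ v)) := by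
    intro f hf v h
    by_cases hv : v ∈ U
    · obtain ⟨h1, h2, ⟨w, hw, hw'⟩, h4⟩ := (hQ v).2.2.2 hv
      exact ⟨inl w, Or.inr ⟨w, hw, rfl⟩, QB v hv (fv f hf v hv h) ⟨w, hw, rfl⟩, hw'⟩
    · rw [((hQ v).2.2.1 hv).2]
      exact ⟨inr f, Or.inl rfl, hf, h⟩
  obtain ⟨f, v1, v2, v3, fB, n12, n23, n13, ad1, ad2, ad3, hl, hτ⟩ := select C hu G ρ (fun v hv => ((hQ v).2.2.1 hv).2) (by
    intro f v hf h
    obtain ⟨p, _, hp, h'⟩ := rootadj f hf v h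
    exact (G.sees _).1 ⟨ρ v, (hQ v).1, rfl, p, hp, h'⟩)
  set A : Set V := {v | v ∈ U ∧ K.Adj (inr f) (inl v)} with hA
  set Y : Set V := Q v1 ∪ Q v2 ∪ Q v3 with hY
  have inY : ∀ v, (v = v1 ∨ v = v2 ∨ v = v3) → Q v ⊆ Y := by
    rintro v (rfl | rfl | rfl) x hx
    · exact Or.inl (Or.inl hx)
    · exact Or.inl (Or.inr hx)
    · exact Or.inr hx
  have Yin : ∀ x ∈ Y, ∃ v, (v = v1 ∨ v = v2 ∨ v = v3) ∧ x ∈ Q v := by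
    rintro x ((h | h) | h)
    · exact ⟨v1, by simp, h⟩
    · exact ⟨v2, by simp, h⟩
    · exact ⟨v3, by simp, h⟩
  have adv : ∀ v, (v = v1 ∨ v = v2 ∨ v = v3) → K.Adj (inr f) (inl v) := by
    rintro v (rfl | rfl | rfl) <;> assumption
  have QU : ∀ v x, x ∈ Q v → v ∈ U := by
    intro v x hx
    by_contra hv
    rw [((hQ v).2.2.1 hv).1] at hx
    exact hx
  have ne : (A ∪ Y).Nonempty := by
    obtain ⟨v, hv, h⟩ := mem_fre_inr.1 (reg_sub hu fB)
    exact ⟨v, Or.inl ⟨hv, h⟩⟩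
  refine ⟨A ∪ Y, f, ?_, ⟨ne, A \ Y, Y, by simp, by simp, ?_, ?_⟩, ?_, fB, fun v hv h => Or.inl ⟨hv, h⟩, ?_, ?_, ?_⟩
  · rintro x (hx | hx)
    · exact hx.1
    · obtain ⟨v, _, hv⟩ := Yin x hx
      exact (hQ v).2.1 hv
  · have hsub : (A \ Y) ∪ {v1, v2, v3} ⊆ {v | K.Adj (inr f) (inl v)} := by
      rintro x (hx | hx)
      · exact hx.1.2
      · exact adv x (by simpa using hx)
    have hdis : Disjoint (A \ Y) {v1, v2, v3} := by
      rw [Set.disjoint_left]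
      intro x hx hx'
      exact hx.2 (inY x (by simpa using hx') ((hQ x).2.2.2 hx.1.1).1)
    have h3 : ({v1, v2, v3} : Set V).encard = 3 := by
      rw [Set.encard_eq_three]; exact ⟨v1, v2, v3, n12, n13, n23, rfl⟩
    have := (Set.encard_le_encard hsub).trans (C.le f)
    rw [Set.encard_union_eq hdis, h3] at this
    have hfin : (A \ Y).Finite := Set.toFinite _
    rw [hfin.encard_eq_coe_toFinset_card] at this ⊢
    have := C.d3
    norm_cast at *
    omega
  · have h0 : IsUnionOfVPaths T r 0 (∅ : Set V) := ⟨0, le_refl _, Fin.elim0, fun i => i.elim0, by simp⟩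
    have hq : ∀ v, Q v = ∅ ∨ IsVerticalPath T r (Q v) := by
      intro v
      by_cases hv : v ∈ U
      · exact Or.inr ((hQ v).2.2.2 hv).2.1
      · exact Or.inl ((hQ v).2.2.1 hv).1
    have := vp_union (vp_union (vp_union h0 (hq v1)) (hq v2)) (hq v3)
    simpa using this
  · rintro _ ⟨x, hx | hx, rfl⟩
    · exact fv f fB x hx.1 hx.2
    · obtain ⟨v, hv, hxv⟩ := Yin x hx
      exact QB v (QU v x hxv) (fv f fB v (QU v x hxv) (adv v hv)) ⟨x, hxv, rfl⟩
  · apply connS_center (inr f)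
    have one : ∀ v ∈ A, CIn K.Adj (insert (inr f) (inl '' (A ∪ Y))) (inr f) (inl v) := by
      intro v hv
      exact Relation.ReflTransGen.single ⟨Or.inl rfl, Or.inr ⟨v, Or.inl hv, rfl⟩, hv.2⟩
    rintro _ (rfl | ⟨x, hx | hx, rfl⟩)
    · exact Relation.ReflTransGen.refl
    · exact one x hx
    · obtain ⟨v, hv, hxv⟩ := Yin x hx
      have hvU := QU v x hxv
      obtain ⟨h1, h2, h3, h4⟩ := (hQ v).2.2.2 hvU
      refine Relation.ReflTransGen.trans (one v ⟨hvU, adv v hv⟩) (CIn.mono ?_ (fun _ _ h => h) (h4 (inl v) ⟨v, h1, rfl⟩ (inl x) ⟨x, hxv, rfl⟩))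
      rintro _ ⟨z, hz, rfl⟩
      exact Or.inr ⟨z, Or.inr (inY v hv hz), rfl⟩
  · have key : ∀ v, (v = v1 ∨ v = v2 ∨ v = v3) → ∃ p ∈ (insert (inr f) (inl '' (A ∪ Y)) : Set (V ⊕ F)), ∃ q ∈ Cl (lab (ρ v)), K.Adj p q := by
      intro v hv
      obtain ⟨p, hp, hp', h⟩ := rootadj f fB v (adv v hv)
      refine ⟨p, ?_, inl (ρ v), G.nbr _ (hQ v).1 p hp' h, h⟩
      rcases hp with rfl | ⟨z, hz, rfl⟩
      · exact Or.inl rfl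
      · exact Or.inr ⟨z, Or.inr (inY v hv hz), rfl⟩
    intro a ha
    rcases hl a ha with rfl | rfl | rfl
    · exact key v1 (by simp)
    · exact key v2 (by simp)
    · exact key v3 (by simp)
  · exact hτ
end ctx


open Sum

section step
variable {V F L D : Type} [Fintype V] [Fintype F] [Fintype L] [Fintype D]
variable {K : Sph (V ⊕ F) L D} {T : SimpleGraph V} {r : V} {d : ℕ} {U0 P U S : Set V}

open Classical in
noncomputable def labN (lab : V → ℕ) (S : Set V) (n : ℕ) (v : V) : ℕ := if v ∈ S then n else lab v

theorem labN_in {lab : V → ℕ} {n : ℕ} {v : V} (h : v ∈ S) : labN lab S n v = n := by simp [labN, h]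
theorem labN_out {lab : V → ℕ} {n : ℕ} {v : V} (h : v ∉ S) : labN lab S n v = lab v := by simp [labN, h]

/-- regions away from the chunk are unchanged -/
theorem out_reg {u u' : V} (hu : u ∈ U) (hu' : u' ∈ U \ S) (hSR : inl '' S ⊆ Reg K U u)
    (hn : (inl u' : V ⊕ F) ∉ Reg K U u) : Reg K (U \ S) u' = Reg K U u' := by
  have key : ∀ v, inl v ∈ Reg K U u' → v ∉ S := by
    intro v hv hvS
    apply hn
    rw [reg_eq' hv (hSR ⟨v, hvS, rfl⟩)]
    exact self_reg _
  apply Set.Subset.antisymm (reg_mono Set.sdiff_subset _)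
  intro x hx
  refine CIn.mono ?_ (fun _ _ h => h) (reg_path hx)
  rintro (v | f) hy
  · exact mem_fre_inl.2 ⟨mem_fre_inl.1 (reg_sub hu'.1 hy), key v hy⟩
  · obtain ⟨v, hv, h⟩ := mem_fre_inr.1 (reg_sub hu'.1 hy)
    exact mem_fre_inr.2 ⟨v, ⟨hv, key v (reg_step hu'.1 hy h (mem_fre_inl.2 hv))⟩, h⟩

theorem out_nbr {u u' v : V} (hu : u ∈ U) (hu' : u' ∈ U \ S) (hSR : inl '' S ⊆ Reg K U u) (hSU : S ⊆ U)
    (hn : (inl u' : V ⊕ F) ∉ Reg K U u) {p : V ⊕ F} (hp : p ∈ Reg K U u') (h : K.Adj p (inl v)) : v ∉ S := by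
  intro hvS
  have := reg_step hu'.1 hp h (mem_fre_inl.2 (hSU hvS))
  apply hn
  rw [reg_eq' this (hSR ⟨v, hvS, rfl⟩)]
  exact self_reg _

theorem out_sees {u u' : V} (hu : u ∈ U) (hu' : u' ∈ U \ S) (hSR : inl '' S ⊆ Reg K U u) (hSU : S ⊆ U)
    (hn : (inl u' : V ⊕ F) ∉ Reg K U u) {lab : V → ℕ} {n : ℕ} (a : ℕ) :
    Sees K (U \ S) (labN lab S n) (Reg K (U \ S) u') a ↔ Sees K U lab (Reg K U u') a := by
  rw [out_reg hu hu' hSR hn]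
  constructor
  · rintro ⟨v, hv, rfl, p, hp, h⟩
    have := out_nbr hu hu' hSR hSU hn hp h
    exact ⟨v, fun h => hv ⟨h, this⟩, (labN_out this).symm, p, hp, h⟩
  · rintro ⟨v, hv, rfl, p, hp, h⟩
    have := out_nbr hu hu' hSR hSU hn hp h
    exact ⟨v, fun h => hv h.1, (labN_out this), p, hp, h⟩

theorem out_good {u u' : V} (hu : u ∈ U) (hu' : u' ∈ U \ S) (hSR : inl '' S ⊆ Reg K U u) (hSU : S ⊆ U)
    (hn : (inl u' : V ⊕ F) ∉ Reg K U u) {lab : V → ℕ} {n : ℕ} {t : Finset ℕ} {Cl : ℕ → Set (V ⊕ F)}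
    (G : GoodB K U lab (Reg K U u') t Cl) :
    GoodB K (U \ S) (labN lab S n) (Reg K (U \ S) u') t Cl := by
  have e := out_reg hu hu' hSR hn
  refine ⟨G.card, fun a => (out_sees hu hu' hSR hSU hn a).trans (G.sees a), G.conn, by rw [e]; exact G.dB, G.dd, ?_, G.tau⟩
  rw [e]
  intro v hv p hp h
  have := out_nbr hu hu' hSR hSU hn hp h
  rw [labN_out this]
  exact G.nbr v (fun h => hv ⟨h, this⟩) p hp h

/-- new classes -/
def ClN (n : ℕ) (S' : Set (V ⊕ F)) (t t' : Finset ℕ) (Cl : ℕ → Set (V ⊕ F)) (a : ℕ) : Set (V ⊕ F) :=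
  if a = n then S' ∪ ⋃ c ∈ t \ t', Cl c else Cl a

open Classical in
noncomputable def tN (K : Sph (V ⊕ F) L D) (U S : Set V) (lab : V → ℕ) (n : ℕ) (t : Finset ℕ) (u' : V) : Finset ℕ :=
  (insert n t).filter (fun a => Sees K (U \ S) (labN lab S n) (Reg K (U \ S) u') a)

theorem ConnS_star {S' : Set (V ⊕ F)} {J : Finset ℕ} {Cl : ℕ → Set (V ⊕ F)} (h1 : K.ConnS S') (hne : S'.Nonempty)
    (h2 : ∀ a ∈ J, K.ConnS (Cl a)) (h3 : ∀ a ∈ J, ∃ p ∈ S', ∃ q ∈ Cl a, K.Adj p q) :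
    K.ConnS (S' ∪ ⋃ c ∈ J, Cl c) := by
  obtain ⟨c, hc⟩ := hne
  have hS : ∀ x ∈ S', CIn K.Adj (S' ∪ ⋃ c ∈ J, Cl c) c x := fun x hx =>
    CIn.mono Set.subset_union_left (fun _ _ h => h) (h1 c hc x hx)
  apply connS_center c
  rintro x (hx | hx)
  · exact hS x hx
  · simp only [Set.mem_iUnion] at hx
    obtain ⟨a, ha, hx⟩ := hx
    obtain ⟨p, hp, q, hq, h⟩ := h3 a ha
    have sub : Cl a ⊆ (S' ∪ ⋃ c ∈ J, Cl c) := by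
      intro y hy; right; simp only [Set.mem_iUnion]; exact ⟨a, ha, hy⟩
    exact Relation.ReflTransGen.trans (Relation.ReflTransGen.tail (hS p hp) ⟨Or.inl hp, sub hq, h⟩)
      (CIn.mono sub (fun _ _ h => h) (h2 a ha q hq x hx))

theorem in_sees_n (C : Ctx K T r d U0 P) {u u' : V} (hu : u ∈ U) (hu' : u' ∈ U \ S) (hSR : inl '' S ⊆ Reg K U u)
    (hSne : S.Nonempty) (hn : (inl u' : V ⊕ F) ∈ Reg K U u) {lab : V → ℕ} {n : ℕ} :
    Sees K (U \ S) (labN lab S n) (Reg K (U \ S) u') n := by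
  obtain ⟨v0, hv0⟩ := hSne
  by_contra hc
  have hp := reg_conn u _ hn _ (hSR ⟨v0, hv0, rfl⟩)
  have : ∀ x, Relation.ReflTransGen (fun a b => a ∈ Reg K U u ∧ b ∈ Reg K U u ∧ K.Adj a b) (inl u') x →
      x ∈ Reg K (U \ S) u' := by
    intro x hx
    induction hx with
    | refl => exact self_reg _
    | @tail y z hy hyz ih =>
      rcases reg_nbr C hu' ih hyz.2.2 with h | ⟨v, hv, rfl⟩
      · exact h
      · exfalso; apply hc
        have hvU : v ∈ U := mem_fre_inl.1 (reg_sub hu hyz.2.1)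
        have hvS : v ∈ S := by by_contra hh; exact hv ⟨hvU, hh⟩
        exact ⟨v, hv, labN_in hvS, y, ih, hyz.2.2⟩
  exact (mem_fre_inl.1 (reg_sub hu' (this _ hp))).2 hv0

theorem in_good (C : Ctx K T r d U0 P) {u u' : V} (hu : u ∈ U) (hu' : u' ∈ U \ S) (hSU : S ⊆ U)
    (hSR : inl '' S ⊆ Reg K U u)
    (hSne : S.Nonempty) (hn : (inl u' : V ⊕ F) ∈ Reg K U u) {lab : V → ℕ} {n : ℕ} {t : Finset ℕ}
    {Cl : ℕ → Set (V ⊕ F)} (G : GoodB K U lab (Reg K U u) t Cl) (htn : ∀ a ∈ t, a < n) {f : F}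
    (hf : inr f ∈ Reg K U u) (hfS : ∀ v ∈ U, K.Adj (inr f) (inl v) → v ∈ S)
    (hc : K.ConnS (insert (inr f) (inl '' S)))
    (ha : ∀ a ∈ t, ∃ p ∈ insert (inr f) (inl '' S), ∃ q ∈ Cl a, K.Adj p q)
    (hτ : t.card ≤ 2 → ∃ τ, K.cor (inr f) τ ∧ ∀ a ∈ t, ∃ x ∈ Cl a, K.cor x τ) :
    GoodB K (U \ S) (labN lab S n) (Reg K (U \ S) u') (tN K U S lab n t u')
      (ClN n (insert (inr f) (inl '' S)) t (tN K U S lab n t u') Cl) ∧ n ∈ tN K U S lab n t u' ∧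
      (t.card = 3 → ∃ x ∈ t, x ∉ tN K U S lab n t u') := by
  classical
  have hnt : n ∉ t := fun h => lt_irrefl _ (htn n h)
  have hBB : Reg K (U \ S) u' ⊆ Reg K U u := by
    rw [← reg_eq hn]; exact reg_mono Set.sdiff_subset _
  have hBS : Disjoint (Reg K (U \ S) u') (insert (inr f) (inl '' S)) := by
    rw [Set.disjoint_left]
    rintro x hx (rfl | ⟨v, hv, rfl⟩)
    · obtain ⟨v, hv, h⟩ := mem_fre_inr.1 (reg_sub hu' hx)
      exact hv.2 (hfS v hv.1 h)
    · exact (mem_fre_inl.1 (reg_sub hu' hx)).2 hv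
  have hSB : insert (inr f) (inl '' S) ⊆ Reg K U u := by
    rintro x (rfl | hx)
    · exact hf
    · exact hSR hx
  -- done neighbours
  have hnb : ∀ v, v ∉ U \ S → ∀ p ∈ Reg K (U \ S) u', K.Adj p (inl v) →
      v ∈ S ∨ (v ∉ S ∧ v ∉ U ∧ lab v ∈ t ∧ inl v ∈ Cl (lab v)) := by
    intro v hv p hp h
    by_cases hvS : v ∈ S
    · exact Or.inl hvS
    · have hvU : v ∉ U := fun h => hv ⟨h, hvS⟩
      exact Or.inr ⟨hvS, hvU, (G.sees _).1 ⟨v, hvU, rfl, p, hBB hp, h⟩, G.nbr v hvU p (hBB hp) h⟩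
  have hmem : ∀ a, Sees K (U \ S) (labN lab S n) (Reg K (U \ S) u') a ↔ a ∈ tN K U S lab n t u' := by
    intro a
    simp only [tN, Finset.mem_filter]
    refine ⟨fun h => ⟨?_, h⟩, fun h => h.2⟩
    obtain ⟨v, hv, rfl, p, hp, h⟩ := h
    rcases hnb v hv p hp h with h | ⟨h1, h2, h3, h4⟩
    · rw [labN_in h]; simp
    · rw [labN_out h1]; simp [h3]
  have hnin : n ∈ tN K U S lab n t u' := (hmem n).1 (in_sees_n C hu hu' hSR hSne hn)
  have htsub : ∀ a ∈ tN K U S lab n t u', a = n ∨ a ∈ t := by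
    intro a ha
    simp only [tN, Finset.mem_filter, Finset.mem_insert] at ha
    exact ha.1
  have adjY : ∀ a ∈ t, a ∈ tN K U S lab n t u' → ∃ p ∈ Reg K (U \ S) u', ∃ q ∈ Cl a, K.Adj p q := by
    intro a hat ha'
    obtain ⟨v, hv, rfl, p, hp, h⟩ := (hmem a).2 ha'
    rcases hnb v hv p hp h with hh | ⟨h1, h2, h3, h4⟩
    · rw [labN_in hh] at hat; exact absurd hat hnt
    · rw [labN_out h1]; exact ⟨p, hp, _, h4, h⟩
  have hmiss : t.card = 3 → ∃ x ∈ t, x ∉ tN K U S lab n t u' := by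
    intro h3
    by_contra hno
    push Not at hno
    obtain ⟨a, b, c, hab, hac, hbc, rfl⟩ := Finset.card_eq_three.1 h3
    obtain ⟨τ, hτ⟩ := G.tau
    have ma : a ∈ ({a,b,c} : Finset ℕ) := by simp
    have mb : b ∈ ({a,b,c} : Finset ℕ) := by simp
    have mc : c ∈ ({a,b,c} : Finset ℕ) := by simp
    have dS : ∀ x ∈ ({a,b,c} : Finset ℕ), Disjoint (insert (inr f) (inl '' S)) (Cl x) := fun x hx =>
      (G.dB x hx).mono_left hSB
    have dY : ∀ x ∈ ({a,b,c} : Finset ℕ), Disjoint (Reg K (U \ S) u') (Cl x) := fun x hx =>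
      (G.dB x hx).mono_left hBB
    exact K.K33 (G.conn a ma) (G.conn b mb) (G.conn c mc) hc (reg_conn u') (G.dd _ ma _ mb hab) (G.dd _ mb _ mc hbc)
      (G.dd _ mc _ ma hac.symm) (dS a ma) (dS b mb) (dS c mc) (dY a ma) (dY b mb) (dY c mc) hBS τ (hτ a ma) (hτ b mb)
      (hτ c mc) (ha a ma) (ha b mb) (ha c mc) (adjY a ma (hno a ma)) (adjY b mb (hno b mb)) (adjY c mc (hno c mc))
  refine ⟨⟨?_, hmem, ?_, ?_, ?_, ?_, ?_⟩, hnin, hmiss⟩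
  · have h1 : (tN K U S lab n t u').card ≤ (insert n t).card := Finset.card_filter_le _ _
    rw [Finset.card_insert_of_notMem hnt] at h1
    have := G.card
    by_cases h3 : t.card = 3
    · obtain ⟨x, hx, hx'⟩ := hmiss h3
      have : tN K U S lab n t u' ⊆ insert n (t.erase x) := by
        intro a ha
        rcases htsub a ha with rfl | h
        · simp
        · simp only [Finset.mem_insert, Finset.mem_erase]
          right; exact ⟨fun e => hx' (e ▸ ha), h⟩
      have := Finset.card_le_card this
      have h5 := Finset.card_insert_le n (t.erase x)
      rw [Finset.card_erase_of_mem hx] at h5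
      omega
    · omega
  · intro a hat
    unfold ClN
    split_ifs with e
    · apply ConnS_star hc ⟨inr f, by simp⟩
      · intro b hb; exact G.conn b (Finset.mem_sdiff.1 hb).1
      · intro b hb; exact ha b (Finset.mem_sdiff.1 hb).1
    · exact G.conn a ((htsub a hat).resolve_left e)
  · intro a hat
    unfold ClN
    split_ifs with e
    · rw [Set.disjoint_union_right]
      refine ⟨hBS, ?_⟩
      simp only [Set.disjoint_iUnion_right]
      intro b hb; exact (G.dB b (Finset.mem_sdiff.1 hb).1).mono_left hBB
    · exact (G.dB a ((htsub a hat).resolve_left e)).mono_left hBB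
  · have key : ∀ b ∈ tN K U S lab n t u', b ≠ n → Disjoint (insert (inr f) (inl '' S) ∪ ⋃ c ∈ t \ tN K U S lab n t u', Cl c) (Cl b) := by
      intro b hb hbn
      have hbt := (htsub b hb).resolve_left hbn
      rw [Set.disjoint_union_left]
      refine ⟨(G.dB b hbt).mono_left hSB, ?_⟩
      simp only [Set.disjoint_iUnion_left]
      intro c hc
      rw [Finset.mem_sdiff] at hc
      exact G.dd c hc.1 b hbt (fun e => hc.2 (e ▸ hb))
    intro a hat b hbt hab
    unfold ClN
    split_ifs with e e' e'
    · exact absurd (e.trans e'.symm) hab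
    · exact key b hbt e'
    · exact (key a hat e).symm
    · exact G.dd a ((htsub a hat).resolve_left e) b ((htsub b hbt).resolve_left e') hab
  · intro v hv p hp h
    rcases hnb v hv p hp h with hh | ⟨h1, h2, h3, h4⟩
    · rw [labN_in hh]; simp only [ClN, if_true]; left; right; exact ⟨v, hh, rfl⟩
    · rw [labN_out h1]
      simp only [ClN]
      rw [if_neg (fun e : lab v = n => hnt (e ▸ h3))]; exact h4
  · by_cases h3 : t.card = 3
    · obtain ⟨τ, hτ⟩ := G.tau
      refine ⟨τ, fun a hat => ?_⟩
      unfold ClN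
      split_ifs with e
      · obtain ⟨x, hx, hx'⟩ := hmiss h3
        obtain ⟨y, hy, h⟩ := hτ x hx
        refine ⟨y, Or.inr ?_, h⟩
        simp only [Set.mem_iUnion]
        exact ⟨x, Finset.mem_sdiff.2 ⟨hx, hx'⟩, hy⟩
      · exact hτ a ((htsub a hat).resolve_left e)
    · obtain ⟨τ, hτf, hτ⟩ := hτ (by have := G.card; omega)
      refine ⟨τ, fun a hat => ?_⟩
      unfold ClN
      split_ifs with e
      · exact ⟨inr f, Or.inl (by simp), hτf⟩
      · exact hτ a ((htsub a hat).resolve_left e)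

end step


open Sum

section st
variable {V F L D : Type} [Fintype V] [Fintype F] [Fintype L] [Fintype D]

structure St (K : Sph (V ⊕ F) L D) (T : SimpleGraph V) (r : V) (d : ℕ) (U0 : Set V) (U : Set V) (lab : V → ℕ)
    (n : ℕ) (Fc bags : Finset (Finset ℕ)) : Prop where
  apo : Apo n Fc bags
  sub : U ⊆ U0
  lab0 : ∀ v, v ∉ U0 → lab v = 0
  lab1 : ∀ v ∈ U0, v ∉ U → 4 ≤ lab v ∧ lab v < n
  parts : ∀ z, 4 ≤ z → z < n → PartOK T r d {v | v ∈ U0 ∧ v ∉ U ∧ lab v = z}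
  faces : ∀ f, (∀ v, K.Adj (inr f) (inl v) → v ∉ U) → ∃ b ∈ bags, ∀ v, K.Adj (inr f) (inl v) → lab v ∈ b
  good : ∀ u ∈ U, ∃ t Cl, GoodB K U lab (Reg K U u) t Cl ∧ ∃ s ∈ Fc, t ⊆ s
  uq : ∀ u ∈ U, ∀ u' ∈ U, ∀ a b c, a ≠ b → b ≠ c → a ≠ c →
    (∀ x ∈ ({a, b, c} : Finset ℕ), Sees K U lab (Reg K U u) x ∧ Sees K U lab (Reg K U u') x) →
    Reg K U u = Reg K U u'

variable {K : Sph (V ⊕ F) L D} {T : SimpleGraph V} {r : V} {d : ℕ} {U0 P U : Set V}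

theorem st_init (C : Ctx K T r d U0 P) : St K T r d U0 U0 (fun _ => 0) 4 apoBase {{0,1,2,3}} := by
  classical
  refine ⟨Apo.base, le_refl _, fun _ _ => rfl, fun v h h' => absurd h h', fun z h1 h2 => by omega, ?_, ?_, ?_⟩
  · intro f _
    exact ⟨{0,1,2,3}, by simp, fun _ _ => by simp⟩
  · intro u hu
    have hP : ∀ v, v ∉ U0 → ∀ p ∈ Reg K U0 u, K.Adj p (inl v) → v ∈ P := by
      intro v hv p hp h
      obtain ⟨f, hf, hfv⟩ := face_nbr C hu hp h
      obtain ⟨w, hw, hfw⟩ := mem_fre_inr.1 (reg_sub hu hf)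
      exact (C.nb w hw f hfw v hfv).resolve_left hv
    refine ⟨({0} : Finset ℕ).filter (fun a => Sees K U0 (fun _ => 0) (Reg K U0 u) a), fun _ => inl '' P, ⟨?_, ?_, ?_, ?_, ?_, ?_, ?_⟩, {0,1,2}, by simp [apoBase], ?_⟩
    · exact (Finset.card_filter_le _ _).trans (by simp)
    · intro a
      simp only [Finset.mem_filter, Finset.mem_singleton]
      refine ⟨fun h => ⟨?_, h⟩, fun h => h.2⟩
      obtain ⟨v, _, h, _⟩ := h
      exact h.symm
    · intro a _; exact C.Pc
    · intro a _
      rw [Set.disjoint_left]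
      rintro x hx ⟨v, hv, rfl⟩
      exact C.PU v hv (mem_fre_inl.1 (reg_sub hu hx))
    · intro a ha b hb hab
      simp only [Finset.mem_filter, Finset.mem_singleton] at ha hb
      exact absurd (ha.1.trans hb.1.symm) hab
    · intro v hv p hp h
      exact ⟨v, hP v hv p hp h, rfl⟩
    · by_cases h : Sees K U0 (fun _ => 0) (Reg K U0 u) 0
      · obtain ⟨v, hv, _, p, hp, h⟩ := h
        obtain ⟨τ, _, h2⟩ := K.exists_tri h
        exact ⟨τ, fun a _ => ⟨inl v, ⟨v, hP v hv p hp h, rfl⟩, h2⟩⟩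
      · obtain ⟨f, hf⟩ := C.inface u
        obtain ⟨τ, _, h2⟩ := K.exists_tri hf
        refine ⟨τ, fun a ha => ?_⟩
        simp only [Finset.mem_filter, Finset.mem_singleton] at ha
        obtain ⟨rfl, ha⟩ := ha
        exact absurd ha h
    · intro a ha
      simp only [Finset.mem_filter, Finset.mem_singleton] at ha
      simp [ha.1]
  · intro u _ u' _ a b c hab _ _ h
    obtain ⟨⟨v, _, h1, _⟩, _⟩ := h a (by simp)
    obtain ⟨⟨v', _, h2, _⟩, _⟩ := h b (by simp)
    exact absurd (h1.symm.trans h2) hab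

theorem st_step (C : Ctx K T r d U0 P) {lab : V → ℕ} {n : ℕ} {Fc bags : Finset (Finset ℕ)}
    (I : St K T r d U0 U lab n Fc bags) (hne : U.Nonempty) :
    ∃ U' lab' n' Fc' bags', U' ⊂ U ∧ St K T r d U0 U' lab' n' Fc' bags' := by
  classical
  -- choose region
  have hchoose : ∃ u ∈ U, ∃ t Cl, GoodB K U lab (Reg K U u) t Cl ∧ ∃ s ∈ Fc, t ⊆ s ∧
      (t.card ≠ 3 → ∀ u' ∈ U, ∀ t' Cl', GoodB K U lab (Reg K U u') t' Cl' → t'.card ≠ 3) := by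
    by_cases h : ∃ u ∈ U, ∃ t Cl, GoodB K U lab (Reg K U u) t Cl ∧ t.card = 3
    · obtain ⟨u, hu, t, Cl, hG, h3⟩ := h
      obtain ⟨t2, Cl2, hG2, s, hs, hts⟩ := I.good u hu
      have : t = t2 := by ext a; rw [← hG.sees, hG2.sees]
      exact ⟨u, hu, t, Cl, hG, s, hs, this ▸ hts, fun h => absurd h3 h⟩
    · obtain ⟨u, hu⟩ := hne
      obtain ⟨t2, Cl2, hG2, s, hs, hts⟩ := I.good u hu
      exact ⟨u, hu, t2, Cl2, hG2, s, hs, hts, fun _ u' hu' t' Cl' hG' h3 => h ⟨u', hu', t', Cl', hG', h3⟩⟩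
  obtain ⟨u, hu, t, Cl, G, s, hs, hts, hprio⟩ := hchoose
  obtain ⟨S, f, hSU, hSok, hSR, hf, hfS, hSc, ha, hτ⟩ := chunk C I.sub hu G
  have hSne := hSok.1
  obtain ⟨hn4, hFc, _⟩ := I.apo.basic
  have hsn : ∀ a ∈ s, a < n := (hFc s hs).2
  have hs3 : s.card = 3 := (hFc s hs).1
  have htn : ∀ a ∈ t, a < n := fun a h => hsn a (hts h)
  have hlabn : ∀ v, v ∉ U → lab v < n := by
    intro v hv
    by_cases h : v ∈ U0
    · exact (I.lab1 v h hv).2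
    · rw [I.lab0 v h]; omega
  have hin := fun (u' : V) (hu' : u' ∈ U \ S) (hn : (inl u' : V ⊕ F) ∈ Reg K U u) =>
    in_good C hu hu' hSU hSR hSne hn G htn hf hfS hSc ha hτ
  refine ⟨U \ S, labN lab S n, n + 1, _, _, ?_, Apo.step I.apo hs, ?_, ?_, ?_, ?_, ?_, ?_, ?_⟩
  · refine ⟨Set.sdiff_subset, fun h => ?_⟩
    obtain ⟨v, hv⟩ := hSne
    exact (h (hSU hv)).2 hv
  · exact Set.sdiff_subset.trans I.sub
  · intro v hv
    rw [labN_out (fun h => hv (I.sub (hSU h)))]; exact I.lab0 v hv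
  · intro v hv hv'
    by_cases hvS : v ∈ S
    · rw [labN_in hvS]; omega
    · rw [labN_out hvS]
      have := I.lab1 v hv (fun h => hv' ⟨h, hvS⟩)
      omega
  · intro z hz hzn
    by_cases e : z = n
    · have : {v | v ∈ U0 ∧ v ∉ U \ S ∧ labN lab S n v = z} = S := by
        ext v
        simp only [Set.mem_ofPred_eq]
        constructor
        · rintro ⟨h1, h2, h3⟩
          by_contra hvS
          rw [labN_out hvS] at h3
          have := hlabn v (fun h => h2 ⟨h, hvS⟩)
          omega
        · intro h; exact ⟨I.sub (hSU h), fun hh => hh.2 h, (labN_in h).trans e.symm⟩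
      rw [this]; exact hSok
    · have : {v | v ∈ U0 ∧ v ∉ U \ S ∧ labN lab S n v = z} = {v | v ∈ U0 ∧ v ∉ U ∧ lab v = z} := by
        ext v
        simp only [Set.mem_ofPred_eq]
        constructor
        · rintro ⟨h1, h2, h3⟩
          have hvS : v ∉ S := fun h => e ((labN_in h ▸ h3).symm)
          rw [labN_out hvS] at h3
          exact ⟨h1, fun h => h2 ⟨h, hvS⟩, h3⟩
        · rintro ⟨h1, h2, h3⟩
          exact ⟨h1, fun hh => h2 hh.1, by rw [labN_out (fun h => h2 (hSU h))]; exact h3⟩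
      rw [this]; exact I.parts z hz (by omega)
  · intro g hg
    by_cases hold : ∀ v, K.Adj (inr g) (inl v) → v ∉ U
    · obtain ⟨b, hb, h⟩ := I.faces g hold
      refine ⟨b, Finset.mem_insert_of_mem hb, fun v hv => ?_⟩
      rw [labN_out (fun h => hold v hv (hSU h))]; exact h v hv
    · push Not at hold
      obtain ⟨w, hw, hwU⟩ := hold
      have hwS : w ∈ S := by by_contra hh; exact hg w hw ⟨hwU, hh⟩
      have hgR : inr g ∈ Reg K U u := reg_face C hu (hSR ⟨w, hwS, rfl⟩) hw.symm
      refine ⟨insert n s, Finset.mem_insert_self _ _, fun v hv => ?_⟩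
      by_cases hvS : v ∈ S
      · rw [labN_in hvS]; simp
      · rw [labN_out hvS]
        have hvU : v ∉ U := fun h => hg v hv ⟨h, hvS⟩
        exact Finset.mem_insert_of_mem (hts ((G.sees _).1 ⟨v, hvU, rfl, _, hgR, hv⟩))
  · intro u' hu'
    by_cases hR : (inl u' : V ⊕ F) ∈ Reg K U u
    · obtain ⟨h1, h2, h3⟩ := hin u' hu' hR
      refine ⟨_, _, h1, ?_⟩
      have htsub : ∀ a ∈ tN K U S lab n t u', a = n ∨ a ∈ t := by
        intro a ha
        simp only [tN, Finset.mem_filter, Finset.mem_insert] at ha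
        exact ha.1
      have : ∃ x ∈ s, x ∉ tN K U S lab n t u' := by
        by_cases ht3 : t.card = 3
        · obtain ⟨x, hx, hx'⟩ := h3 ht3
          exact ⟨x, hts hx, hx'⟩
        · have : ¬ s ⊆ t := fun h => by
            have := Finset.card_le_card h
            have := G.card
            omega
          obtain ⟨x, hx, hx'⟩ := Finset.not_subset.1 this
          refine ⟨x, hx, fun h => ?_⟩
          rcases htsub x h with e | h
          · have := hsn x hx; omega
          · exact hx' h
      obtain ⟨x, hx, hx'⟩ := this
      refine ⟨insert n (s.erase x), Finset.mem_union_right _ (Finset.mem_image.2 ⟨x, hx, rfl⟩), ?_⟩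
      intro a ha
      rcases htsub a ha with rfl | h
      · simp
      · exact Finset.mem_insert_of_mem (Finset.mem_erase.2 ⟨fun e => hx' (e ▸ ha), hts h⟩)
    · obtain ⟨t2, Cl2, hG2, s2, hs2, hts2⟩ := I.good u' hu'.1
      refine ⟨t2, Cl2, out_good hu hu' hSR hSU hR hG2, ?_⟩
      by_cases e : s2 = s
      · subst e
        by_cases h3 : t2.card = 3
        · exfalso
          have ht3 : t.card = 3 := by
            by_contra hh
            exact hprio hh u' hu'.1 t2 Cl2 hG2 h3
          have e1 : t = s2 := Finset.eq_of_subset_of_card_le hts (by omega)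
          have e2 : t2 = s2 := Finset.eq_of_subset_of_card_le hts2 (by omega)
          obtain ⟨a, b, c, hab, hac, hbc, hsabc⟩ := Finset.card_eq_three.1 hs3
          apply hR
          rw [I.uq u hu u' hu'.1 a b c hab hbc hac ?_]
          · exact self_reg _
          · intro x hx
            rw [← hsabc] at hx
            exact ⟨(G.sees x).2 (e1 ▸ hx), (hG2.sees x).2 (e2 ▸ hx)⟩
        · have : ¬ s2 ⊆ t2 := fun h => by
            have := Finset.card_le_card h
            have := hG2.card
            omega
          obtain ⟨x, hx, hx'⟩ := Finset.not_subset.1 this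
          refine ⟨insert n (s2.erase x), Finset.mem_union_right _ (Finset.mem_image.2 ⟨x, hx, rfl⟩), ?_⟩
          intro a ha
          exact Finset.mem_insert_of_mem (Finset.mem_erase.2 ⟨fun e => hx' (e ▸ ha), hts2 ha⟩)
      · exact ⟨s2, Finset.mem_union_left _ (Finset.mem_erase.2 ⟨e, hs2⟩), hts2⟩
  · have hset : ∀ u' ∈ U \ S, (inl u' : V ⊕ F) ∈ Reg K U u → ∀ a b c, a ≠ b → b ≠ c → a ≠ c →
        (∀ x ∈ ({a, b, c} : Finset ℕ), Sees K (U \ S) (labN lab S n) (Reg K (U \ S) u') x) →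
        tN K U S lab n t u' = {a, b, c} := by
      intro u' hu' hR a b c hab hbc hac h
      obtain ⟨h1, _⟩ := hin u' hu' hR
      symm
      apply Finset.eq_of_subset_of_card_le
      · intro x hx; exact (h1.sees x).1 (h x hx)
      · rw [Finset.card_eq_three.2 ⟨a, b, c, hab, hac, hbc, rfl⟩]; exact h1.card
    have hmix : ∀ u1 ∈ U \ S, ∀ u2 ∈ U \ S, (inl u1 : V ⊕ F) ∈ Reg K U u → (inl u2 : V ⊕ F) ∉ Reg K U u →
        ∀ a b c, a ≠ b → b ≠ c → a ≠ c →
        (∀ x ∈ ({a, b, c} : Finset ℕ), Sees K (U \ S) (labN lab S n) (Reg K (U \ S) u1) x) →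
        (∀ x ∈ ({a, b, c} : Finset ℕ), Sees K (U \ S) (labN lab S n) (Reg K (U \ S) u2) x) → False := by
      intro u1 hu1 u2 hu2 hR1 hR2 a b c hab hbc hac h1 h2
      have e := hset u1 hu1 hR1 a b c hab hbc hac h1
      have hn := (hin u1 hu1 hR1).2.1
      rw [e] at hn
      obtain ⟨v, hv, hvn, p, hp, h⟩ := (out_sees hu hu2 hSR hSU hR2 n).1 (h2 n hn)
      have := hlabn v hv
      omega
    intro u1 hu1 u2 hu2 a b c hab hbc hac h
    by_cases hR1 : (inl u1 : V ⊕ F) ∈ Reg K U u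
    · by_cases hR2 : (inl u2 : V ⊕ F) ∈ Reg K U u
      · by_contra hne
        have e1 := hset u1 hu1 hR1 a b c hab hbc hac (fun x hx => (h x hx).1)
        have e2 := hset u2 hu2 hR2 a b c hab hbc hac (fun x hx => (h x hx).2)
        have g1 := (hin u1 hu1 hR1).1
        have g2 := (hin u2 hu2 hR2).1
        rw [e1] at g1
        rw [e2] at g2
        have ma : a ∈ ({a,b,c} : Finset ℕ) := by simp
        have mb : b ∈ ({a,b,c} : Finset ℕ) := by simp
        have mc : c ∈ ({a,b,c} : Finset ℕ) := by simp
        have dj : Disjoint (Reg K (U \ S) u2) (Reg K (U \ S) u1) := by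
          rw [Set.disjoint_left]
          intro x hx2 hx1
          exact hne (reg_eq' hx2 hx1)
        have adj1 : ∀ x ∈ ({a,b,c} : Finset ℕ), ∃ p ∈ Reg K (U \ S) u1, ∃ q ∈ ClN n (insert (inr f) (inl '' S)) t {a,b,c} Cl x, K.Adj p q := by
          intro x hx
          obtain ⟨v, hv, rfl, p, hp, h⟩ := (h x hx).1
          exact ⟨p, hp, _, g1.nbr v hv p hp h, h⟩
        have adj2 : ∀ x ∈ ({a,b,c} : Finset ℕ), ∃ p ∈ Reg K (U \ S) u2, ∃ q ∈ ClN n (insert (inr f) (inl '' S)) t {a,b,c} Cl x, K.Adj p q := by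
          intro x hx
          obtain ⟨v, hv, rfl, p, hp, h⟩ := (h x hx).2
          exact ⟨p, hp, _, g2.nbr v hv p hp h, h⟩
        obtain ⟨τ, hτ⟩ := g1.tau
        exact K.K33 (g1.conn a ma) (g1.conn b mb) (g1.conn c mc) (reg_conn u1) (reg_conn u2) (g1.dd _ ma _ mb hab)
          (g1.dd _ mb _ mc hbc) (g1.dd _ mc _ ma hac.symm) (g1.dB a ma) (g1.dB b mb) (g1.dB c mc) (g2.dB a ma)
          (g2.dB b mb) (g2.dB c mc) dj τ (hτ a ma) (hτ b mb) (hτ c mc) (adj1 a ma) (adj1 b mb) (adj1 c mc)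
          (adj2 a ma) (adj2 b mb) (adj2 c mc)
      · exact (hmix u1 hu1 u2 hu2 hR1 hR2 a b c hab hbc hac (fun x hx => (h x hx).1) (fun x hx => (h x hx).2)).elim
    · by_cases hR2 : (inl u2 : V ⊕ F) ∈ Reg K U u
      · exact (hmix u2 hu2 u1 hu1 hR2 hR1 a b c hab hbc hac (fun x hx => (h x hx).2) (fun x hx => (h x hx).1)).elim
      · rw [out_reg hu hu1 hSR hR1, out_reg hu hu2 hSR hR2]
        exact I.uq u1 hu1.1 u2 hu2.1 a b c hab hbc hac (fun x hx => 
          ⟨(out_sees hu hu1 hSR hSU hR1 x).1 (h x hx).1, (out_sees hu hu2 hSR hSU hR2 x).1 (h x hx).2⟩)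

theorem st_main (C : Ctx K T r d U0 P) : ∃ (lab : V → ℕ) (n : ℕ) (Fc bags : Finset (Finset ℕ)), Apo n Fc bags ∧ (∀ v, v ∉ U0 → lab v = 0) ∧
    (∀ v ∈ U0, 4 ≤ lab v ∧ lab v < n) ∧ (∀ z, 4 ≤ z → z < n → PartOK T r d {v | v ∈ U0 ∧ lab v = z}) ∧
    ∀ f, ∃ b ∈ bags, ∀ v, K.Adj (inr f) (inl v) → lab v ∈ b := by
  have key : ∀ m (U : Set V) lab n Fc bags, U.ncard = m → St K T r d U0 U lab n Fc bags →
      ∃ lab n Fc bags, St K T r d U0 ∅ lab n Fc bags := by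
    intro m
    induction m using Nat.strong_induction_on with
    | _ m ih =>
      intro U lab n Fc bags hm I
      rcases U.eq_empty_or_nonempty with rfl | hne
      · exact ⟨_, _, _, _, I⟩
      · obtain ⟨U', lab', n', Fc', bags', hs, I'⟩ := st_step C I hne
        have := Set.ncard_lt_ncard hs
        exact ih _ (hm ▸ this) U' _ _ _ _ rfl I'
  obtain ⟨lab, n, Fc, bags, I⟩ := key _ U0 _ _ _ _ rfl (st_init C)
  refine ⟨lab, n, Fc, bags, I.apo, I.lab0, fun v hv => I.lab1 v hv (by simp), ?_, fun f => I.faces f (by simp)⟩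
  intro z h1 h2
  have := I.parts z h1 h2
  simpa using this

end st


theorem aux3 {V : Type} {a b c x y : V} (h1 : a ≠ b) (h2 : a ≠ c) (h3 : b ≠ c) (ha : a ≠ x → a = y)
    (hb : b ≠ x → b = y) (hc : c ≠ x → c = y) : False := by
  by_cases e1 : a = x <;> by_cases e2 : b = x <;> by_cases e3 : c = x <;> simp_all

namespace Multigraph
variable {V E F : Type} {G : Multigraph V E}

theorem int_step {emb : G.Embedding F} {EC : Set E} {fout f g : F} {e : E} (hf : f ∈ interiorFaces emb EC fout)
    (he : e ∉ EC) (h1 : (emb.boundary f).HasEdge e) (h2 : (emb.boundary g).HasEdge e) :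
    g ∈ interiorFaces emb EC fout := fun h => hf (h.tail ⟨e, he, h2, h1⟩)

theorem occ_mem {emb : G.Embedding F} {u : V} {e : E} {c p : F × ℕ} (hc : IsCorner emb.boundary u c)
    (hp : IsOcc emb.boundary e p) (h : EndOf emb.boundary c p) :
    (emb.boundary c.1).HasEdge e ∧ u ∈ G.ends e := by
  obtain ⟨f, i⟩ := c
  obtain ⟨g, j⟩ := p
  obtain ⟨h1, h2⟩ := h
  simp only at h1 h2
  subst h1
  obtain ⟨c1, c2⟩ := hc
  obtain ⟨p1, p2⟩ := hp
  simp only at c1 c2 p1 p2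
  refine ⟨⟨j, p1, p2⟩, ?_⟩
  rw [← p2, (emb.boundary f).compat j, ← c2]
  rcases h2 with rfl | rfl
  · simp
  · rw [CWalk.vtx_mod]; simp

theorem int_all {emb : G.Embedding F} {EC : Set E} {fout f g : F} {u : V} (hu : ∀ e, u ∈ G.ends e → e ∉ EC)
    (hf : f ∈ interiorFaces emb EC fout) (h1 : (emb.boundary f).HasVtx u) (h2 : (emb.boundary g).HasVtx u) :
    g ∈ interiorFaces emb EC fout := by
  obtain ⟨i, hi⟩ := h1
  obtain ⟨j, hj⟩ := h2
  have := emb.link_conn u (f, i) (g, j) hi hj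
  have key : ∀ c c', Relation.EqvGen (CornerLinked emb.boundary u) c c' →
      (c.1 ∈ interiorFaces emb EC fout ↔ c'.1 ∈ interiorFaces emb EC fout) := by
    intro c c' h
    induction h with
    | rel x y h =>
      obtain ⟨h1, h2, e, p, p', _, o1, o2, e1, e2⟩ := h
      obtain ⟨a1, a2⟩ := occ_mem h1 o1 e1
      obtain ⟨b1, b2⟩ := occ_mem h2 o2 e2
      exact ⟨fun h => int_step h (hu e a2) a1 b1, fun h => int_step h (hu e a2) b1 a1⟩
    | refl x => exact Iff.rfl
    | symm x y _ ih => exact ih.symm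
    | trans x y z _ _ ih1 ih2 => exact ih1.trans ih2
  exact (key _ _ this).1 hf

end Multigraph

open Multigraph in
/-- special case of Lemma 24 of Dujmović, Morin & Wood.
Let `d ≥ 3` and let `G⁺` be a plane multigraph each of whose faces is bounded by a
cycle of length in `{3, …, d}`.  Let `T` be a spanning tree of `G⁺` rooted at a vertex
`r` on the boundary of the outer face, and let `P` be a vertical path in `T` with
end-vertices `p₁, p₂` such that the cycle `C` obtained from `P` by adding the edge
`p₁p₂` is a subgraph of `G⁺ − r`.  Let `G` be the plane graph consisting of all
vertices and edges of `G⁺` contained in `C` and the interior of `C`.  Then `G^{(d)}`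
has an `H`-partition `𝒫` with `P ∈ 𝒫`, such that each part other than `P` has a
partition `{Xᵢ, Yᵢ}` with `|Xᵢ| ≤ d − 3` and `Yᵢ` a union of at most three vertical
paths in `T`, and `H` is planar with treewidth at most 3. -/
theorem inner_framed_partition (d : ℕ) (hd : 3 ≤ d)
    {V E F : Type} [Fintype V] [Fintype E] [Fintype F]
    (Gp : Multigraph V E) (emb : Gp.Embedding F)
    (hcyc : ∀ f, (emb.boundary f).IsCycle ∧
      3 ≤ (emb.boundary f).len ∧ (emb.boundary f).len ≤ d)
    (fout : F) (hplane : emb.eulerGenus = 0)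
    (S : Set E) (hS : Gp.IsSpanningTree S)
    (r : V) (hr : (emb.boundary fout).HasVtx r)
    (P : Set V) (p₁ p₂ : V)
    (hP : IsVerticalPathBtw (Gp.simpleOn S) r P p₁ p₂ ∨
          IsVerticalPathBtw (Gp.simpleOn S) r P p₂ p₁)
    (e₀ : E) (he₀ : Gp.ends e₀ = s(p₁, p₂)) (hp12 : p₁ ≠ p₂) (hrP : r ∉ P)
    (EC : Set E) (hEC : EC = {e | e = e₀ ∨ (e ∈ S ∧ ∀ w ∈ Gp.ends e, w ∈ P)})
    (VG : Set V) (hVG : VG = P ∪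
      {v | ∃ f ∈ Multigraph.interiorFaces emb EC fout, (emb.boundary f).HasVtx v}) :
    ∃ (W : Type) (H : SimpleGraph W) (A : W → Set ↥VG) (xP : W),
      IsHPartition ((Multigraph.innerFramedGraph emb d EC fout P).induce VG) H A ∧
      IsPlanar H ∧ TreewidthLE H 3 ∧
      Subtype.val '' A xP = P ∧
      ∀ x, x ≠ xP → ∃ X Y : Set V,
        Subtype.val '' A x = X ∪ Y ∧ X ∩ Y = ∅ ∧
        X.encard ≤ ((d - 3 : ℕ) : ℕ∞) ∧
        IsUnionOfVPaths (Gp.simpleOn S) r 3 Y := by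
  classical
  have hT := hS.1
  have hPc : p₁ ∈ P ∧ p₂ ∈ P ∧ ∀ x ∈ P, ∀ y ∈ P, CIn (Gp.simpleOn S).Adj P x y := by
    rcases hP with ⟨_, rfl⟩ | ⟨_, rfl⟩
    · exact btw_conn hT p₁ p₂
    · obtain ⟨h1, h2, h3⟩ := btw_conn hT p₂ p₁
      exact ⟨h2, h1, h3⟩
  obtain ⟨hp1, hp2, hPc⟩ := hPc
  have hECP : ∀ e ∈ EC, ∀ w ∈ Gp.ends e, w ∈ P := by
    intro e he w hw
    rw [hEC] at he
    rcases he with rfl | he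
    · rw [he₀, Sym2.mem_iff] at hw
      rcases hw with rfl | rfl <;> assumption
    · exact he.2 w hw
  have hall : ∀ u, u ∉ P → ∀ f g, f ∈ interiorFaces emb EC fout → (emb.boundary f).HasVtx u →
      (emb.boundary g).HasVtx u → g ∈ interiorFaces emb EC fout := fun u hu f g hf h1 h2 =>
    int_all (fun e hue he => hu (hECP e he u hue)) hf h1 h2
  have hVGm : ∀ v, v ∈ VG ↔ v ∈ P ∨ ∃ f ∈ interiorFaces emb EC fout, (emb.boundary f).HasVtx v := by
    intro v; rw [hVG]; rfl
  have hcyc' : ∀ f, (emb.boundary f).IsCycle ∧ 3 ≤ (emb.boundary f).len := fun f => ⟨(hcyc f).1, (hcyc f).2.1⟩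
  let K := toSph emb hcyc' hplane
  have hvf : ∀ v f, K.Adj (Sum.inl v) (Sum.inr f) ↔ (emb.boundary f).HasVtx v := adj_vf emb hcyc' hplane
  have hfv : ∀ v f, K.Adj (Sum.inr f) (Sum.inl v) ↔ (emb.boundary f).HasVtx v := fun v f =>
    ⟨fun h => (hvf v f).1 h.symm, fun h => ((hvf v f).2 h).symm⟩
  have hcommon : ∀ u v e, Gp.ends e = s(u, v) → ∃ f, (emb.boundary f).HasVtx u ∧ (emb.boundary f).HasVtx v := by
    intro u v e he
    obtain ⟨t, ht⟩ := exists_face emb e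
    have := (emb.boundary t.1).compat t.2
    rw [ht, he, Sym2.eq_iff] at this
    have k1 := (emb.boundary t.1).hasVtx_vtx t.2
    have k2 := (emb.boundary t.1).hasVtx_vtx (t.2 + 1)
    rcases this with ⟨h1, h2⟩ | ⟨h1, h2⟩
    · exact ⟨t.1, h1 ▸ k1, h2 ▸ k2⟩
    · exact ⟨t.1, h1 ▸ k2, h2 ▸ k1⟩
  have C : Ctx K (Gp.simpleOn S) r d (VG \ P) P := by
    refine ⟨adj_ff emb hcyc' hplane, ?_, ?_, ?_, ?_, hd, hT, ?_, ?_, ?_, ?_, ?_⟩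
    · intro t
      exact ⟨_, _, _, fun z => cor_iff emb hcyc' hplane z t⟩
    · intro f x y
      have inj := (hcyc f).1.1
      have h3 := (hcyc f).2.1
      have n01 : (emb.boundary f).vtx 0 ≠ (emb.boundary f).vtx 1 := fun h => by
        have := inj 0 1 (by omega) (by omega) h; omega
      have n02 : (emb.boundary f).vtx 0 ≠ (emb.boundary f).vtx 2 := fun h => by
        have := inj 0 2 (by omega) (by omega) h; omega
      have n12 : (emb.boundary f).vtx 1 ≠ (emb.boundary f).vtx 2 := fun h => by
        have := inj 1 2 (by omega) (by omega) h; omega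
      have : ∃ i, (emb.boundary f).vtx i ≠ x ∧ (emb.boundary f).vtx i ≠ y := by
        by_contra hno
        push Not at hno
        have h0 := hno 0
        have h1 := hno 1
        have h2 := hno 2
        exact aux3 n01 n02 n12 h0 h1 h2
      obtain ⟨i, h1, h2⟩ := this
      exact ⟨_, h1, h2, (hfv _ _).2 ((emb.boundary f).hasVtx_vtx i)⟩
    · intro v
      by_cases hv : v = r
      · exact ⟨fout, (hvf _ _).2 (hv ▸ hr)⟩
      · have : Nontrivial V := ⟨⟨v, r, hv⟩⟩
        obtain ⟨w, hw⟩ := emb.conn.preconnected.exists_adj_of_nontrivial v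
        obtain ⟨_, e, he⟩ := hw
        obtain ⟨f, h1, _⟩ := hcommon _ _ e he
        exact ⟨f, (hvf _ _).2 h1⟩
    · intro f
      have : {v | K.Adj (Sum.inr f) (Sum.inl v)} ⊆ (((Finset.range (emb.boundary f).len).image (emb.boundary f).vtx : Finset V) : Set V) := by
        intro v hv
        obtain ⟨i, hi, h⟩ := (hfv v f).1 hv
        simp only [Finset.coe_image, Set.mem_image, Finset.coe_range, Set.mem_Iio]
        exact ⟨i, hi, h⟩
      refine (Set.encard_le_encard this).trans ?_
      rw [Set.encard_coe_eq_coe_finsetCard]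
      have h2 := Finset.card_image_le (s := Finset.range (emb.boundary f).len) (f := (emb.boundary f).vtx)
      rw [Finset.card_range] at h2
      exact_mod_cast h2.trans (hcyc f).2.2
    · rintro u v ⟨_, e, _, he⟩
      exact (adj_vv emb hcyc' hplane u v).2 ⟨e, he⟩
    · rintro ⟨h1, h2⟩
      obtain ⟨f, hf, hfr⟩ := ((hVGm r).1 h1).resolve_left h2
      exact hall r h2 f fout hf hfr hr Relation.ReflTransGen.refl
    · intro v hv h; exact h.2 hv
    · rintro _ ⟨a, ha, rfl⟩ _ ⟨b, hb, rfl⟩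
      refine Relation.ReflTransGen.lift Sum.inl (fun x y h => ⟨⟨x, h.1, rfl⟩, ⟨y, h.2.1, rfl⟩, ?_⟩) _ _ (hPc a ha b hb)
      obtain ⟨_, e, _, he⟩ := h.2.2
      exact (adj_vv emb hcyc' hplane x y).2 ⟨e, he⟩
    · rintro u ⟨hu, huP⟩ f hfu v hfv'
      rw [hfv] at hfu hfv'
      obtain ⟨g, hg, hgu⟩ := ((hVGm u).1 hu).resolve_left huP
      by_cases hvP : v ∈ P
      · exact Or.inr hvP
      · exact Or.inl ⟨(hVGm v).2 (Or.inr ⟨f, hall u huP g f hg hgu hfu, hfv'⟩), hvP⟩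
  obtain ⟨lab, n, Fc, bags, apo, lab0, lab1, parts, faces⟩ := st_main C
  have hn4 := apo.basic.1
  have labP : ∀ v ∈ VG, lab v = 0 ↔ v ∈ P := by
    intro v hv
    constructor
    · intro h
      by_contra hvP
      have := lab1 v ⟨hv, hvP⟩
      omega
    · intro h; exact lab0 v (fun hh => hh.2 h)
  let W := {z : ℕ // z = 0 ∨ (4 ≤ z ∧ z < n)}
  let A : W → Set ↥VG := fun z => {v | lab v.1 = z.1}
  let Q := (Multigraph.innerFramedGraph emb d EC fout P).induce VG
  let H : SimpleGraph W :=
    { Adj := fun x y => x ≠ y ∧ ∃ u ∈ A x, ∃ v ∈ A y, Q.Adj u v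
      symm := ⟨fun x y ⟨h, u, hu, v, hv, huv⟩ => ⟨h.symm, v, hv, u, hu, huv.symm⟩⟩
      loopless := ⟨fun x h => h.1 rfl⟩ }
  have hadj : ∀ x y, H.Adj x y → ∃ b ∈ bags, x.1 ∈ b ∧ y.1 ∈ b := by
    rintro x y ⟨hne, u, hu, v, hv, huv⟩
    have hu : lab u.1 = x.1 := hu
    have hv : lab v.1 = y.1 := hv
    have hface : ∀ f, (emb.boundary f).HasVtx u.1 → (emb.boundary f).HasVtx v.1 → ∃ b ∈ bags, x.1 ∈ b ∧ y.1 ∈ b := by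
      intro f h1 h2
      obtain ⟨b, hb, h⟩ := faces f
      exact ⟨b, hb, hu ▸ h _ ((hfv _ _).2 h1), hv ▸ h _ ((hfv _ _).2 h2)⟩
    have hPP : u.1 ∈ P → v.1 ∈ P → False := by
      intro h1 h2
      rw [← labP _ u.2] at h1
      rw [← labP _ v.2] at h2
      exact hne (Subtype.ext (hu.symm.trans (h1.trans (h2.symm.trans hv))))
    obtain ⟨_, (⟨e, he1, he2⟩ | ⟨f, h1, h2, h3, h4⟩ | ⟨h1, h2, h3⟩)⟩ := huv
    · obtain ⟨f, h1, h2⟩ := hcommon _ _ e he2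
      exact hface f h1 h2
    · exact hface f h3 h4
    · exact (hPP h2 h3).elim
  have hlt : ∀ w : W, w.1 < n := fun w => by rcases w.2 with h | h <;> omega
  have himg : ∀ x : W, x.1 ≠ 0 → Subtype.val '' A x = {v | v ∈ VG \ P ∧ lab v = x.1} := by
    intro x hx
    ext v
    constructor
    · rintro ⟨w, hw, rfl⟩
      have hw : lab w.1 = x.1 := hw
      exact ⟨⟨w.2, fun h => hx (hw ▸ (labP _ w.2).2 h)⟩, hw⟩
    · rintro ⟨h1, h2⟩
      exact ⟨⟨v, h1.1⟩, h2, rfl⟩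
  have hpart : ∀ x : W, x.1 ≠ 0 → PartOK (Gp.simpleOn S) r d (Subtype.val '' A x) := by
    intro x hx
    rw [himg x hx]
    have := x.2.resolve_left hx
    exact parts x.1 this.1 this.2
  have hPVG : ∀ v ∈ P, v ∈ VG := fun v hv => (hVGm v).2 (Or.inl hv)
  have himg0 : Subtype.val '' A ⟨0, Or.inl rfl⟩ = P := by
    ext v
    constructor
    · rintro ⟨w, hw, rfl⟩
      exact (labP _ w.2).1 hw
    · intro h
      exact ⟨⟨v, hPVG v h⟩, (labP _ (hPVG v h)).2 h, rfl⟩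
  refine ⟨W, H, A, ⟨0, Or.inl rfl⟩, ⟨?_, ?_, ?_⟩, apo.planar H Subtype.val Subtype.val_injective hlt hadj,
    apo.treewidth H Subtype.val Subtype.val_injective hlt hadj, himg0, ?_⟩
  · intro x
    by_cases hx : x.1 = 0
    · exact ⟨⟨p₁, hPVG _ hp1⟩, ((labP _ (hPVG _ hp1)).2 hp1).trans hx.symm⟩
    · exact Set.image_nonempty.1 (hpart x hx).1
  · intro v
    have : lab v.1 = 0 ∨ (4 ≤ lab v.1 ∧ lab v.1 < n) := by
      by_cases h : v.1 ∈ P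
      · exact Or.inl ((labP _ v.2).2 h)
      · exact Or.inr (lab1 _ ⟨v.2, h⟩)
    refine ⟨⟨lab v.1, this⟩, rfl, fun y hy => ?_⟩
    exact Subtype.ext (Eq.symm hy)
  · intro x y hxy
    exact ⟨fun h => h.2, fun h => ⟨hxy, h⟩⟩
  · intro x hx
    exact (hpart x (fun h => hx (Subtype.ext h))).2
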